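/- Let A ≥ 3 be a real number and let f be defined on configurations q = (q_1, q_2, q_3, q_4) of four distinct points in ℝ² by f(q) = 2·∑_{k=1}^{4} |q_k|² + (1/(A−2))·∑_{1≤k<l≤4} |q_k − q_l|^{2−A} (four equal unit masses, total mass 4). The set of critical points of f is invariant under the diagonal action of the rotation group SO(2) on (ℝ²)⁴ and is the union of exactly 50 SO(2)-orbits; of these orbits, exactly 6 have Morse index 0, exactly 24 have Morse index 1, and exactly 20 have Morse index 2, where the Morse index of a critical point is the maximal dimension of a linear subspace of (ℝ²)⁴ ≅ ℝ⁸ on which the Hessian quadratic form of f is negative definite. Equivalently, the Morse polynomial of f on the quotient configuration space is 6 + 24t + 20t². -/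

import Mathlib

open Real Finset

/-- The set of planar central configurations: `N`-tuples of pairwise distinct points of the
plane (modeled by `ℂ`) at which the gradient of `f` vanishes. -/
def critSet (N : ℕ) (f : (Fin N → ℂ) → ℝ) : Set (Fin N → ℂ) :=
  {q | (∀ k l, k ≠ l → q k ≠ q l) ∧ fderiv ℝ f q = 0}

/-- The orbit of a planar configuration under the diagonal action of the rotation group
`SO(2)` (acting as multiplication by unit complex numbers). -/
def rotOrbit (N : ℕ) (q : Fin N → ℂ) : Set (Fin N → ℂ) :=
  {p | ∃ u : ℂ, ‖u‖ = 1 ∧ p = fun k => u * q k}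

/-- The Morse index of `f` at `q`: the maximal dimension of a linear subspace on which the
Hessian quadratic form `v ↦ D²f(q)(v,v)` of `f` at `q` is negative definite. -/
noncomputable def morseIndex {E : Type*} [NormedAddCommGroup E] [NormedSpace ℝ E]
    (f : E → ℝ) (q : E) : ℕ :=
  sSup {n : ℕ | ∃ V : Submodule ℝ E, Module.finrank ℝ V = n ∧
    ∀ v ∈ V, v ≠ 0 → fderiv ℝ (fderiv ℝ f) q v v < 0}

/-- The squared-distance function of the dual problem. -/
noncomputable def ps (a t : ℝ) : ℝ := (1 - t) ^ (-a)

lemma ps_pos {a t : ℝ} (ht : t < 1) : 0 < ps a t := Real.rpow_pos_of_pos (by linarith) _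

lemma ps_zero (a : ℝ) : ps a 0 = 1 := by simp [ps]

lemma ps_lt {a s t : ℝ} (ha : 0 < a) (hst : s < t) (ht : t < 1) : ps a s < ps a t := by
  unfold ps
  exact Real.rpow_lt_rpow_of_neg (by linarith) (by linarith) (by linarith)

lemma ps_le {a s t : ℝ} (ha : 0 < a) (hst : s ≤ t) (ht : t < 1) : ps a s ≤ ps a t := by
  rcases hst.eq_or_lt with h | h
  · rw [h]
  · exact (ps_lt ha h ht).le

lemma ps_convex {a : ℝ} (ha : 0 < a) : ConvexOn ℝ (Set.Iio 1) (ps a) := by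
  refine ⟨convex_Iio 1, fun x hx y hy c d hc hd hcd => ?_⟩
  have hx' : 0 < 1 - x := by simpa using hx
  have hy' : 0 < 1 - y := by simpa using hy
  have e : 1 - (c • x + d • y) = c • (1 - x) + d • (1 - y) := by
    simp only [smul_eq_mul]; linear_combination -hcd
  have hl := strictConcaveOn_log_Ioi.concaveOn.2 (x := 1 - x) hx' (y := 1 - y) hy' hc hd hcd
  have hp : 0 < c • (1 - x) + d • (1 - y) := by
    have := (convex_Ioi (0:ℝ)) (x := 1 - x) hx' (y := 1 - y) hy' hc hd hcd
    exact this
  have he := convexOn_exp.2 (x := Real.log (1 - x) * (-a)) (Set.mem_univ _)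
    (y := Real.log (1 - y) * (-a)) (Set.mem_univ _) hc hd hcd
  unfold ps
  rw [e, Real.rpow_def_of_pos hp, Real.rpow_def_of_pos hx', Real.rpow_def_of_pos hy']
  refine le_trans (Real.exp_le_exp.2 ?_) he
  simp only [smul_eq_mul] at hl ⊢
  nlinarith

/-- Difference quotient. -/
noncomputable def sl (a s t : ℝ) : ℝ := (ps a s - ps a t) / (s - t)

lemma sl_comm (a s t : ℝ) : sl a s t = sl a t s := by
  unfold sl; rw [← neg_sub (ps a t), ← neg_sub t s, neg_div_neg_eq]

lemma sl_mono_left {a s s' t : ℝ} (ha : 0 < a) (hs : s ≤ s') (hs1 : s' < 1) (ht1 : t < 1)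
    (h1 : s ≠ t) (h2 : s' ≠ t) : sl a s t ≤ sl a s' t :=
  (ps_convex ha).secant_mono (a := t) (x := s) (y := s') ht1 (lt_of_le_of_lt hs hs1) hs1 h1 h2 hs

lemma sl_mono {a s s' t t' : ℝ} (ha : 0 < a) (hs : s ≤ s') (ht : t ≤ t') (hs1 : s' < 1)
    (ht1 : t' < 1) (h1 : s ≠ t) (h2 : s' ≠ t') : sl a s t ≤ sl a s' t' := by
  by_cases h : s' = t
  · have h3 : s ≠ t' := by
      intro h3; apply h1; apply le_antisymm <;> linarith
    calc sl a s t = sl a t s := sl_comm ..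
      _ ≤ sl a t' s := sl_mono_left ha ht ht1 (by linarith) (Ne.symm h1) (Ne.symm h3)
      _ = sl a s t' := sl_comm ..
      _ ≤ sl a s' t' := sl_mono_left ha hs hs1 ht1 h3 h2
  · calc sl a s t ≤ sl a s' t := sl_mono_left ha hs hs1 (by linarith) h1 h
      _ = sl a t s' := sl_comm ..
      _ ≤ sl a t' s' := sl_mono_left ha ht ht1 hs1 (Ne.symm h) (Ne.symm h2)
      _ = sl a s' t' := sl_comm ..

lemma sl_pos {a s t : ℝ} (ha : 0 < a) (hs : s < 1) (ht : t < 1) (h : s ≠ t) : 0 < sl a s t := by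
  rcases lt_or_gt_of_ne h with h | h
  · exact div_pos_of_neg_of_neg (by linarith [ps_lt ha h ht]) (by linarith)
  · exact div_pos (by linarith [ps_lt ha h hs]) (by linarith)

/-- Gradient component of the dual function. -/
noncomputable def Eg (a p q r s : ℝ) : ℝ := q * ps a (p*q) + r * ps a (p*r) + s * ps a (p*s)

lemma pair_eq {a p q r s : ℝ} (h : Eg a p q r s = Eg a q p r s) (hpq : p ≠ q)
    (hr : r ≠ 0) (hs : s ≠ 0) :
    ps a (p*q) = r^2 * sl a (p*r) (q*r) + s^2 * sl a (p*s) (q*s) := by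
  unfold Eg at h
  unfold sl
  have h1 : p * r - q * r ≠ 0 := by rw [← sub_mul]; exact mul_ne_zero (sub_ne_zero.2 hpq) hr
  have h2 : p * s - q * s ≠ 0 := by rw [← sub_mul]; exact mul_ne_zero (sub_ne_zero.2 hpq) hs
  have h3 : p - q ≠ 0 := sub_ne_zero.2 hpq
  rw [mul_comm q p] at h
  have e1 : p * r - q * r = (p - q) * r := by ring
  have e2 : p * s - q * s = (p - q) * s := by ring
  rw [e1, e2]
  field_simp
  linear_combination -h

/-- Concave case: two of the three like-signed weights coincide. -/
lemma concave_sym {a s x y z : ℝ} (ha : 0 < a) (hs : 0 < s) (hx : 0 < x) (hxy : x < y) (hyz : y < z)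
    (h1 : y * z < 1)
    (e1 : Eg a x y z (-s) = Eg a y x z (-s)) (e2 : Eg a y z x (-s) = Eg a z y x (-s)) : False := by
  have hy : 0 < y := by linarith
  have hz : 0 < z := by linarith
  have p1 := pair_eq e1 (by linarith) hz.ne' (by linarith)
  have p2 := pair_eq e2 (by linarith) hx.ne' (by linarith)
  have b1 : x * y < y * z := by nlinarith
  have b2 : x * z < y * z := by nlinarith
  have l1 : ps a (x*y) < ps a (y*z) := ps_lt ha b1 h1
  have l2 : sl a (y*x) (z*x) ≤ sl a (x*z) (y*z) :=
    sl_mono ha (by nlinarith) (by nlinarith) (by linarith) h1 (by nlinarith) (by linarith)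
  have l3 : sl a (y * -s) (z * -s) ≤ sl a (x * -s) (y * -s) :=
    sl_mono ha (by nlinarith) (by nlinarith) (by nlinarith) (by nlinarith)
      (by nlinarith) (by nlinarith)
  have l4 : 0 < sl a (y*x) (z*x) := sl_pos ha (by linarith) (by linarith) (by nlinarith)
  have l5 : x^2 * sl a (y*x) (z*x) ≤ z^2 * sl a (x*z) (y*z) := by
    apply mul_le_mul _ l2 l4.le (by positivity)
    nlinarith
  have l6 := mul_le_mul_of_nonneg_left l3 (sq_nonneg (-s))
  linarith

/-- Convex case with an ordering of the absolute values: all four coincide. -/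
lemma convex_sym {a al be ga ka : ℝ} (ha : 0 < a) (hga : 0 < ga) (h1 : ga ≤ be) (h2 : be ≤ al)
    (h3 : al ≤ ka) (hsum : al + be = ga + ka) (hab : al * be < 1) (hgk : ga * ka < 1)
    (e12 : Eg a (-al) (-be) ga ka = Eg a (-be) (-al) ga ka)
    (e34 : Eg a ga ka (-al) (-be) = Eg a ka ga (-al) (-be))
    (e23 : Eg a (-be) ga (-al) ka = Eg a ga (-be) (-al) ka) : al = be ∧ ga = ka := by
  have hbe : 0 < be := by linarith
  have hal : 0 < al := by linarith
  have hka : 0 < ka := by linarith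
  have p3 := pair_eq e23 (by linarith) (by linarith) hka.ne'
  have q1 : 0 < al * be := by positivity
  have q2 : 0 < ga * ka := by positivity
  have q3 : 0 < be * ga := by positivity
  have q4 : 0 < be * ka := by positivity
  have q5 : 0 < al * ga := by positivity
  have q6 : 0 < al * ka := by positivity
  have hab' : al = be := by
    by_contra hne
    have hlt : be < al := lt_of_le_of_ne h2 (Ne.symm hne)
    have p1 := pair_eq e12 (by intro h; linarith) hga.ne' hka.ne'
    have l1 : ps a (-be * ga) < ps a (-al * -be) := ps_lt ha (by nlinarith) (by linarith)
    have l2 : sl a (-al * ga) (-be * ga) ≤ sl a (-be * -al) (ga * -al) := by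
      rw [sl_comm]
      exact sl_mono ha (by linarith) (by linarith) (by linarith) (by linarith)
        (by nlinarith) (by nlinarith)
    have l3 : sl a (-al * ka) (-be * ka) ≤ sl a (-be * ka) (ga * ka) :=
      sl_mono ha (by nlinarith) (by nlinarith) (by linarith) hgk (by nlinarith) (by nlinarith)
    have l4 : 0 < sl a (-al * ga) (-be * ga) := sl_pos ha (by linarith) (by linarith) (by nlinarith)
    have l5 : ga^2 * sl a (-al * ga) (-be * ga) ≤ (-al)^2 * sl a (-be * -al) (ga * -al) :=
      mul_le_mul (by nlinarith) l2 l4.le (by positivity)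
    have l6 := mul_le_mul_of_nonneg_left l3 (sq_nonneg ka)
    linarith
  refine ⟨hab', ?_⟩
  by_contra hne
  have hlt : ga < ka := lt_of_le_of_ne (by linarith) hne
  subst hab'
  have p1 := pair_eq e34 hne (by linarith) (by linarith)
  have m1 : al * ga < al * ka := mul_lt_mul_of_pos_left hlt hal
  have m2 : al * ga ≤ al * al := mul_le_mul_of_nonneg_left h1 hal.le
  have m3 : al * al ≤ al * ka := mul_le_mul_of_nonneg_left h3 hal.le
  have m4 : al * al ≤ ka * ka := mul_le_mul h3 h3 hal.le hka.le
  have l1 : ps a (-al * ga) < ps a (ga * ka) := ps_lt ha (by linarith) hgk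
  have l2 : sl a (ga * -al) (ka * -al) ≤ sl a (-al * -al) (ga * -al) :=
    sl_mono ha (by linarith) (by linarith) (by linarith) (by linarith) (by intro h; linarith)
      (by intro h; linarith)
  have l3 : sl a (ga * -al) (ka * -al) ≤ sl a (-al * ka) (ga * ka) := by
    rw [sl_comm]
    exact sl_mono ha (by linarith) (by linarith) (by linarith) hgk (by intro h; linarith)
      (by intro h; linarith)
  have l4 : 0 < sl a (ga * -al) (ka * -al) :=
    sl_pos ha (by linarith) (by linarith) (by intro h; linarith)
  have l5 : (-al)^2 * sl a (ga * -al) (ka * -al) ≤ ka^2 * sl a (-al * ka) (ga * ka) :=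
      mul_le_mul (by linarith) l3 l4.le (by positivity)
  have l6 := mul_le_mul_of_nonneg_left l2 (sq_nonneg (-al))
  linarith

lemma zero_excl {a p q r : ℝ} (hsum : p + q + r = 0)
    (hpq : p * q < 1) (hpr : p * r < 1) (hqr : q * r < 1)
    (e1 : q * ps a (p*q) + r * ps a (p*r) = 0) (e2 : p * ps a (p*q) + r * ps a (q*r) = 0)
    (e3 : p * ps a (p*r) + q * ps a (q*r) = 0) : p = 0 ∧ q = 0 ∧ r = 0 := by
  have P1 := ps_pos (a := a) hpq
  have P2 := ps_pos (a := a) hpr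
  have P3 := ps_pos (a := a) hqr
  set A := ps a (p*q); set B := ps a (p*r); set C := ps a (q*r)
  have h1 : q * r ≤ 0 := by
    by_contra hc
    rcases mul_pos_iff.1 (not_le.1 hc) with ⟨x1, x2⟩ | ⟨x1, x2⟩
    · linarith [mul_pos x1 P1, mul_pos x2 P2]
    · linarith [mul_neg_of_neg_of_pos x1 P1, mul_neg_of_neg_of_pos x2 P2]
  have h2 : p * r ≤ 0 := by
    by_contra hc
    rcases mul_pos_iff.1 (not_le.1 hc) with ⟨x1, x2⟩ | ⟨x1, x2⟩
    · linarith [mul_pos x1 P1, mul_pos x2 P3]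
    · linarith [mul_neg_of_neg_of_pos x1 P1, mul_neg_of_neg_of_pos x2 P3]
  have h3 : p * q ≤ 0 := by
    by_contra hc
    rcases mul_pos_iff.1 (not_le.1 hc) with ⟨x1, x2⟩ | ⟨x1, x2⟩
    · linarith [mul_pos x1 P2, mul_pos x2 P3]
    · linarith [mul_neg_of_neg_of_pos x1 P2, mul_neg_of_neg_of_pos x2 P3]
  by_cases hp : p = 0
  · rw [hp] at e2; have : r = 0 := by
      have : r * C = 0 := by linarith
      rcases mul_eq_zero.1 this with h | h
      · exact h
      · linarith
    exact ⟨hp, by linarith, this⟩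
  exfalso
  have hq : q ≠ 0 := by
    rintro rfl; have : p * B = 0 := by linarith
    rcases mul_eq_zero.1 this with h | h
    · exact hp h
    · linarith
  have hr : r ≠ 0 := by
    rintro rfl; have : p * A = 0 := by linarith
    rcases mul_eq_zero.1 this with h | h
    · exact hp h
    · linarith
  have h1' := lt_of_le_of_ne h1 (mul_ne_zero hq hr)
  have h2' := lt_of_le_of_ne h2 (mul_ne_zero hp hr)
  have h3' := lt_of_le_of_ne h3 (mul_ne_zero hp hq)
  have := mul_neg_of_pos_of_neg (mul_pos_of_neg_of_neg h1' h2') h3'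
  nlinarith [sq_nonneg (p*q*r)]

lemma bern_neg {a x : ℝ} (ha : 0 ≤ a) (hx : 0 < x) : 1 + a * (1 - x) ≤ x ^ (-a) := by
  rw [Real.rpow_def_of_pos hx]
  have h1 := Real.log_le_sub_one_of_pos hx
  have h2 := Real.add_one_le_exp (Real.log x * (-a))
  nlinarith

lemma ps_ratio {a s t : ℝ} (hs : s < 1) (ht : t < 1) :
    ps a t = ps a s * ((1 - t) / (1 - s)) ^ (-a) := by
  unfold ps
  rw [← Real.mul_rpow (by linarith) (div_nonneg (by linarith) (by linarith)),
    mul_div_cancel₀ _ (by linarith)]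

lemma ps_tangent {a s t : ℝ} (ha : 0 < a) (hs : s < 1) (ht : t < 1) :
    ps a s + a * ps a s / (1 - s) * (t - s) ≤ ps a t := by
  rw [ps_ratio hs ht]
  have h0 : 0 < 1 - s := by linarith
  have h := bern_neg ha.le (x := (1 - t) / (1 - s)) (div_pos (by linarith) h0)
  have h2 := mul_le_mul_of_nonneg_left h (ps_pos (a := a) hs).le
  refine le_trans (le_of_eq ?_) h2
  field_simp
  ring

lemma ratio_le {a b c s t : ℝ} (ha : 0 < a) (hab : a * b = 1) (hc : 0 < c) (hs : s < 1)
    (ht : t < 1) : c * ps a s ≤ ps a t ↔ c ^ b * (1 - t) ≤ 1 - s := by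
  have hS : 0 < 1 - s := by linarith
  have hT : 0 < 1 - t := by linarith
  have hcb : 0 < c ^ b := Real.rpow_pos_of_pos hc _
  have e1 : c = (c ^ b) ^ a := by rw [← Real.rpow_mul hc.le, mul_comm, hab, Real.rpow_one]
  rw [← Real.rpow_le_rpow_iff (z := a) (by positivity) hS.le ha, Real.mul_rpow hcb.le hT.le, ← e1]
  unfold ps
  rw [Real.rpow_neg hS.le, Real.rpow_neg hT.le, ← div_eq_mul_inv, ← one_div,
    div_le_div_iff₀ (Real.rpow_pos_of_pos hS _) (Real.rpow_pos_of_pos hT _), one_mul]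

lemma ratio_lt {a b c s t : ℝ} (ha : 0 < a) (hab : a * b = 1) (hc : 0 < c) (hs : s < 1)
    (ht : t < 1) : c * ps a s < ps a t ↔ c ^ b * (1 - t) < 1 - s := by
  have hab' : a * b = 1 := hab
  have h := ratio_le (c := c⁻¹) ha hab (inv_pos.2 hc) ht hs
  rw [Real.inv_rpow hc.le] at h
  have hcb : 0 < c ^ b := Real.rpow_pos_of_pos hc _
  rw [inv_mul_le_iff₀ hc, inv_mul_le_iff₀ hcb] at h
  exact not_iff_not.1 (by rw [not_lt, not_lt]; exact h)

lemma two_rpow_ge {t : ℝ} (ht : 0 ≤ t) : 1 + 0.69 * t + 0.2 * t ^ 2 ≤ (2:ℝ) ^ t := by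
  rw [Real.rpow_def_of_pos (by norm_num)]
  have h := Real.quadratic_le_exp_of_nonneg (x := Real.log 2 * t)
    (mul_nonneg (Real.log_nonneg (by norm_num)) ht)
  have h2 := Real.log_two_gt_d9
  nlinarith [mul_nonneg (sub_nonneg.2 h2.le) ht, sq_nonneg t,
    mul_nonneg (mul_nonneg (sub_nonneg.2 h2.le) ht) ht,
    mul_nonneg (mul_nonneg (mul_nonneg (sub_nonneg.2 h2.le) ht) ht)
      (Real.log_nonneg (show (1:ℝ) ≤ 2 by norm_num))]

/-- Equations for the isosceles family `δ = (-(2+ρ)x, x, x, ρx)`, `u = x²`. -/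
def Iso (a r u : ℝ) : Prop :=
  0 < r ∧ 0 < u ∧ u < 1 ∧ r * u < 1 ∧
  ps a (r*u) = (1+r) * ps a (-(r*((2+r)*u))) + ps a (-((2+r)*u)) ∧
  ps a u + r^2 * ps a (-(r*((2+r)*u))) = 4 * ps a (-((2+r)*u))

lemma iso_lt_num {m t N b : ℝ} (hm1 : 1 < m) (hm2 : m < 2) (ht : 0 ≤ t)
    (hN : 2.59 * m * (1 + 0.69 * t + 0.2 * t^2) ≤ N) (hb : b = 1.5 + t)
    (hP : 0 < 2 + 3*m - (2-m)*N) :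
    b < (N-1) * ((1 - m + m^2)/(2*m*N) + 2/(2 + 3*m - (2-m)*N)) := by
  have hN1 : 2.59 * m ≤ N := by nlinarith [mul_nonneg ht ht, mul_nonneg (by linarith : 0 ≤ m) ht]
  have hN0 : 0 < N := by nlinarith
  -- first term
  have h1 : 0.375 * m - 0.145 ≤ (N-1) * ((1 - m + m^2)/(2*m*N)) := by
    rw [← mul_div_assoc, le_div_iff₀ (by positivity)]
    have : (3/4) * m^2 ≤ 1 - m + m^2 := by nlinarith [sq_nonneg (m-2)]
    have h2 := mul_le_mul_of_nonneg_left this (by nlinarith : 0 ≤ N - 1)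
    have : 0 < m * N := by positivity
    nlinarith
  have h2 : 1.645 + t - 0.375 * m < (N-1) * (2/(2 + 3*m - (2-m)*N)) := by
    rw [← mul_div_assoc, lt_div_iff₀ hP]
    have hc : 0 ≤ 2 + (2-m) * (1.645 + t - 0.375*m) := by nlinarith
    have h3 := mul_le_mul_of_nonneg_right hN hc
    have key : 0 < 2.59 * m * (1 + 0.69 * t + 0.2 * t^2) * (2 + (2-m) * (1.645 + t - 0.375*m)) - 2
        - (2+3*m)*(1.645 + t - 0.375*m) := by
      have k0 : 0.05 + (m-1) ≤ 2.59*m*(2+(2-m)*(1.645-0.375*m)) - 2 - (2+3*m)*(1.645-0.375*m) := by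
        nlinarith [mul_pos (sub_pos.2 hm1) (sub_pos.2 hm2),
          mul_pos (mul_pos (sub_pos.2 hm1) (sub_pos.2 hm2)) (sub_pos.2 hm1)]
      have k1 : -(m-1) ≤ 2.59*m*(0.69*(2+(2-m)*(1.645-0.375*m)) + (2-m)) - (2+3*m) := by
        nlinarith [mul_pos (sub_pos.2 hm1) (sub_pos.2 hm2),
          mul_pos (mul_pos (sub_pos.2 hm1) (sub_pos.2 hm2)) (sub_pos.2 hm1)]
      have k2 : (m-1)/4 ≤ 2.59*m*(0.2*(2+(2-m)*(1.645-0.375*m)) + 0.69*(2-m)) := by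
        nlinarith [mul_pos (sub_pos.2 hm1) (sub_pos.2 hm2),
          mul_pos (mul_pos (sub_pos.2 hm1) (sub_pos.2 hm2)) (sub_pos.2 hm1)]
      have k3 : 0 ≤ 2.59*m*0.2*(2-m) := by
        apply mul_nonneg _ (by linarith); linarith
      have k1' := mul_le_mul_of_nonneg_right k1 ht
      have k2' := mul_le_mul_of_nonneg_right k2 (sq_nonneg t)
      have k3' := mul_nonneg k3 (pow_nonneg ht 3)
      have k4 := mul_nonneg (sub_pos.2 hm1).le (sq_nonneg (1 - t/2))
      linarith
    linarith
  rw [mul_add]; linarith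

lemma log_ratio {S T : ℝ} (hT : 0 < T) (h : T ≤ S) : 2 * (S - T) / (S + T) ≤ Real.log (S / T) := by
  have h1 := Real.le_log_one_add_of_nonneg (x := S / T - 1)
    (by rw [sub_nonneg, le_div_iff₀ hT]; linarith)
  have e1 : 1 + (S / T - 1) = S / T := by ring
  rw [e1] at h1
  refine le_trans (le_of_eq ?_) h1
  have h3 : S + T ≠ 0 := by linarith
  have e2 : S / T - 1 + 2 = (S + T) / T := by field_simp; ring
  have e3 : 2 * (S / T - 1) = 2 * (S - T) / T := by field_simp
  rw [e2, e3, div_div_div_cancel_right₀ hT.ne']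

lemma iso_not_lt {a b r u : ℝ} (ha : 0 < a) (hab : a * b = 1) (hb : 3/2 ≤ b) (h : Iso a r u) :
    1 ≤ r := by
  by_contra hr1
  push Not at hr1
  obtain ⟨hr, hu, hu1, hru, e1, e2⟩ := h
  set v := (2+r)*u with hv
  have hv0 : 0 < v := by positivity
  have hrv : r * v < v := by nlinarith
  have Zp : 0 < ps a (-v) := ps_pos (by linarith)
  have WZ : ps a (-v) + a * ps a (-v) / (1 + v) * (v - r * v) ≤ ps a (-(r*v)) := by
    have := ps_tangent ha (s := -v) (t := -(r*v)) (by linarith) (by nlinarith)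
    simp only [sub_neg_eq_add] at this; linarith
  have WZ0 : 0 < a * ps a (-v) / (1 + v) * (v - r * v) := by
    apply mul_pos (by positivity) (by linarith)
  have Yp : 0 < ps a (r*u) := ps_pos hru
  have YZ : (2+r) * ps a (-v) < ps a (r*u) := by nlinarith
  have hN := (ratio_lt ha hab (by linarith) (by linarith) hru).1 YZ
  have XY : ps a (r*u) * (1 + a * (2*((1-r)*u)/(2-(1+r)*u))) ≤ ps a u := by
    rw [ps_ratio hru hu1]
    apply mul_le_mul_of_nonneg_left _ Yp.le
    rw [Real.rpow_def_of_pos (div_pos (by linarith) (by linarith))]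
    have h1 := log_ratio (S := 1 - r*u) (T := 1 - u) (by linarith) (by nlinarith)
    have e3 : Real.log ((1-u)/(1-r*u)) = - Real.log ((1-r*u)/(1-u)) := by
      rw [← Real.log_inv, inv_div]
    rw [e3]
    have h2 := Real.add_one_le_exp (-Real.log ((1-r*u)/(1-u)) * -a)
    have e4 : 2*((1-r)*u)/(2-(1+r)*u) = 2 * ((1 - r*u) - (1-u)) / ((1-r*u) + (1-u)) := by
      congr 1 <;> ring
    rw [e4]
    have := mul_le_mul_of_nonneg_left h1 ha.le
    linarith
  set N := (2+r)^b with hNd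
  have hD : 0 < 2 - (1+r)*u := by nlinarith
  -- combined inequality
  have main : u * (1+r+r^2)/(1+v) + 2*u/(2-(1+r)*u) ≤ b := by
    have i1 : (1+r+r^2) * (ps a (-(r*v)) - ps a (-v)) + (ps a u - ps a (r*u))
        = (1-r)*(2+r)*ps a (-v) := by rw [e1]; linear_combination e2
    have i2 : (1+r+r^2) * (a * ps a (-v) / (1 + v) * (v - r * v)) ≤
        (1+r+r^2) * (ps a (-(r*v)) - ps a (-v)) := by
      apply mul_le_mul_of_nonneg_left (by linarith) (by positivity)
    have i3 : (2+r) * ps a (-v) * (a * (2*((1-r)*u)/(2-(1+r)*u))) ≤ ps a u - ps a (r*u) := by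
      have : 0 ≤ a * (2*((1-r)*u)/(2-(1+r)*u)) := by
        have : 0 ≤ 1 - r := by linarith
        positivity
      have := mul_le_mul_of_nonneg_right YZ.le this
      linarith
    have i4 : a * (u * (1+r+r^2)/(1+v) + 2*u/(2-(1+r)*u)) * ((1-r)*(2+r)*ps a (-v))
        ≤ 1 * ((1-r)*(2+r)*ps a (-v)) := by
      have e5 : a * (u * (1+r+r^2)/(1+v) + 2*u/(2-(1+r)*u)) * ((1-r)*(2+r)*ps a (-v)) =
        (1+r+r^2) * (a * ps a (-v) / (1 + v) * (v - r * v)) +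
        (2+r) * ps a (-v) * (a * (2*((1-r)*u)/(2-(1+r)*u))) := by
        have : v - r * v = (1-r)*((2+r)*u) := by rw [hv]; ring
        rw [this]; ring
      rw [e5]; linarith
    have i5 := le_of_mul_le_mul_right i4 (by
      have : 0 < 1 - r := by linarith
      positivity)
    have hb0 : 0 < b := by linarith
    calc _ = b * (a * (u * (1+r+r^2)/(1+v) + 2*u/(2-(1+r)*u))) := by
          rw [← mul_assoc, mul_comm b a, hab, one_mul]
      _ ≤ b * 1 := mul_le_mul_of_nonneg_left i5 hb0.le
      _ = b := mul_one b
  -- lower bound for N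
  have hN2 : 2.59 * (1+r) * (1 + 0.69 * (b-1.5) + 0.2 * (b-1.5)^2) ≤ N := by
    have e6 : N = (2+r)^(3/2:ℝ) * (2+r)^(b-1.5) := by
      rw [hNd, ← Real.rpow_add (by linarith)]; norm_num
    rw [e6]
    apply mul_le_mul
    · refine (sq_le_sq₀ (by positivity) (by positivity)).1 ?_
      have e7 : ((2+r)^(3/2:ℝ))^2 = (2+r)^3 := by
        rw [← Real.rpow_natCast, ← Real.rpow_mul (by linarith), ← Real.rpow_natCast (2+r) 3]
        norm_num
      rw [e7]
      nlinarith [mul_pos hr hr, mul_pos (mul_pos hr hr) hr, mul_nonneg hr.le (sq_nonneg (r-1)), sq_nonneg (r-1)]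
    · refine le_trans (two_rpow_ge (by linarith)) ?_
      exact Real.rpow_le_rpow (by norm_num) (by linarith) (by linarith)
    · nlinarith [sq_nonneg (b-1.5)]
    · positivity
  have hN3 : 1 < N := by
    have : 0 ≤ (b-1.5) := by linarith
    nlinarith [mul_nonneg this this, mul_nonneg hr.le this, mul_nonneg hr.le (mul_nonneg this this)]
  have hu0 : N - 1 < u * (2+r+r*N) := by
    rw [hv] at hN; linarith
  have j2 : (N-1) * (2-(1+r)*u) < u * (2 + 3*(1+r) - (2-(1+r))*N) := by nlinarith
  have hP : 0 < 2 + 3*(1+r) - (2-(1+r))*N := by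
    have : 0 < (N-1) * (2-(1+r)*u) := mul_pos (by linarith) hD
    exact (pos_iff_pos_of_mul_pos (lt_trans this j2)).1 hu
  have key := iso_lt_num (m := 1+r) (t := b-1.5) (N := N) (b := b) (by linarith) (by linarith)
    (by linarith) hN2 (by ring) hP
  have k1 : (N-1) * ((1 - (1+r) + (1+r)^2)/(2*(1+r)*N)) ≤ u * (1+r+r^2)/(1+v) := by
    rw [← mul_div_assoc, div_le_div_iff₀ (by positivity) (by positivity)]
    have : (N-1)*(1+v) ≤ u * (2*(1+r)*N) := by rw [hv]; linarith
    have := mul_le_mul_of_nonneg_right this (by positivity : 0 ≤ 1+r+r^2)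
    linarith
  have k2 : (N-1) * (2/(2 + 3*(1+r) - (2-(1+r))*N)) ≤ 2*u/(2-(1+r)*u) := by
    rw [← mul_div_assoc, div_le_div_iff₀ hP hD]
    linarith
  rw [mul_add] at key
  linarith

lemma ps_upper {a s t : ℝ} (ha : 0 ≤ a) (ha1 : a ≤ 1) (hs : s < 1) (ht : t < 1) :
    ps a s ≤ ps a t * (1 + a * ((s - t) / (1 - s))) := by
  rw [ps_ratio ht hs]
  apply mul_le_mul_of_nonneg_left _ (ps_pos ht).le
  have h0 : 0 < 1 - s := by linarith
  have h1 : 0 < 1 - t := by linarith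
  have e : ((1 - s) / (1 - t)) ^ (-a) = (1 + (s - t) / (1 - s)) ^ a := by
    rw [Real.rpow_neg (by positivity), ← Real.inv_rpow (by positivity), inv_div]
    congr 1; field_simp; ring
  rw [e]
  refine rpow_one_add_le_one_add_mul_self ?_ ha ha1
  rw [le_div_iff₀ h0]; linarith

lemma ps_cont {a : ℝ} {α : Type*} [TopologicalSpace α] {g : α → ℝ} {S : Set α}
    (hg : ContinuousOn g S) (h1 : ∀ x ∈ S, g x < 1) : ContinuousOn (fun x => ps a (g x)) S := by
  unfold ps
  apply ContinuousOn.rpow_const (continuousOn_const.sub hg)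
  intro x hx; left
  have := h1 x hx
  show 1 - g x ≠ 0
  linarith

lemma curve_ivt {F H : ℝ × ℝ → ℝ} {r0 r1 p1 : ℝ} (hr : r0 ≤ r1)
    (hF : ContinuousOn F (Set.Icc r0 r1 ×ˢ Set.Icc 0 p1))
    (hH : ContinuousOn H (Set.Icc r0 r1 ×ˢ Set.Icc 0 p1))
    (hex : ∀ r ∈ Set.Icc r0 r1, ∃ p ∈ Set.Icc 0 p1, F (r, p) = 0)
    (huniq : ∀ r ∈ Set.Icc r0 r1, ∀ p ∈ Set.Icc 0 p1, ∀ p' ∈ Set.Icc 0 p1,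
      F (r, p) = 0 → F (r, p') = 0 → p = p')
    (h0 : ∀ p ∈ Set.Icc 0 p1, F (r0, p) = 0 → H (r0, p) ≤ 0)
    (h1 : ∀ p ∈ Set.Icc 0 p1, F (r1, p) = 0 → 0 ≤ H (r1, p)) :
    ∃ r ∈ Set.Icc r0 r1, ∃ p ∈ Set.Icc 0 p1, F (r, p) = 0 ∧ H (r, p) = 0 := by
  set C := Set.Icc r0 r1 ×ˢ Set.Icc 0 p1 with hC
  have cC : IsCompact C := isCompact_Icc.prod isCompact_Icc
  have clC : IsClosed C := cC.isClosed
  have cl1 : IsClosed (C ∩ F ⁻¹' {0}) := hF.preimage_isClosed_of_isClosed clC isClosed_singleton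
  have clA : IsClosed (C ∩ F ⁻¹' {0} ∩ (C ∩ H ⁻¹' Set.Iic 0)) :=
    cl1.inter (hH.preimage_isClosed_of_isClosed clC isClosed_Iic)
  have clB : IsClosed (C ∩ F ⁻¹' {0} ∩ (C ∩ H ⁻¹' Set.Ici 0)) :=
    cl1.inter (hH.preimage_isClosed_of_isClosed clC isClosed_Ici)
  have A1 := ((cC.of_isClosed_subset clA (fun x hx => hx.1.1)).image continuous_fst).isClosed
  have B1 := ((cC.of_isClosed_subset clB (fun x hx => hx.1.1)).image continuous_fst).isClosed
  have := (isPreconnected_closed_iff.1 (isPreconnected_Icc (a := r0) (b := r1))) _ _ A1 B1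
    (by
      intro r hr
      obtain ⟨p, hp, hp0⟩ := hex r hr
      rcases le_total (H (r, p)) 0 with h | h
      · left; exact ⟨(r, p), ⟨⟨⟨hr, hp⟩, hp0⟩, ⟨hr, hp⟩, h⟩, rfl⟩
      · right; exact ⟨(r, p), ⟨⟨⟨hr, hp⟩, hp0⟩, ⟨hr, hp⟩, h⟩, rfl⟩)
    (by
      have hr : r0 ∈ Set.Icc r0 r1 := ⟨le_rfl, hr⟩
      obtain ⟨p, hp, hp0⟩ := hex r0 hr
      exact ⟨r0, hr, (r0, p), ⟨⟨⟨hr, hp⟩, hp0⟩, ⟨hr, hp⟩, h0 p hp hp0⟩, rfl⟩)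
    (by
      have hr : r1 ∈ Set.Icc r0 r1 := ⟨hr, le_rfl⟩
      obtain ⟨p, hp, hp0⟩ := hex r1 hr
      exact ⟨r1, hr, (r1, p), ⟨⟨⟨hr, hp⟩, hp0⟩, ⟨hr, hp⟩, h1 p hp hp0⟩, rfl⟩)
  obtain ⟨r, hr, ⟨⟨x, p⟩, hx, rfl⟩, ⟨⟨x', p'⟩, hx', hh⟩⟩ := this
  simp only at hh hr
  subst hh
  have := huniq x' hr p hx.1.1.2 p' hx'.1.1.2 hx.1.2 hx'.1.2
  subst this
  exact ⟨x', hr, p, hx.1.1.2, hx.1.2, le_antisymm hx.2.2 hx'.2.2⟩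

lemma exi_num {b r u v N : ℝ} (hb : 3/2 ≤ b) (hr : 1 < r) (hr3 : r ≤ 1.005) (hN5 : 5.19 ≤ N)
    (hu : 0 < u) (hu1 : u < 1) (hv : v = (2+r)*u) (hv0 : 0 < v) (hrN : (r-1)*N = 0.025)
    (hN0 : 5.19 * (1 + 0.69 * (b-1.5) + 0.2 * (b-1.5)^2) ≤ N) (hN' : N * (1 - r*u) ≤ 1 + r * v) :
    b < u/(r*(1-u)) + (1+r+r^2)*u/(1+r*v) := by
  have k1 : 0.2459 * (N-1) ≤ u/(r*(1-u)) := by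
    rw [le_div_iff₀ (mul_pos (by linarith) (by linarith))]
    have : (N-1)*(1-u) ≤ u * (1.0/40 + (1+r)^2) := by
      have h3 : ((r-1)*N)*u = 0.025*u := by rw [hrN]
      rw [hv] at hN'; linarith
    have h2 : r * (1.0/40 + (1+r)^2) * 0.2459 ≤ 1 := by nlinarith
    have := mul_le_mul_of_nonneg_left this (by linarith : 0 ≤ 0.2459 * r)
    have := mul_le_mul_of_nonneg_left h2 hu.le
    linarith
  have k2 : 0.745 * (N-1) / N ≤ (1+r+r^2)*u/(1+r*v) := by
    rw [div_le_div_iff₀ (by linarith) (by positivity)]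
    have : (N-1)*(1+r*v) ≤ u * (r*(3+r)*N) := by
      rw [hv] at hN' ⊢; linarith
    have h2 : 0.745 * (r * (3+r)) ≤ 1 + r + r^2 := by nlinarith
    have := mul_le_mul_of_nonneg_left h2 (by positivity : 0 ≤ u * N)
    linarith
  refine lt_of_lt_of_le ?_ (add_le_add k1 k2)
  have e1 : 0.745 * (N-1) / N = 0.745 - 0.745 / N := by field_simp
  rw [e1]
  have : 0.745 / N ≤ 0.1436 := by
    rw [div_le_iff₀ (by linarith)]; linarith
  nlinarith [sq_nonneg (b - 1.8)]

lemma exi_alg {a r u v X Y Z W : ℝ} (ha : 0 < a) (hr : 1 < r) (hu : 0 < u) (hu1 : u < 1)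
    (hv : v = (2+r)*u) (hv0 : 0 < v) (hZp : 0 < Z)
    (hX : X ≤ Y * (1 + a * ((u - r*u)/(1-u))))
    (hW : W ≤ Z * (1 + a * ((-(r*v) - -v)/(1 - -(r*v)))))
    (hWZ2 : (1/r) * Z ≤ W) (hWZ : W ≤ Z) (e1 : Y = (1+r) * W + Z)
    (K2 : 1 < a * (u/(r*(1-u)) + (1+r+r^2)*u/(1+r*v))) : X + r^2 * W < 4 * Z := by
  have K3 := mul_lt_mul_of_pos_right K2
    (mul_pos (mul_pos (sub_pos.2 hr) (by linarith : 0 < 2 + r)) hZp)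
  have hY2 : (2+r)/r * Z ≤ Y := by
    have : (2+r)*((1/r) * Z) ≤ (2+r) * W :=
      mul_le_mul_of_nonneg_left hWZ2 (by linarith)
    have e : (2+r)/r * Z = (2+r)*((1/r) * Z) := by ring
    rw [e]; linarith
  have d1 : (2+r)/r * Z * (a * ((r-1)*u/(1-u))) ≤ Y - X := by
    have h1 := mul_le_mul_of_nonneg_right hY2
      (by
        have : 0 < 1 - u := by linarith
        have : 0 < r - 1 := by linarith
        positivity : 0 ≤ a * ((r-1)*u/(1-u)))
    have e : a * ((u - r*u)/(1-u)) = - (a * ((r-1)*u/(1-u))) := by ring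
    rw [e] at hX
    linarith
  have d2 : Z * (a * ((r-1)*v/(1+r*v))) ≤ Z - W := by
    have e : a * ((-(r*v) - -v)/(1 - -(r*v))) = - (a * ((r-1)*v/(1+r*v))) := by
      rw [sub_neg_eq_add]; ring
    rw [e] at hW
    linarith
  have d3 := mul_le_mul_of_nonneg_left d2 (by positivity : 0 ≤ 1 + r + r^2)
  have e9 : a * (u/(r*(1-u)) + (1+r+r^2)*u/(1+r*v)) * ((r-1)*(2+r)*Z) =
      (2+r)/r * Z * (a * ((r-1)*u/(1-u))) +
      (1+r+r^2) * (Z * (a * ((r-1)*v/(1+r*v)))) := by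
    have h1 : 1 - u ≠ 0 := by linarith
    have h2 : 1 + r*v ≠ 0 := by positivity
    have h3 : r ≠ 0 := by linarith
    have e : v/(1+r*v) = (2+r)*(u/(1+r*v)) := by rw [hv]; ring
    have e' : (r-1)*v/(1+r*v) = (r-1)*((2+r)*(u/(1+r*v))) := by rw [← e]; ring
    rw [e']
    have e'' : u/(r*(1-u)) = u/(1-u)/r := by rw [div_div, mul_comm]
    rw [e'']
    ring
  rw [e9] at K3
  linarith

lemma exi_lo {a b r u : ℝ} (ha : 0 < a) (hab : a * b = 1) (hb : 3/2 ≤ b) (hr : 1 < r)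
    (hr2 : (r - 1) * (40 * (3:ℝ)^b) = 1) (hu : 0 < u) (hru : r * u < 1)
    (e1 : ps a (r*u) = (1+r) * ps a (-(r*((2+r)*u))) + ps a (-((2+r)*u))) :
    ps a u + r^2 * ps a (-(r*((2+r)*u))) < 4 * ps a (-((2+r)*u)) := by
  have hb0 : 0 < b := by linarith
  have ha1 : a ≤ 1 := by nlinarith
  have hu1 : u < 1 := by nlinarith
  set v := (2+r)*u with hv
  have hv0 : 0 < v := by positivity
  have hN0 : 5.19 * (1 + 0.69 * (b-1.5) + 0.2 * (b-1.5)^2) ≤ (3:ℝ)^b := by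
    have e6 : (3:ℝ)^b = 3^(3/2:ℝ) * 3^(b-1.5) := by
      rw [← Real.rpow_add (by norm_num)]; norm_num
    rw [e6]
    apply mul_le_mul
    · refine (sq_le_sq₀ (by positivity) (by positivity)).1 ?_
      have e7 : ((3:ℝ)^(3/2:ℝ))^2 = 3^3 := by
        rw [← Real.rpow_natCast, ← Real.rpow_mul (by norm_num), ← Real.rpow_natCast 3 3]
        norm_num
      rw [e7]; norm_num
    · refine le_trans (two_rpow_ge (by linarith)) ?_
      exact Real.rpow_le_rpow (by norm_num) (by norm_num) (by linarith)
    · nlinarith [sq_nonneg (b-1.5)]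
    · positivity
  have hX := ps_upper (s := u) (t := r*u) ha.le ha1 hu1 hru
  have hW := ps_upper (s := -(r*v)) (t := -v) ha.le ha1 (by nlinarith) (by linarith)
  have hZp : 0 < ps a (-v) := ps_pos (by linarith)
  have hYp : 0 < ps a (r*u) := ps_pos hru
  have hWp : 0 < ps a (-(r*v)) := ps_pos (by nlinarith)
  have hWZ : ps a (-(r*v)) ≤ ps a (-v) := ps_le ha (by nlinarith) (by linarith)
  have hN := (ratio_le (c := 2+r) ha hab (by linarith) (s := -(r*v)) (by nlinarith) hru).1
    (by linarith)
  have hNN : (3:ℝ)^b ≤ (2+r)^b := Real.rpow_le_rpow (by norm_num) (by linarith) hb0.le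
  set N := (3:ℝ)^b
  have hN' : N * (1 - r*u) ≤ 1 + r * v := by
    have := mul_le_mul_of_nonneg_right hNN (by linarith : 0 ≤ 1 - r*u)
    linarith
  have hWZ2 : (1/r) * ps a (-v) ≤ ps a (-(r*v)) := by
    rw [ratio_le ha hab (by positivity) (by linarith) (by nlinarith)]
    have h1 : (1/r)^b ≤ 1/r := by
      have := Real.rpow_le_rpow_of_exponent_ge (x := 1/r) (by positivity)
        (by rw [div_le_one (by linarith)]; exact hr.le) (show 1 ≤ b by linarith)
      simpa using this
    calc (1/r)^b * (1 - -(r*v)) ≤ 1/r * (1 - -(r*v)) :=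
          mul_le_mul_of_nonneg_right h1 (by nlinarith)
      _ = 1/r + v := by field_simp; ring
      _ ≤ 1 - -v := by
        have : 1/r ≤ 1 := by rw [div_le_one (by linarith)]; exact hr.le
        linarith
  have hN5 : 5.19 ≤ N := by nlinarith [sq_nonneg (b-1.5)]
  have hr3 : r ≤ 1.005 := by nlinarith
  have hrN : (r-1)*N = 0.025 := by linarith
  have K := exi_num hb hr hr3 hN5 hu hu1 hv hv0 hrN hN0 hN'
  have K2 : 1 < a * (u/(r*(1-u)) + (1+r+r^2)*u/(1+r*v)) := by
    have := mul_lt_mul_of_pos_left K ha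
    rwa [hab] at this
  exact exi_alg ha hr hu hu1 hv hv0 hZp hX hW hWZ2 hWZ e1 K2

lemma exi_hi {a b u : ℝ} (ha : 0 < a) (hab : a * b = 1) (hb : 3/2 ≤ b) (hu : 0 < u)
    (hru : 3 * u < 1) :
    4 * ps a (-((2+3)*u)) < ps a u + 3^2 * ps a (-(3*((2+3)*u))) := by
  have h : (4/9) * ps a (-((2+3)*u)) < ps a (-(3*((2+3)*u))) := by
    rw [ratio_lt ha hab (by norm_num) (by linarith) (by linarith)]
    have h1 : (4/9:ℝ)^b ≤ 8/27 := by
      refine (Real.rpow_le_rpow_of_exponent_ge (by norm_num) (by norm_num) hb).trans ?_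
      refine (sq_le_sq₀ (by positivity) (by positivity)).1 ?_
      have e7 : ((4/9:ℝ)^(3/2:ℝ))^2 = (4/9)^3 := by
        rw [← Real.rpow_natCast, ← Real.rpow_mul (by norm_num), ← Real.rpow_natCast (4/9) 3]
        norm_num
      rw [e7]; norm_num
    have := mul_le_mul_of_nonneg_right h1 (by linarith : 0 ≤ 1 - -(3*((2+3)*u)))
    linarith
  have h2 := ps_pos (a := a) (show u < 1 by linarith)
  generalize ps a (-((2+3)*u)) = Z at *
  generalize ps a (-(3*((2+3)*u))) = W at *
  linarith

lemma iso_exists {a b : ℝ} (ha : 0 < a) (hab : a * b = 1) (hb : 3/2 ≤ b) :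
    ∃ r u, 1 < r ∧ Iso a r u := by
  have hb0 : 0 < b := by linarith
  set N := (3:ℝ)^b with hN
  have hN1 : 1 ≤ N := Real.one_le_rpow (by norm_num) hb0.le
  set r0 := 1 + 1/(40*N) with hr0
  have hr01 : 1 < r0 := by
    have : 0 < 1/(40*N) := by positivity
    linarith
  have hr03 : r0 ≤ 3 := by
    have : 1/(40*N) ≤ 1 := by rw [div_le_one (by positivity)]; linarith
    linarith
  have hr0e : (r0 - 1) * (40*N) = 1 := by rw [hr0]; field_simp; ring
  set p1 := 1 - ((5:ℝ)^b)⁻¹ with hp1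
  have h5 : 0 < ((5:ℝ)^b)⁻¹ := by positivity
  have hp11 : p1 < 1 := by linarith
  have hp10 : 0 ≤ p1 := by
    have : ((5:ℝ)^b)⁻¹ ≤ 1 := inv_le_one_of_one_le₀ (Real.one_le_rpow (by norm_num) hb0.le)
    linarith
  have hps1 : ps a p1 = 5 := by
    unfold ps
    rw [hp1, sub_sub_cancel, Real.rpow_neg h5.le, ← Real.inv_rpow h5.le, inv_inv,
      ← Real.rpow_mul (by norm_num), mul_comm, hab, Real.rpow_one]
  let F : ℝ × ℝ → ℝ := fun x => ps a x.2 - (1 + x.1) * ps a (-((2+x.1)*x.2))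
    - ps a (-((2+x.1)*(x.2/x.1)))
  let H : ℝ × ℝ → ℝ := fun x => ps a (x.2/x.1) + x.1^2 * ps a (-((2+x.1)*x.2))
    - 4 * ps a (-((2+x.1)*(x.2/x.1)))
  have cdiv : ContinuousOn (fun x : ℝ × ℝ => x.2/x.1) (Set.Icc r0 3 ×ˢ Set.Icc 0 p1) := by
    apply ContinuousOn.div continuousOn_snd continuousOn_fst
    rintro ⟨x, p⟩ ⟨hx, hp⟩
    have := hx.1
    simp only at this ⊢
    linarith
  have c1 : ContinuousOn (fun x : ℝ × ℝ => ps a x.2) (Set.Icc r0 3 ×ˢ Set.Icc 0 p1) :=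
    ps_cont continuousOn_snd (by rintro ⟨x, p⟩ ⟨hx, hp⟩; exact lt_of_le_of_lt hp.2 hp11)
  have c2 : ContinuousOn (fun x : ℝ × ℝ => ps a (-((2+x.1)*x.2))) (Set.Icc r0 3 ×ˢ Set.Icc 0 p1) :=
    ps_cont (by fun_prop) (by
      rintro ⟨x, p⟩ ⟨hx, hp⟩
      have h1 := hx.1; have h2 := hp.1
      simp only at h1 h2 ⊢
      nlinarith)
  have c3 : ContinuousOn (fun x : ℝ × ℝ => ps a (-((2+x.1)*(x.2/x.1))))
      (Set.Icc r0 3 ×ˢ Set.Icc 0 p1) :=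
    ps_cont ((continuousOn_const.add continuousOn_fst).mul cdiv).neg (by
      rintro ⟨x, p⟩ ⟨hx, hp⟩
      have h1 := hx.1; have h2 := hp.1
      simp only at h1 h2 ⊢
      have : 0 ≤ (2+x)*(p/x) := by
        have : 0 < x := by linarith
        positivity
      linarith)
  have c4 : ContinuousOn (fun x : ℝ × ℝ => ps a (x.2/x.1)) (Set.Icc r0 3 ×ˢ Set.Icc 0 p1) :=
    ps_cont cdiv (by
      rintro ⟨x, p⟩ ⟨hx, hp⟩
      have h1 := hx.1; have h2 := hp.2
      simp only at h1 h2 ⊢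
      rw [div_lt_one (by linarith)]; linarith)
  have cF : ContinuousOn F (Set.Icc r0 3 ×ˢ Set.Icc 0 p1) :=
    (c1.sub ((continuousOn_const.add continuousOn_fst).mul c2)).sub c3
  have cH : ContinuousOn H (Set.Icc r0 3 ×ˢ Set.Icc 0 p1) :=
    (c4.add ((continuousOn_fst.pow 2).mul c2)).sub (continuousOn_const.mul c3)
  have Fmono : ∀ r ∈ Set.Icc r0 3, ∀ p ∈ Set.Icc 0 p1, ∀ p' ∈ Set.Icc 0 p1, p < p' →
      F (r, p) < F (r, p') := by
    intro r hr p hp p' hp' hpp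
    have hr1 : 1 < r := lt_of_lt_of_le hr01 hr.1
    have hr0 : 0 < r := by linarith
    have l1 := ps_lt ha hpp (lt_of_le_of_lt hp'.2 hp11)
    have q1 : (2+r)*p ≤ (2+r)*p' := mul_le_mul_of_nonneg_left hpp.le (by linarith)
    have q2 : (2+r)*(p/r) ≤ (2+r)*(p'/r) :=
      mul_le_mul_of_nonneg_left (div_le_div_of_nonneg_right hpp.le hr0.le) (by linarith)
    have q3 : 0 ≤ (2+r)*p := mul_nonneg (by linarith) hp.1
    have q4 : 0 ≤ (2+r)*(p/r) := mul_nonneg (by linarith) (div_nonneg hp.1 hr0.le)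
    have l2 := ps_le ha (neg_le_neg q1) (by linarith)
    have l3 := ps_le ha (neg_le_neg q2) (by linarith)
    have := mul_le_mul_of_nonneg_left l2 (by linarith : 0 ≤ 1 + r)
    simp only [F]
    linarith
  have F0 : ∀ r ∈ Set.Icc r0 3, F (r, 0) < 0 := by
    intro r hr
    simp only [F, mul_zero, zero_div, neg_zero, ps_zero]
    linarith [hr.1]
  have hex : ∀ r ∈ Set.Icc r0 3, ∃ p ∈ Set.Icc 0 p1, F (r, p) = 0 := by
    intro r hr
    have hr1 : 1 < r := lt_of_lt_of_le hr01 hr.1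
    have F1 : 0 ≤ F (r, p1) := by
      have l2 : ps a (-((2+r)*p1)) ≤ 1 := by
        rw [← ps_zero a]; apply ps_le ha _ (by norm_num)
        have : 0 ≤ (2+r)*p1 := mul_nonneg (by linarith) hp10
        linarith
      have l3 : ps a (-((2+r)*(p1/r))) ≤ 1 := by
        rw [← ps_zero a]; apply ps_le ha _ (by norm_num)
        have : 0 ≤ (2+r)*(p1/r) := mul_nonneg (by linarith) (div_nonneg hp10 (by linarith))
        linarith
      have := mul_le_mul_of_nonneg_left l2 (by linarith : 0 ≤ 1 + r)
      simp only [F, hps1]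
      linarith [hr.2]
    have cF' : ContinuousOn (fun p => F (r, p)) (Set.Icc 0 p1) :=
      cF.comp (by fun_prop) (fun p hp => ⟨hr, hp⟩)
    have := intermediate_value_Icc hp10 cF' (show (0:ℝ) ∈ Set.Icc _ _ from ⟨(F0 r hr).le, F1⟩)
    obtain ⟨p, hp, h⟩ := this
    exact ⟨p, hp, h⟩
  have hpos : ∀ r ∈ Set.Icc r0 3, ∀ p ∈ Set.Icc 0 p1, F (r, p) = 0 → 0 < p := by
    intro r hr p hp h
    rcases hp.1.eq_or_lt with h0 | h0
    · rw [← h0] at h; exact absurd h (F0 r hr).ne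
    · exact h0
  obtain ⟨r, hr, p, hp, hFz, hHz⟩ := curve_ivt hr03 cF cH hex
    (by
      intro r hr p hp p' hp' h h'
      rcases lt_trichotomy p p' with hl | hl | hl
      · have := Fmono r hr p hp p' hp' hl; linarith
      · exact hl
      · have := Fmono r hr p' hp' p hp hl; linarith)
    (by
      intro p hp h
      have hp0 := hpos r0 ⟨le_rfl, hr03⟩ p hp h
      have er : r0 * (p/r0) = p := mul_div_cancel₀ _ (by linarith)
      have er2 : r0 * ((2+r0)*(p/r0)) = (2+r0)*p := by rw [mul_left_comm, er]
      have := exi_lo (u := p/r0) ha hab hb hr01 hr0e (by positivity)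
        (by rw [er]; linarith [hp.2]) (by rw [er2, er]; simp only [F] at h; linarith)
      rw [er2] at this
      simp only [H]; linarith)
    (by
      intro p hp h
      have hp0 := hpos 3 ⟨hr03, le_rfl⟩ p hp h
      have er : 3 * (p/3) = p := by ring
      have er2 : 3 * ((2+3)*(p/3)) = (2+3)*p := by ring
      have := exi_hi (u := p/3) ha hab hb (by positivity) (by rw [er]; linarith [hp.2])
      rw [er2] at this
      simp only [H]; linarith)
  have hr1 : 1 < r := lt_of_lt_of_le hr01 hr.1
  have hp0 := hpos r hr p hp hFz
  have er : r * (p/r) = p := mul_div_cancel₀ _ (by linarith)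
  have er2 : r * ((2+r)*(p/r)) = (2+r)*p := by rw [mul_left_comm, er]
  have hp1' : p < 1 := lt_of_le_of_lt hp.2 hp11
  refine ⟨r, p/r, hr1, by linarith, by positivity, ?_, ?_, ?_, ?_⟩
  · rw [div_lt_one (by linarith)]; linarith
  · rw [er]; exact hp1'
  · rw [er, er2]; simp only [F] at hFz; linarith
  · rw [er2]; simp only [H] at hHz; linarith

lemma sad_r {b r u v X Y Z W E : ℝ} (hr : 1 < r) (hu : 0 < u) (hru : r * u < 1)
    (hv : v = (2+r)*u) (hX : 0 < X) (hW : 0 < W) (e2 : X + r^2 * W = 4 * Z)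
    (hE : X ≤ E * W) (hc : E/(r-1) + (E + r^2)/(1+r) + r^3/(3+r) < 2*b*r^2) :
    u * (2*X/(1-u) + (r-r)^2*Y/(1-r*u) + (4+r-r)^2*Z/(1+v) + 2*(r*(1+r)-r)^2*W/(1+r*v))
      < b*(r+r)^2*W := by
  have hr1 : 0 < r - 1 := by linarith
  have hr0 : 0 < r := by linarith
  have hu1 : 0 < 1 - u := by nlinarith
  have hv0 : 0 < v := by rw [hv]; positivity
  have b1 : u/(1-u) ≤ 1/(r-1) := by
    rw [div_le_div_iff₀ hu1 hr1]; linarith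
  have b2 : u/(1+v) ≤ 1/(2+2*r) := by
    rw [div_le_div_iff₀ (by positivity) (by positivity), hv]; linarith
  have b3 : u/(1+r*v) ≤ 1/(r*(3+r)) := by
    rw [div_le_div_iff₀ (by positivity) (by positivity), hv]; nlinarith
  have E0 : 0 < E := by
    by_contra h
    push Not at h
    have := mul_nonpos_of_nonpos_of_nonneg h hW.le
    linarith
  have t1 : 2*X*(u/(1-u)) ≤ 2*(E*W)*(1/(r-1)) :=
    mul_le_mul (by linarith) b1 (by positivity) (by positivity)
  have t2 : 4*(X + r^2*W)*(u/(1+v)) ≤ 4*(E*W+r^2*W)*(1/(2+2*r)) :=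
    mul_le_mul (by linarith) b2 (by positivity) (by positivity)
  have t3 : 2*(r^2)^2*W*(u/(1+r*v)) ≤ 2*(r^2)^2*W*(1/(r*(3+r))) :=
    mul_le_mul_of_nonneg_left b3 (by positivity)
  have e : u * (2*X/(1-u) + (r-r)^2*Y/(1-r*u) + (4+r-r)^2*Z/(1+v) + 2*(r*(1+r)-r)^2*W/(1+r*v))
      = 2*X*(u/(1-u)) + 4*(4*Z)*(u/(1+v)) + 2*(r^2)^2*W*(u/(1+r*v)) := by ring
  rw [e, ← e2]
  have h := mul_lt_mul_of_pos_right hc (by positivity : 0 < 2 * W)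
  have e3 : (E/(r-1) + (E + r^2)/(1+r) + r^3/(3+r)) * (2*W) = 2*(E*W)*(1/(r-1)) +
      4*(E*W+r^2*W)*(1/(2+2*r)) + 2*(r^2)^2*W*(1/(r*(3+r))) := by
    field_simp
    ring
  rw [e3] at h
  linarith

lemma partA {a S T : ℝ} (ha : 0 < a) (ha1 : a ≤ 2/3) (hS : 0 < S) (hST : S < T)
    (hT : T ≤ 3/2 * S) :
    a * S^(-a) / S + 2 * (a * T^(-a) / T) ≤ 3 * ((S^(-a) - T^(-a))/(T - S)) := by
  have hT0 : 0 < T := by linarith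
  have hl := log_ratio hS hST.le
  set L := Real.log (T/S) with hL
  have hL0 : 0 ≤ L := Real.log_nonneg (by rw [le_div_iff₀ hS]; linarith)
  have hTS : T = S * Real.exp L := by
    rw [hL, Real.exp_log (by positivity)]; field_simp
  set y := Real.exp (-(a*L/2)) with hy
  set k := Real.exp (L/3) with hk
  have hk3 : T = S * k^3 := by
    rw [hTS, hk, ← Real.exp_nat_mul]; congr 2; push_cast; ring
  have hk1 : 1 ≤ k := Real.one_le_exp (by positivity)
  have hy1 : y ≤ 1 := Real.exp_le_one_iff.2 (by have : 0 ≤ a * L := by positivity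
                                                linarith)
  have hy0 : 0 < y := Real.exp_pos _
  have hyk : 1 ≤ y * k := by
    rw [hy, hk, ← Real.exp_add]; apply Real.one_le_exp; nlinarith
  have hTa : T^(-a) = S^(-a) * y^2 := by
    rw [hTS, Real.mul_rpow hS.le (Real.exp_pos _).le, ← Real.exp_mul, hy, ← Real.exp_nat_mul]
    congr 2; push_cast; ring
  have hSa : 0 < S^(-a) := Real.rpow_pos_of_pos hS _
  have hsinh : a * L * y ≤ 1 - y^2 := by
    have h := Real.self_le_sinh_iff.2 (show 0 ≤ a*L/2 by positivity)
    rw [Real.sinh_eq] at h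
    have h2 := mul_le_mul_of_nonneg_right h hy0.le
    have h3 : Real.exp (a*L/2) * y = 1 := by rw [hy, ← Real.exp_add]; simp
    rw [← hy] at h2
    nlinarith
  have hk32 : k^3 ≤ 3/2 := by
    have : S * k^3 ≤ S * (3/2) := by linarith
    exact le_of_mul_le_mul_left this hS
  have hk2 : k ≤ 1.145 := by
    by_contra h
    push Not at h
    have := pow_lt_pow_left₀ h (by norm_num) (show 3 ≠ 0 by norm_num)
    norm_num at this
    linarith
  have quad : (T+S)*(T+2*y^2*S) ≤ 6*y*(S*T) := by
    have g : (k^3+1)*(k^3+2*y^2) ≤ 6*y*k^3 := by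
      -- y² ≤ (1 + 1/k) y - 1/k
      have c1 : k*y^2 ≤ (k+1)*y - 1 := by nlinarith
      have f1 : k^7+k^6+k^5+2*k^4-4*k^3-2*k^2-2*k-2 ≤ 0 := by
        have q1 : k^2 ≤ 1.312 := by nlinarith
        have q2 : k^4 ≤ 1.722 := by nlinarith
        have q5 : 1 ≤ k^2 := by nlinarith
        have q6 : 1 ≤ k^3 := by nlinarith
        have q7 : k^5 ≤ 1.968 := by nlinarith
        have q8 : k^6 ≤ 2.25 := by nlinarith
        have q9 : k^7 ≤ 2.577 := by nlinarith
        nlinarith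
      have f2 : (k-1)*(k^7+k^6+k^5+2*k^4-4*k^3-2*k^2-2*k-2) ≤ 0 :=
        mul_nonpos_of_nonneg_of_nonpos (by linarith) f1
      -- endpoint values
      have s1 : (k^3+1)*(k^3+2) ≤ 6*k^3 := by nlinarith
      -- multiply by k
      have k0 : 0 < k := by linarith
      have c2 := mul_le_mul_of_nonneg_left c1 (by positivity : 0 ≤ 2*(k^3+1))
      rcases hk1.eq_or_lt with hk' | hk'
      · rw [← hk'] at hyk ⊢
        have : y = 1 := le_antisymm hy1 (by linarith)
        rw [this]; norm_num
      have m : (k-1)*(k^4*(k^3+1) + 2*(k^3+1)*((k+1)*y-1) - 6*y*k^4) ≤ 0 := by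
        have id : (k-1)*(k^4*(k^3+1) + 2*(k^3+1)*((k+1)*y-1) - 6*y*k^4) =
          (y*k - 1) * k * ((k^3+1)*(k^3+2) - 6*k^3)
          + (1-y)*((k-1)*(k^7+k^6+k^5+2*k^4-4*k^3-2*k^2-2*k-2)) := by ring
        rw [id]
        have m1 := mul_nonneg (mul_nonneg (sub_nonneg.2 hyk) k0.le) (sub_nonneg.2 s1)
        have m2 := mul_nonneg (sub_nonneg.2 hy1) (neg_nonneg.2 f2)
        linarith
      have m' := nonpos_of_mul_nonpos_right m (by linarith)
      have m3 : k * ((k^3+1)*(k^3+2*y^2) - 6*y*k^3) ≤ 0 := by linarith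
      have := nonpos_of_mul_nonpos_right m3 k0
      linarith
    rw [hk3]
    have := mul_le_mul_of_nonneg_left g (by positivity : 0 ≤ S^2)
    linarith
  have step : 2 * (a*y*(S^(-a)))/(T+S) ≤ (S^(-a) - T^(-a))/(T - S) := by
    rw [hTa, div_le_div_iff₀ (by linarith) (by linarith)]
    rw [div_le_iff₀ (by linarith)] at hl
    have h1 := mul_le_mul_of_nonneg_left hl (by positivity : 0 ≤ S^(-a) * (a*y))
    have h2 := mul_le_mul_of_nonneg_left hsinh (by positivity : 0 ≤ S^(-a) * (T+S))
    linarith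
  refine le_trans ?_ (mul_le_mul_of_nonneg_left step (by norm_num : (0:ℝ) ≤ 3))
  rw [hTa]
  have e : a * S^(-a) / S + 2 * (a * (S^(-a) * y^2) / T) =
      a * S^(-a) * ((T + 2*y^2*S)/(S*T)) := by field_simp
  have e2 : 3 * (2 * (a*y*(S^(-a)))/(T+S)) = a * S^(-a) * ((6*y)/(T+S)) := by ring
  rw [e, e2]
  apply mul_le_mul_of_nonneg_left _ (by positivity)
  rw [div_le_div_iff₀ (by positivity) (by positivity)]
  linarith

lemma partB {b σ R : ℝ} (hb : 3/2 ≤ b) (hσ : 1 < σ) (hR : R = σ^b)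
    (hc : b ≤ 2 ∨ (b ≤ 3 ∧ σ ≤ 5) ∨ (b ≤ 4 ∧ σ ≤ 5/3)) :
    2 + R/σ ≤ (4 - 1/σ) * (b*(σ-1)*R/(R-1)) := by
  have hσ0 : 0 < σ := by linarith
  have hR1 : 1 < R := by rw [hR]; exact Real.one_lt_rpow hσ (by linarith)
  have hs : 0 < 4 - 1/σ := by
    have : 1/σ < 1 := by rw [div_lt_one hσ0]; exact hσ
    linarith
  have hRp : ∀ n : ℕ, b ≤ n → R ≤ σ^n := by
    intro n hn
    rw [hR, ← Real.rpow_natCast]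
    exact Real.rpow_le_rpow_of_exponent_le hσ.le hn
  rcases le_or_gt b 2 with h2 | h2
  · have hB : σ ≤ b*(σ-1)*R/(R-1) := by
      rw [le_div_iff₀ (by linarith)]
      have h1 := bern_neg (a := b-1) (by linarith) hσ0
      have e : σ^(-(b-1)) * R = σ := by
        rw [hR, ← Real.rpow_add hσ0]
        have : -(b-1) + b = 1 := by ring
        rw [this, Real.rpow_one]
      have := mul_le_mul_of_nonneg_right h1 (by linarith : 0 ≤ R)
      linarith
    refine le_trans ?_ (mul_le_mul_of_nonneg_left hB hs.le)
    have h3 := hRp 2 (by exact_mod_cast h2)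
    have h4 : R/σ ≤ σ := by rw [div_le_iff₀ hσ0]; linarith
    have e : (4 - 1/σ)*σ = 4*σ - 1 := by field_simp
    rw [e]; linarith
  · have hB : 2*σ^2/(σ+1) ≤ b*(σ-1)*R/(R-1) := by
      rw [div_le_div_iff₀ (by linarith) (by linarith)]
      have h1 := one_add_mul_self_le_rpow_one_add (s := (σ^2)⁻¹ - 1) (p := b/2)
        (by have : 0 ≤ (σ^2)⁻¹ := by positivity
            linarith) (by linarith)
      have e : (1 + ((σ^2)⁻¹ - 1))^(b/2) = R⁻¹ := by
        rw [add_sub_cancel, Real.inv_rpow (by positivity), hR, ← Real.rpow_natCast,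
          ← Real.rpow_mul hσ0.le]
        congr 2; push_cast; ring
      rw [e] at h1
      have h3 := mul_le_mul_of_nonneg_right h1 (by positivity : 0 ≤ 2*σ^2*R)
      have e1 : R⁻¹ * (2*σ^2*R) = 2*σ^2 := by field_simp
      have e2 : (1 + b/2*((σ^2)⁻¹ - 1)) * (2*σ^2*R) = 2*σ^2*R + b*R*(1-σ^2) := by field_simp
      rw [e1, e2] at h3
      nlinarith
    refine le_trans ?_ (mul_le_mul_of_nonneg_left hB hs.le)
    have e : (4 - 1/σ)*(2*σ^2/(σ+1)) = (8*σ^2-2*σ)/(σ+1) := by field_simp; ring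
    rw [e, le_div_iff₀ (by linarith)]
    rcases hc with h | ⟨h, h'⟩ | ⟨h, h'⟩
    · linarith
    · have h3 := hRp 3 (by exact_mod_cast h)
      have h4 : R/σ ≤ σ^2 := by rw [div_le_iff₀ hσ0]; linarith
      have : (σ-1)*(σ^2-6*σ-2) ≤ 0 := mul_nonpos_of_nonneg_of_nonpos (by linarith) (by nlinarith)
      have := mul_le_mul_of_nonneg_right h4 (by linarith : 0 ≤ σ+1)
      linarith
    · have h3 := hRp 4 (by exact_mod_cast h)
      have h4 : R/σ ≤ σ^3 := by rw [div_le_iff₀ hσ0]; linarith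
      have : (σ-1)*(σ^3+2*σ^2-6*σ-2) ≤ 0 := by
        apply mul_nonpos_of_nonneg_of_nonpos (by linarith)
        have : σ^2 ≤ 25/9 := by nlinarith
        nlinarith
      have := mul_le_mul_of_nonneg_right h4 (by linarith : 0 ≤ σ+1)
      linarith

lemma sad_b {a b r u X Y σ R : ℝ} (ha : 0 < a) (hab : a * b = 1) (hb : 3/2 ≤ b) (hr : 1 < r)
    (hr2 : r < 2) (hru : r * u < 1) (hX : 0 < X) (hY : Y = σ * X)
    (hR : 1 - u = R * (1 - r*u)) (hσ : 1 < σ) (hR1 : 1 < R) (h2 : (2-r)*σ < 1)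
    (H : 2 + R/σ ≤ (4 - 1/σ) * (b*(σ-1)*R/(R-1))) :
    2 * (a*X/(1-u)) + (2-r)^2 * (a*Y/(1-r*u)) < (2+r)*((Y-X)/((r-1)*u)) := by
  have hT : 0 < 1 - r*u := by linarith
  set T := 1 - r*u with hTd
  have hσ0 : 0 < σ := by linarith
  have e1 : (r-1)*u = (R-1)*T := by linarith
  have hRm : 0 < R - 1 := by linarith
  have l1 : 2*(a*X/(1-u)) + (2-r)^2*(a*Y/T) = a*X/(R*T) * (2 + (2-r)^2*σ*R) := by
    rw [hR, hY]; field_simp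
  have l2 : (2+r)*((Y-X)/((r-1)*u)) = a*X/(R*T) * ((2+r)*(b*(σ-1)*R/(R-1))) := by
    rw [e1, hY]
    have : a*X/(R*T) * ((2+r)*(b*(σ-1)*R/(R-1))) = (a*b)*(X*(2+r)*(σ-1)/((R-1)*T)) := by
      field_simp
    rw [this, hab]; field_simp
  rw [l1, l2]
  apply mul_lt_mul_of_pos_left _ (by positivity)
  have hB : 0 < b*(σ-1)*R/(R-1) := by
    have : 0 < σ - 1 := by linarith
    have : 0 < b := by linarith
    positivity
  have c1 : (2-r)^2*σ*R ≤ R/σ := by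
    rw [le_div_iff₀ hσ0]
    have h0 : 0 ≤ (2-r)*σ := by
      have : 0 < 2 - r := by linarith
      positivity
    have : ((2-r)*σ)^2 ≤ 1 := by nlinarith
    have := mul_le_mul_of_nonneg_right this (by linarith : 0 ≤ R)
    linarith
  have c2 : 4 - 1/σ < 2 + r := by
    have : 2 - r < 1/σ := by rw [lt_div_iff₀ hσ0]; exact h2
    linarith
  have := mul_lt_mul_of_pos_right c2 hB
  linarith

lemma iso_III {r X Y Z W : ℝ} (e1 : Y = (1+r)*W + Z) (e2 : X + r^2*W = 4*Z) :
    (r-1)*Y = (Y-X) + (2+r)*(Z-W) := by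
  rw [e1]; linear_combination (1:ℝ) * e2

/-- Facts about an isosceles solution with `ρ > 1`. -/
lemma iso_facts {a b r u : ℝ} (ha : 0 < a) (hab : a * b = 1) (hr : 1 < r) (h : Iso a r u) :
    ps a u < ps a (r*u) ∧ ps a (-(r*((2+r)*u))) < ps a (-((2+r)*u)) ∧
    (2-r) * ps a (r*u) < ps a u ∧
    (ps a (r*u) / ps a u)^b = (1-u)/(1-r*u) ∧ 1 < (1-u)/(1-r*u) := by
  obtain ⟨hr0, hu, hu1, hru, e1, e2⟩ := h
  have hv0 : 0 < (2+r)*u := by positivity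
  have hrv : (2+r)*u < r*((2+r)*u) := by nlinarith
  have h1 : ps a u < ps a (r*u) := ps_lt ha (by nlinarith) hru
  have h2 : ps a (-(r*((2+r)*u))) < ps a (-((2+r)*u)) := ps_lt ha (by linarith) (by linarith)
  refine ⟨h1, h2, ?_, ?_, ?_⟩
  · have h3 := iso_III e1 e2
    have := mul_pos (by linarith : 0 < 2 + r) (sub_pos.2 h2)
    linarith
  · have hp := ps_pos (a := a) hu1
    rw [ps_ratio hu1 hru, mul_div_cancel_left₀ _ hp.ne', ← Real.rpow_mul
      (div_nonneg (by linarith) (by linarith)), neg_mul, hab, Real.rpow_neg_one, inv_div]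
  · rw [lt_div_iff₀ (by linarith)]; nlinarith

lemma sad_2 {a b r u : ℝ} (ha : 0 < a) (hab : a * b = 1) (hb : 3/2 ≤ b) (hr : 1 < r)
    (hr2 : r ≤ 1.7) (h : Iso a r u) (hc : b ≤ 2 ∨ (b ≤ 3) ∨ (b ≤ 4 ∧ r ≤ 1.4)) :
    u * (2*ps a u/(1-u) + (r-2)^2*ps a (r*u)/(1-r*u) + (4+r-2)^2*ps a (-((2+r)*u))/(1+(2+r)*u)
      + 2*(2*(1+r)-r)^2*ps a (-(r*((2+r)*u)))/(1+r*((2+r)*u)))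
      < b*(2+r)^2*ps a (-(r*((2+r)*u))) := by
  obtain ⟨f1, f2, f3, f4, f5⟩ := iso_facts ha hab hr h
  obtain ⟨hr0, hu, hu1, hru, e1, e2⟩ := h
  have ha1 : a ≤ 2/3 := by nlinarith
  have hX := ps_pos (a := a) hu1
  have hv0 : 0 < (2+r)*u := by positivity
  have hrv : (2+r)*u < r*((2+r)*u) := by nlinarith
  have pa := partA ha ha1 (S := 1 + (2+r)*u) (T := 1 + r*((2+r)*u)) (by linarith) (by linarith)
    (by nlinarith)
  have hσ : 1 < ps a (r*u)/ps a u := by rw [lt_div_iff₀ hX]; linarith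
  have hσ2 : (2-r) * (ps a (r*u)/ps a u) < 1 := by
    rw [← mul_div_assoc, div_lt_one hX]; exact f3
  have pb := partB hb hσ f4.symm (by
    rcases hc with h | h | ⟨h, h'⟩
    · left; exact h
    · right; left; refine ⟨h, ?_⟩
      nlinarith
    · right; right; refine ⟨h, ?_⟩
      nlinarith)
  have pb' := sad_b (Y := ps a (r*u)) (σ := ps a (r*u)/ps a u) (R := (1-u)/(1-r*u)) ha hab hb hr
    (by linarith) hru hX (div_mul_cancel₀ _ hX.ne').symm
    (div_mul_cancel₀ _ (by linarith : 1 - r*u ≠ 0)).symm hσ f5 hσ2 pb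
  have z1 : (1 + (2+r)*u)^(-a) = ps a (-((2+r)*u)) := by unfold ps; rw [sub_neg_eq_add]
  have w1 : (1 + r*((2+r)*u))^(-a) = ps a (-(r*((2+r)*u))) := by unfold ps; rw [sub_neg_eq_add]
  rw [z1, w1] at pa
  clear z1 w1 pb hσ hσ2 f4 f5
  generalize ps a u = X at *
  generalize ps a (r*u) = Y at *
  generalize ps a (-((2+r)*u)) = Z at *
  generalize ps a (-(r*((2+r)*u))) = W at *
  have h3 := iso_III e1 e2
  have hr1 : 0 < r - 1 := by linarith
  set v := (2+r)*u with hv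
  have pa' := mul_le_mul_of_nonneg_left pa (by positivity : 0 ≤ (2+r)^2*u)
  have pb'' := mul_lt_mul_of_pos_left pb' hu
  have q1 : (2+r)^2*u * (3*((Z-W)/(1 + r*v - (1+v)))) + u*((2+r)*((Y-X)/((r-1)*u)))
      = (2+r)^2*W := by
    have : 1 + r*v - (1+v) = (r-1)*v := by ring
    rw [this]
    have s1 : (2+r)^2*u * (3*((Z-W)/((r-1)*v))) = 3*((2+r)*(Z-W))/(r-1) := by
      rw [hv]; field_simp
    have s2 : u*((2+r)*((Y-X)/((r-1)*u))) = (2+r)*(Y-X)/(r-1) := by field_simp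
    rw [s1, s2, ← add_div, div_eq_iff hr1.ne']
    have s3 : (2+r)*(Z-W) = (r-1)*Y - (Y-X) := by linarith
    have s4 : (2+r)^2*W = 4*Y - X := by rw [e1]; linear_combination (1:ℝ)*e2
    rw [s3, s4]; ring
  have q2 : a * (u * (2*X/(1-u) + (r-2)^2*Y/(1-r*u) + (4+r-2)^2*Z/(1+v)
      + 2*(2*(1+r)-r)^2*W/(1+r*v))) < (2+r)^2*W := by
    rw [← q1]
    refine lt_of_eq_of_lt ?_ (add_lt_add_of_le_of_lt pa' pb'')
    ring
  have hb0 : 0 < b := by linarith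
  have q3 := mul_lt_mul_of_pos_left q2 hb0
  rw [← mul_assoc, mul_comm b a, hab, one_mul] at q3
  linarith

lemma iso_contra {a b r u : ℝ} (ha : 0 < a) (hab : a * b = 1) (hb : 4 ≤ b) (hr : 1 < r)
    (hr2 : r ≤ 1.3) (h : Iso a r u) : False := by
  obtain ⟨f1, f2, f3, f4, f5⟩ := iso_facts ha hab hr h
  obtain ⟨hr0, hu, hu1, hru, e1, e2⟩ := h
  have hrv : 0 < r*((2+r)*u) := by positivity
  have g1 := (ratio_le (c := 2+r) ha hab (by linarith) (s := -(r*((2+r)*u))) (by linarith) hru).1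
    (by linarith)
  have g2 := (ratio_lt (c := 2-r) ha hab (by linarith) hru hu1).1 f3
  have g3 : 1 - b*(r-1) ≤ (2-r)^b := by
    have := one_add_mul_self_le_rpow_one_add (s := 1 - r) (p := b) (by linarith) (by linarith)
    have e : 1 + (1-r) = 2 - r := by ring
    rw [e] at this; linarith
  set T := 1 - r*u with hT
  have hT0 : 0 < T := by linarith
  have hu' : r*(1-u) = r - 1 + T := by rw [hT]; ring
  set M := (2-r)^b with hM
  have hM0 : 0 < M := Real.rpow_pos_of_pos (by linarith) _
  have g4 : M*(r-1) < T*((1+b)*(r-1)) := by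
    have : M*(r*(1-u)) < r*T := by nlinarith
    rw [hu'] at this
    nlinarith
  have g5 : M < T*(1+b) := by
    have : M*(r-1) < T*(1+b)*(r-1) := by linarith
    exact lt_of_mul_lt_mul_right this (by linarith)
  have g6 : (2+r)^b * T < 3 + r := by
    have : r*((2+r)*u) < 2 + r := by nlinarith
    linarith
  have hN0 : 0 < (2+r)^b := Real.rpow_pos_of_pos (by linarith) _
  have g7 : (2+r)^b * M < (3+r)*(1+b) := by
    have h1 := mul_lt_mul_of_pos_left g5 hN0
    have h2 := mul_lt_mul_of_pos_right g6 (by linarith : 0 < 1 + b)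
    linarith
  rw [hM, ← Real.mul_rpow (by linarith) (by linarith)] at g7
  have g8 : (2.31:ℝ)^b ≤ ((2+r)*(2-r))^b :=
    Real.rpow_le_rpow (by norm_num) (by nlinarith) (by linarith)
  have g9 : 28*(1+0.69*(b-4)) ≤ (2.31:ℝ)^b := by
    have e : (2.31:ℝ)^b = 2.31^(4:ℝ) * 2.31^(b-4) := by
      rw [← Real.rpow_add (by norm_num)]; congr 1; ring
    rw [e]
    apply mul_le_mul
    · have : (4:ℝ) = ((4:ℕ):ℝ) := by norm_num
      rw [this, Real.rpow_natCast]; norm_num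
    · have h1 := two_rpow_ge (t := b-4) (by linarith)
      have h2 : (2:ℝ)^(b-4) ≤ 2.31^(b-4) :=
        Real.rpow_le_rpow (by norm_num) (by norm_num) (by linarith)
      nlinarith [sq_nonneg (b-4)]
    · nlinarith
    · positivity
  nlinarith

lemma iso_saddle {a b r u : ℝ} (ha : 0 < a) (hab : a * b = 1) (hb : 3/2 ≤ b) (hr : 1 < r)
    (h : Iso a r u) : ∃ κ, 0 < κ ∧
    u * (2*ps a u/(1-u) + (r-κ)^2*ps a (r*u)/(1-r*u) + (4+r-κ)^2*ps a (-((2+r)*u))/(1+(2+r)*u)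
      + 2*(κ*(1+r)-r)^2*ps a (-(r*((2+r)*u)))/(1+r*((2+r)*u)))
      < b*(κ+r)^2*ps a (-(r*((2+r)*u))) := by
  have h' := h
  obtain ⟨f1, f2, f3, f4, f5⟩ := iso_facts ha hab hr h
  obtain ⟨hr0, hu, hu1, hru, e1, e2⟩ := h
  have hrv : 0 < r*((2+r)*u) := by positivity
  have hv : 0 < (2+r)*u := by positivity
  have hX := ps_pos (a := a) hu1
  have hW := ps_pos (a := a) (show -(r*((2+r)*u)) < 1 by linarith)
  have key : ∀ E, ps a u ≤ E * ps a (-(r*((2+r)*u))) →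
      E/(r-1) + (E + r^2)/(1+r) + r^3/(3+r) < 2*b*r^2 → ∃ κ, 0 < κ ∧
    u * (2*ps a u/(1-u) + (r-κ)^2*ps a (r*u)/(1-r*u) + (4+r-κ)^2*ps a (-((2+r)*u))/(1+(2+r)*u)
      + 2*(κ*(1+r)-r)^2*ps a (-(r*((2+r)*u)))/(1+r*((2+r)*u)))
      < b*(κ+r)^2*ps a (-(r*((2+r)*u))) := fun E h1 h2 =>
    ⟨r, hr0, sad_r hr hu hru rfl hX hW e2 h1 h2⟩
  have bnd : ∀ c Q : ℝ, 0 < c → (1/c)^b * Q ≤ 1 → 1 + r*((2+r)*u) ≤ Q * (1 + (2+r)*u) →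
      ps a u ≤ (4*c - r^2) * ps a (-(r*((2+r)*u))) := by
    intro c Q hc h1 h2
    have h3 : (1/c) * ps a (-((2+r)*u)) ≤ ps a (-(r*((2+r)*u))) := by
      rw [ratio_le ha hab (by positivity) (by linarith) (by linarith)]
      have h4 := mul_le_mul_of_nonneg_left h2 (by positivity : 0 ≤ (1/c)^b)
      have h5 := mul_le_mul_of_nonneg_right h1 (by linarith : 0 ≤ 1 + (2+r)*u)
      linarith
    rw [one_div, inv_mul_le_iff₀ hc] at h3
    linarith
  rcases le_or_gt 2 r with hr2 | hr2
  · apply key ((2+r)^2/3)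
    · have : (2+r)^2 * ps a (-(r*((2+r)*u))) = 4 * ps a (r*u) - ps a u := by
        rw [e1]; linear_combination (1:ℝ)*e2
      linarith
    · have hb2 : 3*r^2 ≤ 2*b*r^2 := by nlinarith [sq_nonneg r]
      refine lt_of_lt_of_le ?_ hb2
      obtain ⟨w, hw, rfl⟩ : ∃ w, 0 ≤ w ∧ r = 2 + w := ⟨r - 2, by linarith, by ring⟩
      have k1 : 0 < 2 + w - 1 := by linarith
      rw [div_div, div_add_div _ _ (by positivity) (by positivity),
        div_add_div _ _ (by positivity) (by positivity), div_lt_iff₀ (by positivity), ← sub_pos]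
      ring_nf
      positivity
  have num : ∀ r0 c K : ℝ, 1 < r0 → r0 ≤ r → 0 ≤ 4*c-r0^2 → 0 ≤ c → 0 ≤ K → K ≤ 2*b →
      (4*c-r0^2)/(r0-1) + 4*c/(1+r0) + 1.6 < K*r0^2 →
      (4*c-r^2)/(r-1) + ((4*c-r^2) + r^2)/(1+r) + r^3/(3+r) < 2*b*r^2 := by
    intro r0 c K h0 h1 h2 h2' hK h3' h4
    have h3 : K*r0^2 ≤ 2*b*r^2 :=
      mul_le_mul h3' (pow_le_pow_left₀ (by linarith) h1 2) (by positivity) (by linarith)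
    have b1 : (4*c-r^2)/(r-1) ≤ (4*c-r0^2)/(r0-1) := by
      have := pow_le_pow_left₀ (by linarith : 0 ≤ r0) h1 2
      apply div_le_div₀ h2 (by linarith) (by linarith) (by linarith)
    have b2 : ((4*c-r^2) + r^2)/(1+r) ≤ 4*c/(1+r0) := by
      rw [sub_add_cancel]
      apply div_le_div₀ (by linarith) le_rfl (by linarith) (by linarith)
    have b3 : r^3/(3+r) ≤ 1.6 := by
      rw [div_le_iff₀ (by linarith)]
      have : r^2 ≤ 4 := by nlinarith
      nlinarith
    linarith
  have hvr : r*((2+r)*u) < 2 + r := by nlinarith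
  rcases le_or_gt 1.7 r with h17 | h17
  · apply key (4*1.41 - r^2)
    · apply bnd 1.41 (5/3) (by norm_num)
      · have h1 : (1/1.41:ℝ)^b ≤ (1/1.41:ℝ)^(3/2:ℝ) :=
          Real.rpow_le_rpow_of_exponent_ge (by norm_num) (by norm_num) hb
        have h2 : ((1/1.41:ℝ)^(3/2:ℝ))^2 ≤ 0.36 := by
          rw [← Real.rpow_natCast, ← Real.rpow_mul (by norm_num)]
          have : (3/2:ℝ) * ((2:ℕ):ℝ) = ((3:ℕ):ℝ) := by norm_num
          rw [this, Real.rpow_natCast]; norm_num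
        have h3 : (1/1.41:ℝ)^(3/2:ℝ) ≤ 0.6 := by
          refine abs_le_of_sq_le_sq' ?_ (by norm_num) |>.2
          norm_num at h2 ⊢; exact h2
        linarith
      · have : r * ((r-5/3)*((2+r)*u)) ≤ r * (2/3) := by nlinarith
        have := le_of_mul_le_mul_left this hr0
        linarith
    · exact num 1.7 1.41 3 (by norm_num) h17 (by norm_num) (by norm_num) (by norm_num)
        (by linarith) (by norm_num)
  have e15 : 3 ≤ b → ps a u ≤ (4*1.145 - r^2) * ps a (-(r*((2+r)*u))) := by
    intro hb3
    apply bnd 1.145 (3/2) (by norm_num)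
    · have h1 : (1/1.145:ℝ)^b ≤ (1/1.145:ℝ)^((3:ℕ):ℝ) :=
        Real.rpow_le_rpow_of_exponent_ge (by norm_num) (by norm_num) (by exact_mod_cast hb3)
      rw [Real.rpow_natCast] at h1
      norm_num at h1 ⊢
      linarith
    · have : r * ((r-3/2)*((2+r)*u)) ≤ r * (1/2) := by nlinarith
      have := le_of_mul_le_mul_left this hr0
      linarith
  rcases le_or_gt b 3 with hb3 | hb3
  · exact ⟨2, by norm_num, sad_2 ha hab hb hr h17.le h' (Or.inr (Or.inl hb3))⟩
  rcases le_or_gt b 4 with hb4 | hb4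
  · rcases le_or_gt r 1.4 with h14 | h14
    · exact ⟨2, by norm_num, sad_2 ha hab hb hr h17.le h' (Or.inr (Or.inr ⟨hb4, h14⟩))⟩
    · apply key _ (e15 hb3.le)
      exact num 1.4 1.145 6 (by norm_num) h14.le (by norm_num) (by norm_num)
        (by norm_num) (by linarith) (by norm_num)
  · rcases le_or_gt r 1.3 with h14 | h14
    · exact (iso_contra ha hab hb4.le hr h14 h').elim
    · apply key _ (e15 hb3.le)
      exact num 1.3 1.145 8 (by norm_num) h14.le (by norm_num) (by norm_num)
        (by norm_num) (by linarith) (by norm_num)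

lemma first_order_strict {φ : ℝ → ℝ} {c : ℝ} (h : HasDerivAt φ c 0) (hc : 0 < c) :
    ∀ᶠ t in nhdsWithin (0:ℝ) (Set.Ioi 0), φ 0 < φ t := by
  have h1 := (hasDerivAt_iff_tendsto_slope.1 h).eventually (lt_mem_nhds hc)
  have h2 : nhdsWithin (0:ℝ) (Set.Ioi 0) ≤ nhdsWithin 0 {0}ᶜ :=
    nhdsWithin_mono _ (fun x hx => (ne_of_gt hx : x ≠ 0))
  filter_upwards [h2 h1, self_mem_nhdsWithin] with t ht ht0
  have ht0' : 0 < t := ht0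
  rw [slope_def_field, sub_zero] at ht
  have := (div_pos_iff_of_pos_right ht0').1 ht
  linarith

lemma second_order_strict {φ φ' : ℝ → ℝ} {c : ℝ} (h : ∀ᶠ t in nhds (0:ℝ), HasDerivAt φ (φ' t) t)
    (h0 : φ' 0 = 0) (h2 : HasDerivAt φ' c 0) (hc : 0 < c) :
    ∀ᶠ t in nhdsWithin (0:ℝ) (Set.Ioi 0), φ 0 < φ t := by
  have h1 := first_order_strict h2 hc
  rw [h0] at h1
  obtain ⟨ε, hε, h3⟩ := Metric.eventually_nhds_iff.1 h
  obtain ⟨ε', hε', h4⟩ := Metric.eventually_nhds_iff.1 (eventually_nhdsWithin_iff.1 h1)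
  have : Set.Ioo (0:ℝ) (min ε ε') ∈ nhdsWithin (0:ℝ) (Set.Ioi 0) :=
    Ioo_mem_nhdsGT (lt_min hε hε')
  filter_upwards [this] with t ht
  have hd : ∀ s ∈ Set.Icc 0 t, HasDerivAt φ (φ' s) s := fun s hs => h3 (by
    rw [Real.dist_eq, sub_zero, abs_of_nonneg hs.1]
    exact lt_of_le_of_lt hs.2 (lt_of_lt_of_le ht.2 (min_le_left _ _)))
  have hm : StrictMonoOn φ (Set.Icc 0 t) := by
    apply strictMonoOn_of_deriv_pos (convex_Icc _ _)
    · exact fun s hs => (hd s hs).continuousAt.continuousWithinAt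
    · intro s hs
      rw [interior_Icc] at hs
      rw [(hd s ⟨hs.1.le, hs.2.le⟩).deriv]
      refine h4 ?_ hs.1
      rw [Real.dist_eq, sub_zero, abs_of_nonneg hs.1.le]
      exact hs.2.trans (lt_of_lt_of_le ht.2 (min_le_right _ _))
  exact hm ⟨le_rfl, ht.1.le⟩ ⟨ht.1.le, le_rfl⟩ ht.1

lemma quad_d1 {a p m n : ℝ} {t : ℝ} (h : 0 < p + m*t + n*t^2) :
    HasDerivAt (fun t => (p + m*t + n*t^2)^(1-a))
      ((1-a)*((p + m*t + n*t^2)^(-a)*(m + 2*n*t))) t := by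
  have h1 : HasDerivAt (fun t => p + m*t + n*t^2) (m + 2*n*t) t := by
    have := (((hasDerivAt_id t).const_mul m).const_add p).add (((hasDerivAt_id t).pow 2).const_mul n)
    refine this.congr_deriv ?_
    simp; ring
  have := h1.rpow_const (p := 1-a) (Or.inl h.ne')
  refine this.congr_deriv ?_
  have : 1 - a - 1 = -a := by ring
  rw [this]; ring

lemma quad_d2 {a p m n : ℝ} (h : 0 < p) :
    HasDerivAt (fun t => (1-a)*((p + m*t + n*t^2)^(-a)*(m + 2*n*t)))
      ((1-a)*(p^(-a)*(2*n) - a*p^(-a)/p*m^2)) 0 := by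
  have h1 : HasDerivAt (fun t:ℝ => p + m*t + n*t^2) m 0 := by
    have := (((hasDerivAt_id (0:ℝ)).const_mul m).const_add p).add
      (((hasDerivAt_id (0:ℝ)).pow 2).const_mul n)
    refine this.congr_deriv ?_
    simp
  have h2 := h1.rpow_const (p := -a) (Or.inl (by simpa using h.ne'))
  have h3 : HasDerivAt (fun t:ℝ => m + 2*n*t) (2*n) 0 := by
    have := ((hasDerivAt_id (0:ℝ)).const_mul (2*n)).const_add m
    refine this.congr_deriv ?_
    simp
  refine ((h2.mul h3).const_mul (1-a)).congr_deriv ?_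
  have : p^(-a-1) = p^(-a)/p := by rw [Real.rpow_sub h, Real.rpow_one]
  simp only [mul_zero, add_zero, ne_eq, OfNat.ofNat_ne_zero, not_false_eq_true, zero_pow, this]
  ring

noncomputable def Gf (a x y : ℝ) : ℝ := 2*(1+(2*x+y)*x)^(1-a) + (1+(2*x+y)*y)^(1-a) +
  (1-x^2)^(1-a) + 2*(1-x*y)^(1-a)

/-- first and second order improvement for `Gf` along the direction `(α, β)` -/
lemma Gf_improve {a x y α β : ℝ} (ha1 : a < 1) (h1 : 0 < 1+(2*x+y)*x) (h2 : 0 < 1+(2*x+y)*y)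
    (h3 : 0 < 1-x^2) (h4 : 0 < 1-x*y) (D1 D2 : ℝ)
    (hD1 : D1 = 2*((1+(2*x+y)*x)^(-a)*((2*α+β)*x+(2*x+y)*α))
      + (1+(2*x+y)*y)^(-a)*((2*α+β)*y+(2*x+y)*β)
      + (1-x^2)^(-a)*(-(2*x*α)) + 2*((1-x*y)^(-a)*(-(α*y+β*x))))
    (hD2 : D2 = 2*((1+(2*x+y)*x)^(-a)*(2*((2*α+β)*α))
        - a*(1+(2*x+y)*x)^(-a)/(1+(2*x+y)*x)*((2*α+β)*x+(2*x+y)*α)^2)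
      + ((1+(2*x+y)*y)^(-a)*(2*((2*α+β)*β))
        - a*(1+(2*x+y)*y)^(-a)/(1+(2*x+y)*y)*((2*α+β)*y+(2*x+y)*β)^2)
      + ((1-x^2)^(-a)*(2*(-α^2)) - a*(1-x^2)^(-a)/(1-x^2)*(-(2*x*α))^2)
      + 2*((1-x*y)^(-a)*(2*(-(α*β))) - a*(1-x*y)^(-a)/(1-x*y)*(-(α*y+β*x))^2))
    (hh : 0 < D1 ∨ (D1 = 0 ∧ 0 < D2)) :
    ∀ᶠ t in nhdsWithin (0:ℝ) (Set.Ioi 0), Gf a x y < Gf a (x+α*t) (y+β*t) := by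
  set φ : ℝ → ℝ := fun t =>
    2*(1+(2*x+y)*x + ((2*α+β)*x+(2*x+y)*α)*t + (2*α+β)*α*t^2)^(1-a)
    + (1+(2*x+y)*y + ((2*α+β)*y+(2*x+y)*β)*t + (2*α+β)*β*t^2)^(1-a)
    + (1-x^2 + (-(2*x*α))*t + (-α^2)*t^2)^(1-a)
    + 2*(1-x*y + (-(α*y+β*x))*t + (-(α*β))*t^2)^(1-a) with hφ
  have e : ∀ t, Gf a (x+α*t) (y+β*t) = φ t := by
    intro t
    rw [hφ]; unfold Gf
    dsimp only
    congr 1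
    · congr 1
      · congr 1
        · congr 2; ring
        · congr 1; ring
      · congr 1; ring
    · congr 2; ring
  have e0 : Gf a x y = φ 0 := by rw [← e 0]; simp
  simp only [e, e0]
  have ev : ∀ p m n : ℝ, 0 < p → ∀ᶠ t in nhds (0:ℝ), 0 < p + m*t + n*t^2 := by
    intro p m n hp
    have hc : ContinuousAt (fun t:ℝ => p + m*t + n*t^2) 0 := by fun_prop
    exact hc.eventually (lt_mem_nhds (by simpa using hp))
  set φ' : ℝ → ℝ := fun t =>
    2*((1-a)*((1+(2*x+y)*x + ((2*α+β)*x+(2*x+y)*α)*t + (2*α+β)*α*t^2)^(-a)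
      *(((2*α+β)*x+(2*x+y)*α) + 2*((2*α+β)*α)*t)))
    + (1-a)*((1+(2*x+y)*y + ((2*α+β)*y+(2*x+y)*β)*t + (2*α+β)*β*t^2)^(-a)
      *(((2*α+β)*y+(2*x+y)*β) + 2*((2*α+β)*β)*t))
    + (1-a)*((1-x^2 + (-(2*x*α))*t + (-α^2)*t^2)^(-a)*((-(2*x*α)) + 2*(-α^2)*t))
    + 2*((1-a)*((1-x*y + (-(α*y+β*x))*t + (-(α*β))*t^2)^(-a)
      *((-(α*y+β*x)) + 2*(-(α*β))*t))) with hφ'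
  have d1 : ∀ᶠ t in nhds (0:ℝ), HasDerivAt φ (φ' t) t := by
    filter_upwards [ev _ ((2*α+β)*x+(2*x+y)*α) ((2*α+β)*α) h1,
      ev _ ((2*α+β)*y+(2*x+y)*β) ((2*α+β)*β) h2,
      ev _ (-(2*x*α)) (-α^2) h3, ev _ (-(α*y+β*x)) (-(α*β)) h4] with t k1 k2 k3 k4
    exact ((((quad_d1 k1).const_mul 2).add (quad_d1 k2)).add (quad_d1 k3)).add
      ((quad_d1 k4).const_mul 2)
  have d2 : HasDerivAt φ' ((1-a)*D2) 0 := by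
    refine (((((quad_d2 h1).const_mul 2).add (quad_d2 h2)).add (quad_d2 h3)).add
      ((quad_d2 h4).const_mul 2)).congr_deriv ?_
    rw [hD2]; ring
  have v0 : φ' 0 = (1-a)*D1 := by
    rw [hφ', hD1]; simp; ring
  rcases hh with hh | ⟨hh, hh'⟩
  · apply first_order_strict (c := (1-a)*D1)
    · rw [← v0]; exact d1.self_of_nhds
    · exact mul_pos (by linarith) hh
  · exact second_order_strict d1 (by rw [v0, hh, mul_zero]) d2 (mul_pos (by linarith) hh')

lemma iso_radial {a r u u' : ℝ} (ha : 0 < a) (hr : 0 < r) (hu : 0 < u) (huu : u < u')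
    (hu1 : u' < 1) (hru : r*u' < 1)
    (h : 2*(2+r)*ps a (-((2+r)*u')) + r*(2+r)*ps a (-(r*((2+r)*u'))) - ps a u' - 2*r*ps a (r*u') = 0)
    (h' : 2*(2+r)*ps a (-((2+r)*u)) + r*(2+r)*ps a (-(r*((2+r)*u))) - ps a u - 2*r*ps a (r*u) = 0) :
    False := by
  have k0 : (2+r)*u < (2+r)*u' := mul_lt_mul_of_pos_left huu (by linarith)
  have k00 : 0 < (2+r)*u := by positivity
  have kk : r*((2+r)*u) < r*((2+r)*u') := mul_lt_mul_of_pos_left k0 hr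
  have kk0 : 0 < r*((2+r)*u) := by positivity
  have k1 := ps_lt ha (show -((2+r)*u') < -((2+r)*u) by linarith) (by linarith)
  have k2 := ps_lt ha (show -(r*((2+r)*u')) < -(r*((2+r)*u)) by linarith) (by linarith)
  have k3 := ps_lt ha huu hu1
  have k4 := ps_lt ha (mul_lt_mul_of_pos_left huu hr) hru
  have m1 := mul_lt_mul_of_pos_left k1 (by linarith : 0 < 2*(2+r))
  have m2 := mul_lt_mul_of_pos_left k2 (by positivity : 0 < r*(2+r))
  have m4 := mul_lt_mul_of_pos_left k4 (by linarith : 0 < 2*r)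
  linarith

lemma Iso.radial {a r u : ℝ} (h : Iso a r u) :
    2*(2+r)*ps a (-((2+r)*u)) + r*(2+r)*ps a (-(r*((2+r)*u))) - ps a u - 2*r*ps a (r*u) = 0 := by
  obtain ⟨hr0, hu, hu1, hru, e1, e2⟩ := h
  rw [e1]; linear_combination -e2

lemma iso_same {a r u u' : ℝ} (ha : 0 < a) (h : Iso a r u) (hu1 : u' < 1) (hu : 0 < u')
    (hru : r*u' < 1)
    (h' : 2*(2+r)*ps a (-((2+r)*u')) + r*(2+r)*ps a (-(r*((2+r)*u'))) - ps a u' - 2*r*ps a (r*u') = 0) :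
    u = u' := by
  have h0 := h.radial
  obtain ⟨hr0, hu', hu1', hru', e1, e2⟩ := h
  rcases lt_trichotomy u u' with k | k | k
  · exact (iso_radial ha hr0 hu' k hu1 hru h' h0).elim
  · exact k
  · exact (iso_radial ha hr0 hu k hu1' hru' h0 h').elim

set_option maxHeartbeats 1600000 in
lemma iso_unique_r {a b r₁ r₂ u₁ u₂ : ℝ} (ha : 0 < a) (hab : a * b = 1) (hb : 3/2 ≤ b)
    (hr1 : 1 < r₁) (hr : r₁ < r₂) (h1 : Iso a r₁ u₁) (h2 : Iso a r₂ u₂) : False := by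
  have ha1 : a < 1 := by nlinarith
  set p := 1 - (2+r₂)^(-(2*b)) with hp
  have hpp : 0 < (2+r₂)^(-(2*b)) := Real.rpow_pos_of_pos (by linarith) _
  have hp1 : p < 1 := by linarith
  have hp0 : 0 < p := by
    have : (2+r₂)^(-(2*b)) < 1 := Real.rpow_lt_one_of_one_lt_of_neg (by linarith) (by linarith)
    linarith
  have hpsp : ps a p = (2+r₂)^2 := by
    unfold ps
    rw [hp, sub_sub_cancel, ← Real.rpow_mul (by linarith), ← Real.rpow_natCast]
    congr 1; push_cast; linarith
  set K : Set (ℝ × ℝ) := {z | 0 ≤ z.1 ∧ r₁*z.1 ≤ z.2 ∧ z.2 ≤ r₂*z.1 ∧ z.1*z.2 ≤ p} with hK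
  have hKb : ∀ z ∈ K, z.1^2 < 1 := by
    rintro z ⟨k1, k2, k3, k4⟩
    have : z.1 ≤ z.2 := by nlinarith
    nlinarith
  have hKc : IsCompact K := by
    apply Metric.isCompact_of_isClosed_isBounded
    · rw [hK]
      have c1 : Continuous (fun z : ℝ × ℝ => z.1) := continuous_fst
      have c2 : Continuous (fun z : ℝ × ℝ => z.2) := continuous_snd
      exact (isClosed_le continuous_const c1).inter ((isClosed_le (c1.const_mul r₁) c2).inter
        ((isClosed_le c2 (c1.const_mul r₂)).inter (isClosed_le (c1.mul c2) continuous_const)))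
    · refine (Metric.isBounded_Icc ((0:ℝ),(0:ℝ)) (1,r₂)).subset ?_
      intro z hz
      have hb := hKb z hz
      obtain ⟨k1, k2, k3, k4⟩ := hz
      have hz1 : z.1 ≤ 1 := by nlinarith
      exact ⟨⟨k1, by simp only; nlinarith⟩, ⟨hz1, by simp only; nlinarith⟩⟩
  have pos : ∀ z ∈ K, 0 < 1+(2*z.1+z.2)*z.1 ∧ 0 < 1+(2*z.1+z.2)*z.2 ∧ 0 < 1-z.1^2 ∧ 0 < 1-z.1*z.2 := by
    intro z hz
    have hb := hKb z hz
    obtain ⟨k1, k2, k3, k4⟩ := hz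
    have : 0 ≤ z.2 := by nlinarith
    exact ⟨by positivity, by positivity, by linarith, by linarith⟩
  have hGc : ContinuousOn (fun z : ℝ × ℝ => Gf a z.1 z.2) K := by
    unfold Gf
    refine ContinuousOn.add (ContinuousOn.add (ContinuousOn.add ?_ ?_) ?_) ?_
    · exact continuousOn_const.mul (ContinuousOn.rpow_const (by fun_prop)
        (fun z hz => Or.inl (pos z hz).1.ne'))
    · exact (ContinuousOn.rpow_const (by fun_prop) (fun z hz => Or.inl (pos z hz).2.1.ne'))
    · exact (ContinuousOn.rpow_const (by fun_prop) (fun z hz => Or.inl (pos z hz).2.2.1.ne'))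
    · exact continuousOn_const.mul (ContinuousOn.rpow_const (by fun_prop)
        (fun z hz => Or.inl (pos z hz).2.2.2.ne'))
  obtain ⟨⟨x, y⟩, hzK, hmax⟩ := hKc.exists_isMaxOn ⟨(0,0), by simp [hK, hp0.le]⟩ hGc
  obtain ⟨q1, q2, q3, q4⟩ := pos _ hzK
  have hzb := hKb _ hzK
  simp only at q1 q2 q3 q4 hzb
  obtain ⟨k1, k2, k3, k4⟩ := hzK
  simp only at k1 k2 k3 k4
  -- the improvement principle
  have imp : ∀ α β D1 D2 : ℝ, (∀ᶠ t in nhdsWithin (0:ℝ) (Set.Ioi 0), (x+α*t, y+β*t) ∈ K) →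
    (D1 = 2*((1+(2*x+y)*x)^(-a)*((2*α+β)*x+(2*x+y)*α))
      + (1+(2*x+y)*y)^(-a)*((2*α+β)*y+(2*x+y)*β)
      + (1-x^2)^(-a)*(-(2*x*α)) + 2*((1-x*y)^(-a)*(-(α*y+β*x)))) →
    (D2 = 2*((1+(2*x+y)*x)^(-a)*(2*((2*α+β)*α))
        - a*(1+(2*x+y)*x)^(-a)/(1+(2*x+y)*x)*((2*α+β)*x+(2*x+y)*α)^2)
      + ((1+(2*x+y)*y)^(-a)*(2*((2*α+β)*β))
        - a*(1+(2*x+y)*y)^(-a)/(1+(2*x+y)*y)*((2*α+β)*y+(2*x+y)*β)^2)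
      + ((1-x^2)^(-a)*(2*(-α^2)) - a*(1-x^2)^(-a)/(1-x^2)*(-(2*x*α))^2)
      + 2*((1-x*y)^(-a)*(2*(-(α*β))) - a*(1-x*y)^(-a)/(1-x*y)*(-(α*y+β*x))^2)) →
    ¬ (0 < D1 ∨ (D1 = 0 ∧ 0 < D2)) := by
    intro α β D1 D2 hm hD1 hD2 hh
    obtain ⟨t, ht1, ht2⟩ := (hm.and (Gf_improve ha1 q1 q2 q3 q4 D1 D2 hD1 hD2 hh)).exists
    exact absurd (hmax ht1) (not_le.2 ht2)
  have ev : ∀ p m n : ℝ, 0 < p → ∀ᶠ t in nhdsWithin (0:ℝ) (Set.Ioi 0), 0 < p + m*t + n*t^2 := by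
    intro p m n hp
    have hc : ContinuousAt (fun t:ℝ => p + m*t + n*t^2) 0 := by fun_prop
    exact (hc.eventually (lt_mem_nhds (by simpa using hp))).filter_mono nhdsWithin_le_nhds
  -- not the origin
  rcases k1.eq_or_lt with hx0 | hx0
  · have hx0' : x = 0 := hx0.symm
    have hy0 : y = 0 := by rw [hx0'] at k2 k3; linarith
    refine imp 1 r₁ _ _ ?_ rfl rfl (Or.inr ⟨?_, ?_⟩)
    · filter_upwards [self_mem_nhdsWithin, ev p 0 (-r₁) hp0] with t ht ht2
      have ht0 : 0 < t := ht
      rw [hx0', hy0, hK]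
      refine ⟨?_, ?_, ?_, ?_⟩ <;> simp only <;> nlinarith
    · rw [hx0', hy0]; ring
    · rw [hx0', hy0]; simp; nlinarith
  obtain ⟨r, hry⟩ : ∃ r, y = r*x := ⟨y/x, by field_simp⟩
  have hrr1 : r₁ ≤ r := by rw [hry] at k2; exact le_of_mul_le_mul_right k2 hx0
  have hrr2 : r ≤ r₂ := by rw [hry] at k3; exact le_of_mul_le_mul_right k3 hx0
  set u := x^2 with hu
  have hu0 : 0 < u := by positivity
  have g1 : 1+(2*x+y)*x = 1 - (-((2+r)*u)) := by rw [hry, hu]; ring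
  have g2 : 1+(2*x+y)*y = 1 - (-(r*((2+r)*u))) := by rw [hry, hu]; ring
  have g4 : 1-x*y = 1 - r*u := by rw [hry, hu]; ring
  have gp1 : (1 - (-((2+r)*u)))^(-a) = ps a (-((2+r)*u)) := rfl
  have gp2 : (1 - (-(r*((2+r)*u))))^(-a) = ps a (-(r*((2+r)*u))) := rfl
  have gp3 : (1 - u)^(-a) = ps a u := rfl
  have gp4 : (1 - r*u)^(-a) = ps a (r*u) := rfl
  rw [g1, g2, g4, gp1, gp2, gp3, gp4] at imp
  have hru : r*u < 1 := by linarith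
  have hr0 : 0 < r := by linarith
  have hrad : x*y = r*u := by rw [hry, hu]; ring
  rw [hrad] at k4
  -- radial direction
  rcases k4.eq_or_lt with k4' | k4'
  · refine imp (-x) (-y) _ _ ?_ rfl rfl (Or.inl ?_)
    · filter_upwards [self_mem_nhdsWithin, ev 1 (-1) 0 one_pos] with t ht ht2
      have ht0 : 0 < t := ht
      have ht3 : 0 < 1 - t := by linarith
      have l1 : x + -x*t = (1-t)*x := by ring
      have l2 : y + -y*t = (1-t)*y := by ring
      rw [l1, l2, hK]
      refine ⟨?_, ?_, ?_, ?_⟩ <;> simp only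
      · positivity
      · have := mul_le_mul_of_nonneg_left k2 ht3.le; linarith
      · have := mul_le_mul_of_nonneg_left k3 ht3.le; linarith
      · have l3 : (1-t)*x*((1-t)*y) = (1-t)^2*p := by rw [← k4', ← hrad]; ring
        rw [l3]
        exact mul_le_of_le_one_left hp0.le (pow_le_one₀ ht3.le (by linarith))
    · have hY : ps a (r*u) = (2+r₂)^2 := by rw [k4', hpsp]
      have hv : 0 < (2+r)*u := by positivity
      have hrv : 0 < r*((2+r)*u) := by positivity
      have z1 := ps_lt ha (show -((2+r)*u) < 0 by linarith) (by norm_num)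
      have z2 := ps_lt ha (show -(r*((2+r)*u)) < 0 by linarith) (by norm_num)
      rw [ps_zero] at z1 z2
      have z3 := ps_pos (a := a) (by linarith : u < 1)
      rw [hY]
      have e : 2*(ps a (-((2+r)*u))*((2*(-x)+(-y))*x+(2*x+y)*(-x)))
          + ps a (-(r*((2+r)*u)))*((2*(-x)+(-y))*y+(2*x+y)*(-y))
          + ps a u*(-(2*x*(-x))) + 2*((2+r₂)^2*(-(-x*y+(-y)*x)))
          = 2*u*(ps a u + 2*r*(2+r₂)^2 - 2*(2+r)*ps a (-((2+r)*u))
            - r*(2+r)*ps a (-(r*((2+r)*u)))) := by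
        rw [hry, hu]; ring
      rw [e]
      apply mul_pos (by positivity)
      have m1 := mul_lt_mul_of_pos_left z1 (by linarith : 0 < 2*(2+r))
      have m2 := mul_lt_mul_of_pos_left z2 (by positivity : 0 < r*(2+r))
      have m3 : (2+r)^2 ≤ (2+r₂)^2 := pow_le_pow_left₀ (by linarith) (by linarith) 2
      have m4 : (2+r₂)^2 ≤ r*(2+r₂)^2 := le_mul_of_one_le_left (by positivity) (by linarith)
      have m5 : 0 ≤ (2+r₂)^2 := by positivity
      linarith
  -- radial derivative vanishes
  have feas : ∀ α β : ℝ, (r₁ < r ∨ r₁*α ≤ β) → (r < r₂ ∨ β ≤ r₂*α) →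
      ∀ᶠ t in nhdsWithin (0:ℝ) (Set.Ioi 0), (x+α*t, y+β*t) ∈ K := by
    intro α β c1 c2
    have w1 : ∀ᶠ t in nhdsWithin (0:ℝ) (Set.Ioi 0), r₁*(x+α*t) ≤ y+β*t := by
      rcases c1 with c | c
      · filter_upwards [ev ((r-r₁)*x) (β-r₁*α) 0 (mul_pos (by linarith) hx0)] with t ht
        rw [hry]; linarith
      · filter_upwards [self_mem_nhdsWithin] with t ht
        have := mul_le_mul_of_nonneg_right c (le_of_lt (Set.mem_Ioi.1 ht)); linarith
    have w2 : ∀ᶠ t in nhdsWithin (0:ℝ) (Set.Ioi 0), y+β*t ≤ r₂*(x+α*t) := by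
      rcases c2 with c | c
      · filter_upwards [ev ((r₂-r)*x) (r₂*α-β) 0 (mul_pos (by linarith) hx0)] with t ht
        rw [hry]; linarith
      · filter_upwards [self_mem_nhdsWithin] with t ht
        have := mul_le_mul_of_nonneg_right c (le_of_lt (Set.mem_Ioi.1 ht)); linarith
    filter_upwards [w1, w2, ev x α 0 hx0, ev (p - r*u) (-(α*y+β*x)) (-(α*β)) (by linarith)]
      with t t1 t2 t3 t4
    refine ⟨?_, t1, t2, ?_⟩ <;> simp only
    · linarith
    · rw [← hrad] at t4; linarith
  have rad : 2*(2+r)*ps a (-((2+r)*u)) + r*(2+r)*ps a (-(r*((2+r)*u))) - ps a u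
      - 2*r*ps a (r*u) = 0 := by
    apply le_antisymm
    · by_contra hcon
      push Not at hcon
      refine imp x y _ _ (feas x y (Or.inr k2) (Or.inr k3)) rfl rfl (Or.inl ?_)
      have := mul_pos (by positivity : 0 < 2*u) hcon
      refine this.trans_le (le_of_eq ?_)
      rw [hry, hu]; ring
    · by_contra hcon
      push Not at hcon
      rcases eq_or_ne r r₁ with c | c
      · -- direction -(x,y) along boundary
        refine imp (-x) (-y) _ _ (feas _ _ (Or.inr (by rw [hry, c]; linarith))
          (Or.inl (by linarith))) rfl rfl (Or.inl ?_)
        have := mul_pos_of_neg_of_neg (by linarith : -(2*u) < 0) hcon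
        refine this.trans_le (le_of_eq ?_)
        rw [hry, hu]; ring
      · refine imp (-x) (-y) _ _ (feas _ _ (Or.inl (lt_of_le_of_ne hrr1 c.symm)) 
          (by rcases hrr2.eq_or_lt with d | d
              · right; rw [hry, d]; linarith
              · left; exact d)) rfl rfl (Or.inl ?_)
        have := mul_pos_of_neg_of_neg (by linarith : -(2*u) < 0) hcon
        refine this.trans_le (le_of_eq ?_)
        rw [hry, hu]; ring
  have hiso : Iso a r u := by
    rcases eq_or_ne r r₁ with c | c
    · have := iso_same ha h1 (by linarith) hu0 (by rw [← c]; exact hru) (by rw [← c]; exact rad)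
      rw [c, ← this]; exact h1
    rcases eq_or_ne r r₂ with d | d
    · have := iso_same ha h2 (by linarith) hu0 (by rw [← d]; exact hru) (by rw [← d]; exact rad)
      rw [d, ← this]; exact h2
    have c' := lt_of_le_of_ne hrr1 c.symm
    have d' := lt_of_le_of_ne hrr2 d
    have key : ps a (-((2+r)*u)) + (1+r)*ps a (-(r*((2+r)*u))) - ps a (r*u) = 0 := by
      apply le_antisymm
      · by_contra hcon
        push Not at hcon
        refine imp 0 1 _ _ (feas _ _ (Or.inl c') (Or.inl d')) rfl rfl (Or.inl ?_)
        refine (mul_pos (by positivity : 0 < 2*x) hcon).trans_le (le_of_eq ?_)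
        rw [hry]; ring
      · by_contra hcon
        push Not at hcon
        refine imp 0 (-1) _ _ (feas _ _ (Or.inl c') (Or.inl d')) rfl rfl (Or.inl ?_)
        refine (mul_pos_of_neg_of_neg (by linarith : -(2*x) < 0) hcon).trans_le (le_of_eq ?_)
        rw [hry]; ring
    refine ⟨hr0, hu0, by linarith, hru, by linarith, ?_⟩
    linear_combination (2*r)*key - rad
  obtain ⟨κ, hκ, hsad⟩ := iso_saddle ha hab hb (by linarith) hiso
  obtain ⟨-, -, -, -, e1, e2⟩ := hiso
  have eX : ps a u = 4 * ps a (-((2+r)*u)) - r^2 * ps a (-(r*((2+r)*u))) := by linarith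
  have hsad' := mul_lt_mul_of_pos_left hsad ha
  have eb : a * (b*(κ+r)^2*ps a (-(r*((2+r)*u)))) = (κ+r)^2*ps a (-(r*((2+r)*u))) := by
    rw [← mul_assoc, ← mul_assoc, hab, one_mul]
  rw [eb] at hsad'
  have fin : ∀ ε : ℝ, ε^2 = 1 →
      (∀ᶠ t in nhdsWithin (0:ℝ) (Set.Ioi 0), (x+ε*t, y+(-(ε*κ))*t) ∈ K) → False := by
    intro ε hε hfe
    refine imp ε (-(ε*κ)) _ _ hfe rfl rfl (Or.inr ⟨?_, ?_⟩)
    · rw [hry, e1, eX]; ring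
    · have h9 := mul_pos (by norm_num : (0:ℝ) < 2) (sub_pos.2 hsad')
      refine h9.trans_le (le_of_eq ?_)
      rw [sub_neg_eq_add, sub_neg_eq_add]
      have n1 : ∀ M : ℝ, M * (-(ε*y + -(ε*κ)*x))^2 = M*((r-κ)^2*u) := by
        intro M; rw [hry, hu]; linear_combination (M*(r-κ)^2*x^2)*hε
      have n2 : ∀ M : ℝ, M * (-(2*x*ε))^2 = M*(4*u) := by
        intro M; rw [hu]; linear_combination (M*4*x^2)*hε
      have n3 : ∀ M : ℝ, M * ((2*ε+ -(ε*κ))*y + (2*x+y)* -(ε*κ))^2 = M*(4*(κ*(1+r)-r)^2*u) := by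
        intro M; rw [hry, hu]; linear_combination (M*4*(κ*(1+r)-r)^2*x^2)*hε
      have n4 : ∀ M : ℝ, M * ((2*ε+ -(ε*κ))*x + (2*x+y)* ε)^2 = M*((4+r-κ)^2*u) := by
        intro M; rw [hry, hu]; linear_combination (M*(4+r-κ)^2*x^2)*hε
      rw [n1, n2, n3, n4]
      have m1 : ps a (-((2+r)*u)) * (2*((2*ε+ -(ε*κ))*ε)) = ps a (-((2+r)*u)) * (2*(2-κ)) := by
        linear_combination (ps a (-((2+r)*u)) * (2*(2-κ)))*hε
      have m2 : ps a (-(r*((2+r)*u))) * (2*((2*ε+ -(ε*κ))* -(ε*κ))) =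
          ps a (-(r*((2+r)*u))) * (-(2*κ*(2-κ))) := by
        linear_combination (-ps a (-(r*((2+r)*u))) * (2*κ*(2-κ)))*hε
      have m3 : ps a u * (2*(-ε^2)) = -(2*ps a u) := by linear_combination (-2*ps a u)*hε
      have m4 : ps a (r*u) * (2*(-(ε* -(ε*κ)))) = 2*κ*ps a (r*u) := by
        linear_combination (2*κ*ps a (r*u))*hε
      rw [m1, m2, m3, m4]
      clear n1 n2 n3 n4 m1 m2 m3 m4 hsad' hsad imp
      generalize ps a u = X at *
      generalize ps a (r*u) = Y at *
      generalize ps a (-((2+r)*u)) = Z at *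
      generalize ps a (-(r*((2+r)*u))) = W at *
      linear_combination (2:ℝ)*eX - 4*κ*e1
  rcases hrr1.eq_or_lt with c | c
  · apply fin (-1) (by norm_num)
    apply feas
    · right; linarith
    · left; linarith
  · apply fin 1 (by norm_num)
    apply feas
    · left; exact c
    · right; linarith

lemma iso_unique {a b r₁ r₂ u₁ u₂ : ℝ} (ha : 0 < a) (hab : a * b = 1) (hb : 3/2 ≤ b)
    (hr1 : 1 < r₁) (hr2 : 1 < r₂) (h1 : Iso a r₁ u₁) (h2 : Iso a r₂ u₂) : r₁ = r₂ ∧ u₁ = u₂ := by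
  have e : r₁ = r₂ := by
    rcases lt_trichotomy r₁ r₂ with h | h | h
    · exact (iso_unique_r ha hab hb hr1 h h1 h2).elim
    · exact h
    · exact (iso_unique_r ha hab hb hr2 h h2 h1).elim
  subst e
  have h3 := h2.radial
  obtain ⟨hr0, hu, hu1, hru, e1, e2⟩ := h2
  exact ⟨rfl, iso_same ha h1 hu1 hu hru h3⟩

lemma iso_low {a b r u : ℝ} (ha : 0 < a) (hab : a * b = 1) (hr : 1 < r) (h : Iso a r u) :
    b * ps a u < u*(r^2*ps a (r*u)/(1-r*u) + (2+r)^2*ps a (-((2+r)*u))/(1+(2+r)*u)) := by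
  obtain ⟨f1, f2, f3, f4, f5⟩ := iso_facts ha hab hr h
  obtain ⟨hr0, hu, hu1, hru, e1, e2⟩ := h
  have hrv : 0 < r*((2+r)*u) := by positivity
  have hv : 0 < (2+r)*u := by positivity
  have h3 := iso_III e1 e2
  have t1 := ps_tangent ha hru hu1
  have t2 := ps_tangent ha (show -((2+r)*u) < 1 by linarith) (show -(r*((2+r)*u)) < 1 by linarith)
  have hY := ps_pos (a := a) hru
  have hb : 0 < b := by
    by_contra hh
    push Not at hh
    have := mul_nonpos_of_nonneg_of_nonpos ha.le hh
    linarith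
  rw [sub_neg_eq_add] at t2
  generalize ps a u = X at *
  generalize ps a (r*u) = Y at *
  generalize ps a (-((2+r)*u)) = Z at *
  generalize ps a (-(r*((2+r)*u))) = W at *
  have s1 : (r-1)*Y ≤ (r-1) * (a * (u*(Y/(1-r*u) + (2+r)^2*Z/(1+(2+r)*u)))) := by
    have t2' := mul_le_mul_of_nonneg_left t2 (by linarith : 0 ≤ 2+r)
    have i1 : a*Y/(1-r*u)*(u - r*u) = -((r-1)*(a*(u*(Y/(1-r*u))))) := by ring
    have i2 : (2+r)*(Z + a*Z/(1+(2+r)*u)*(-(r*((2+r)*u)) - -((2+r)*u))) =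
      (2+r)*Z - (r-1)*(a*(u*((2+r)^2*Z/(1+(2+r)*u)))) := by ring
    rw [i1] at t1
    rw [i2] at t2'
    linarith
  have s2 := le_of_mul_le_mul_left s1 (by linarith)
  have s3 := mul_le_mul_of_nonneg_left s2 hb.le
  rw [← mul_assoc, mul_comm b a, hab, one_mul] at s3
  have s4 : b*X < b*Y := mul_lt_mul_of_pos_left f1 hb
  have s5 : u*(Y/(1-r*u)) ≤ u*(r^2*Y/(1-r*u)) := by
    apply mul_le_mul_of_nonneg_left _ hu.le
    apply div_le_div_of_nonneg_right _ (by linarith)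
    nlinarith
  linarith

def dt (w z : ℂ) : ℝ := w.re * z.re + w.im * z.im

def Dist4 (q : Fin 4 → ℂ) : Prop := ∀ k l, k ≠ l → q k ≠ q l

noncomputable def dsq (q : Fin 4 → ℂ) (k l : Fin 4) : ℝ := Complex.normSq (q k - q l)

/-- gradient form -/
noncomputable def Gr (b : ℝ) (q v : Fin 4 → ℂ) : ℝ :=
  4 * ∑ k, dt (q k) (v k) - ∑ k, ∑ l ∈ Ioi k, dsq q k l ^ (-b) * dt (q k - q l) (v k - v l)

/-- Hessian form -/
noncomputable def Hs (b : ℝ) (q v : Fin 4 → ℂ) : ℝ :=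
  4 * ∑ k, Complex.normSq (v k) - (1/2) * ∑ k, ∑ l, (dsq q k l ^ (-b) * Complex.normSq (v k - v l)
    - 2*b*(dsq q k l ^ (-b) / dsq q k l) * dt (q k - q l) (v k - v l) ^ 2)

lemma sum_pairs (g : Fin 4 → Fin 4 → ℝ) (h : ∀ k l, g k l = g l k) (h0 : ∀ k, g k k = 0) :
    ∑ k, ∑ l ∈ Ioi k, g k l = (1/2) * ∑ k, ∑ l, g k l := by
  have e0 : Ioi (0 : Fin 4) = {1,2,3} := rfl
  have e1 : Ioi (1 : Fin 4) = {2,3} := rfl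
  have e2 : Ioi (2 : Fin 4) = {3} := rfl
  have e3 : Ioi (3 : Fin 4) = ∅ := rfl
  simp only [Fin.sum_univ_four, e0, e1, e2, e3, h0]
  rw [sum_insert (by decide), sum_insert (by decide), sum_insert (by decide)]
  simp only [sum_singleton, sum_empty]
  rw [h 1 0, h 2 0, h 3 0, h 2 1, h 3 1, h 3 2]
  ring

lemma dsq_pos {q : Fin 4 → ℂ} (h : Dist4 q) {k l : Fin 4} (hkl : k ≠ l) : 0 < dsq q k l :=
  Complex.normSq_pos.2 (sub_ne_zero.2 (h k l hkl))

lemma dsq_comm (q : Fin 4 → ℂ) (k l : Fin 4) : dsq q k l = dsq q l k := by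
  unfold dsq; rw [← neg_sub, Complex.normSq_neg]

lemma normSq_line (w z : ℂ) (t : ℝ) : Complex.normSq (w + t • z) =
    Complex.normSq w + (2 * dt w z) * t + Complex.normSq z * t^2 := by
  simp [Complex.normSq_apply, dt]; ring

lemma norm_rpow_two (w : ℂ) (A : ℝ) : ‖w‖^(2-A) = (Complex.normSq w)^(1-A/2) := by
  rw [Complex.normSq_eq_norm_sq, ← Real.rpow_natCast, ← Real.rpow_mul (norm_nonneg _)]
  congr 1; push_cast; ring

lemma dist4_open (q : Fin 4 → ℂ) (h : Dist4 q) : ∀ᶠ p in nhds q, Dist4 p := by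
  have : ∀ k l, ∀ᶠ p : Fin 4 → ℂ in nhds q, k ≠ l → p k ≠ p l := by
    intro k l
    by_cases hkl : k = l
    · simp [hkl]
    · have c : ContinuousAt (fun p : Fin 4 → ℂ => p k - p l) q := by fun_prop
      filter_upwards [c.eventually_ne (sub_ne_zero.2 (h k l hkl))] with p hp _ 
      exact sub_ne_zero.1 hp
  exact Filter.eventually_all.2 fun k => Filter.eventually_all.2 fun l => this k l

section cal
variable {A : ℝ} {f : (Fin 4 → ℂ) → ℝ}

def FForm (A : ℝ) (f : (Fin 4 → ℂ) → ℝ) : Prop := ∀ q : Fin 4 → ℂ, (∀ k l, k ≠ l → q k ≠ q l) →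
      f q = 2 * ∑ k, ‖q k‖ ^ 2 +
        (1 / (A - 2)) * ∑ k, ∑ l ∈ Finset.Ioi k, ‖q k - q l‖ ^ (2 - A)

lemma f_contDiff (hf : FForm A f) {q : Fin 4 → ℂ} (h : Dist4 q) : ContDiffAt ℝ 2 f q := by
  have e : f =ᶠ[nhds q] fun q => 2 * ∑ k, ‖q k‖ ^ 2 +
        (1 / (A - 2)) * ∑ k, ∑ l ∈ Finset.Ioi k, ‖q k - q l‖ ^ (2 - A) := by
    filter_upwards [dist4_open q h] with p hp
    exact hf p hp
  refine ContDiffAt.congr_of_eventuallyEq ?_ e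
  refine ContDiffAt.add (contDiffAt_const.mul (ContDiffAt.sum fun k _ => ?_))
    (contDiffAt_const.mul (ContDiffAt.sum fun k _ => ContDiffAt.sum fun l hl => ?_))
  · exact (contDiffAt_apply ℝ ℂ k q).norm_sq ℝ 
  · refine ContDiffAt.rpow_const_of_ne ?_ ?_
    · exact ContDiffAt.norm ℝ ((contDiffAt_apply ℝ ℂ k q).sub (contDiffAt_apply ℝ ℂ l q))
        (sub_ne_zero.2 (h k l (ne_of_lt (mem_Ioi.1 hl))))
    · exact norm_ne_zero_iff.2 (sub_ne_zero.2 (h k l (ne_of_lt (mem_Ioi.1 hl))))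

lemma line_ev {q : Fin 4 → ℂ} (h : Dist4 q) (v : Fin 4 → ℂ) :
    ∀ᶠ t : ℝ in nhds 0, Dist4 (q + t • v) := by
  have c : ContinuousAt (fun t : ℝ => q + t • v) 0 := by fun_prop
  have := dist4_open (q + (0:ℝ) • v) (by simpa using h)
  exact c.eventually this

lemma f_line (hA : 3 ≤ A) (hf : FForm A f) {q : Fin 4 → ℂ} (h : Dist4 q) (v : Fin 4 → ℂ) :
    HasDerivAt (fun t : ℝ => f (q + t • v)) (Gr (A/2) q v) 0 := by
  set φ : ℝ → ℝ := fun t => 2 * ∑ k, Complex.normSq (q k + t • v k) + (1/(A-2)) *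
    ∑ k, ∑ l ∈ Ioi k, (dsq q k l + (2*dt (q k - q l) (v k - v l))*t
      + Complex.normSq (v k - v l) * t^2)^(1-A/2) with hφ
  have e : (fun t : ℝ => f (q + t • v)) =ᶠ[nhds 0] φ := by
    filter_upwards [line_ev h v] with t ht
    rw [hf _ ht, hφ]
    simp only [Pi.add_apply, Pi.smul_apply, Complex.normSq_eq_norm_sq]
    congr 2
    refine sum_congr rfl fun k _ => sum_congr rfl fun l _ => ?_
    rw [norm_rpow_two]
    have : q k + t • v k - (q l + t • v l) = (q k - q l) + t • (v k - v l) := by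
      rw [smul_sub]; ring
    rw [this, normSq_line, dsq, Complex.normSq_eq_norm_sq (v k - v l)]
  refine HasDerivAt.congr_of_eventuallyEq ?_ e
  have h1 : ∀ k, HasDerivAt (fun t : ℝ => Complex.normSq (q k + t • v k)) (2*dt (q k) (v k)) 0 := by
    intro k
    simp only [normSq_line]
    have := (((hasDerivAt_id (0:ℝ)).const_mul (2*dt (q k) (v k))).const_add
      (Complex.normSq (q k))).add (((hasDerivAt_id (0:ℝ)).pow 2).const_mul (Complex.normSq (v k)))
    refine this.congr_deriv ?_
    simp
  have h2 : ∀ k, ∀ l ∈ Ioi k, HasDerivAt (fun t : ℝ => (dsq q k l + (2*dt (q k - q l) (v k - v l))*t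
      + Complex.normSq (v k - v l) * t^2)^(1-A/2))
      ((1-A/2)*(dsq q k l^(-(A/2)) * (2*dt (q k - q l) (v k - v l)))) 0 := by
    intro k l hl
    have hp := dsq_pos h (ne_of_lt (mem_Ioi.1 hl))
    have := quad_d1 (a := A/2) (t := 0) (p := dsq q k l) (m := 2*dt (q k - q l) (v k - v l))
      (n := Complex.normSq (v k - v l)) (by simpa using hp)
    simpa using this
  refine (((HasDerivAt.fun_sum fun k _ => h1 k).const_mul 2).add
    ((HasDerivAt.fun_sum fun k _ => HasDerivAt.fun_sum fun l hl => h2 k l hl).const_mul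
      (1/(A-2)))).congr_deriv ?_
  unfold Gr
  have hA2 : A - 2 ≠ 0 := by linarith
  have e1 : ∀ k l : Fin 4, (1-A/2)*(dsq q k l^(-(A/2)) * (2*dt (q k - q l) (v k - v l))) =
    (-(A-2)) * (dsq q k l^(-(A/2)) * dt (q k - q l) (v k - v l)) := by intros; ring
  simp only [e1, ← mul_sum]
  field_simp
  ring

lemma f_fderiv (hA : 3 ≤ A) (hf : FForm A f) {q : Fin 4 → ℂ} (h : Dist4 q) (v : Fin 4 → ℂ) :
    fderiv ℝ f q v = Gr (A/2) q v := by
  have hd : DifferentiableAt ℝ f q := (f_contDiff hf h).differentiableAt (by norm_num)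
  have := hd.hasFDerivAt.hasLineDerivAt v
  exact HasDerivAt.unique this (f_line hA hf h v)

lemma f_hess (hA : 3 ≤ A) (hf : FForm A f) {q : Fin 4 → ℂ} (h : Dist4 q) (v : Fin 4 → ℂ) :
    fderiv ℝ (fderiv ℝ f) q v v = Hs (A/2) q v := by
  have hd : DifferentiableAt ℝ (fderiv ℝ f) q :=
    ((f_contDiff hf h).fderiv_right (m := 1) (by norm_num)).differentiableAt (by norm_num)
  have h1 : HasDerivAt (fun t : ℝ => fderiv ℝ f (q + t • v)) (fderiv ℝ (fderiv ℝ f) q v) 0 :=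
    hd.hasFDerivAt.hasLineDerivAt v
  have h2 : HasDerivAt (fun t : ℝ => fderiv ℝ f (q + t • v) v)
      (fderiv ℝ (fderiv ℝ f) q v v) 0 := by
    have := h1.clm_apply (hasDerivAt_const (0:ℝ) v)
    simpa using this
  refine h2.unique ?_
  set φ : ℝ → ℝ := fun t => 4 * ∑ k, (dt (q k) (v k) + Complex.normSq (v k) * t) - (1/2)*
    ∑ k, ∑ l ∈ Ioi k, ((dsq q k l + (2*dt (q k - q l) (v k - v l))*t
      + Complex.normSq (v k - v l) * t^2)^(-(A/2)) *
      (2*dt (q k - q l) (v k - v l) + 2*Complex.normSq (v k - v l)*t)) with hφ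
  have e : (fun t : ℝ => fderiv ℝ f (q + t • v) v) =ᶠ[nhds 0] φ := by
    filter_upwards [line_ev h v] with t ht
    rw [f_fderiv hA hf ht, hφ, Gr]
    beta_reduce
    rw [mul_sum (a := (1/2:ℝ))]
    simp only [Pi.add_apply, Pi.smul_apply]
    congr 1
    · congr 1
      refine sum_congr rfl fun k _ => ?_
      simp [dt, Complex.normSq_apply]; ring
    · refine sum_congr rfl fun k _ => ?_
      rw [mul_sum]
      refine sum_congr rfl fun l _ => ?_
      have : q k + t • v k - (q l + t • v l) = (q k - q l) + t • (v k - v l) := by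
        rw [smul_sub]; ring
      unfold dsq
      simp only [Pi.add_apply, Pi.smul_apply]
      rw [this, normSq_line]
      simp [dt, Complex.normSq_apply]; ring
  refine HasDerivAt.congr_of_eventuallyEq ?_ e
  have hA0 : A/2 ≠ 1 := by intro h; linarith
  have h3 : ∀ k, HasDerivAt (fun t : ℝ => dt (q k) (v k) + Complex.normSq (v k) * t)
      (Complex.normSq (v k)) 0 := by
    intro k
    have := ((hasDerivAt_id (0:ℝ)).const_mul (Complex.normSq (v k))).const_add (dt (q k) (v k))
    refine this.congr_deriv ?_
    simp
  have h4 : ∀ k, ∀ l ∈ Ioi k, HasDerivAt (fun t : ℝ => (dsq q k l + (2*dt (q k - q l) (v k - v l))*t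
      + Complex.normSq (v k - v l) * t^2)^(-(A/2)) *
      (2*dt (q k - q l) (v k - v l) + 2*Complex.normSq (v k - v l)*t))
      (dsq q k l^(-(A/2)) * (2*Complex.normSq (v k - v l)) -
        (A/2)*dsq q k l^(-(A/2))/dsq q k l * (2*dt (q k - q l) (v k - v l))^2) 0 := by
    intro k l hl
    have hp := dsq_pos h (ne_of_lt (mem_Ioi.1 hl))
    have := (quad_d2 (a := A/2) (p := dsq q k l) (m := 2*dt (q k - q l) (v k - v l))
      (n := Complex.normSq (v k - v l)) hp).const_mul ((1-A/2)⁻¹)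
    have hne : (1-A/2) ≠ 0 := sub_ne_zero.2 hA0.symm
    simp only [inv_mul_cancel_left₀ hne] at this
    exact this
  refine (((HasDerivAt.fun_sum fun k _ => h3 k).const_mul 4).sub
    ((HasDerivAt.fun_sum fun k _ => HasDerivAt.fun_sum fun l hl => h4 k l hl).const_mul
      (1/2))).congr_deriv ?_
  unfold Hs
  congr 1
  rw [← sum_pairs]
  · rw [mul_sum]
    refine sum_congr rfl fun k _ => ?_
    rw [mul_sum]
    refine sum_congr rfl fun l _ => ?_
    ring
  · intro k l
    rw [dsq_comm q l k]
    have e1 : Complex.normSq (v l - v k) = Complex.normSq (v k - v l) := by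
      rw [← neg_sub, Complex.normSq_neg]
    have e2 : dt (q l - q k) (v l - v k) = dt (q k - q l) (v k - v l) := by
      simp [dt]; ring
    rw [e1, e2]
  · intro k
    simp [dt]

/-- central configuration equations -/
def IsCC (b : ℝ) (q : Fin 4 → ℂ) : Prop := Dist4 q ∧
  ∀ k, ∑ l, ((dsq q k l ^ (-b) : ℝ) : ℂ) * (q k - q l) = 4 * q k

lemma Gr_eq (b : ℝ) (q v : Fin 4 → ℂ) : Gr b q v =
    ∑ k, dt (4 * q k - ∑ l, ((dsq q k l ^ (-b) : ℝ) : ℂ) * (q k - q l)) (v k) := by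
  have h0 : ∀ w z : ℂ, dt w z = (w * (starRingEnd ℂ) z).re := by intro w z; simp [dt]
  unfold Gr
  rw [sum_pairs]
  · have : ∀ k l, dsq q l k = dsq q k l := fun k l => dsq_comm q l k
    simp only [Fin.sum_univ_four]
    rw [dsq_comm q 1 0, dsq_comm q 2 0, dsq_comm q 3 0, dsq_comm q 2 1, dsq_comm q 3 1, dsq_comm q 3 2]
    simp only [dt, sub_self, mul_zero, Complex.sub_re, Complex.sub_im, Complex.add_re, Complex.add_im,
      Complex.mul_re, Complex.mul_im, Complex.ofReal_re, Complex.ofReal_im, zero_mul, sub_zero, 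
      Complex.re_ofNat, Complex.im_ofNat, Complex.zero_re, Complex.zero_im]
    ring
  · intro k l
    rw [dsq_comm q l k]
    have e2 : dt (q l - q k) (v l - v k) = dt (q k - q l) (v k - v l) := by
      simp [dt]; ring
    rw [e2]
  · intro k; simp [dt]

lemma crit_iff (hA : 3 ≤ A) (hf : FForm A f) (q : Fin 4 → ℂ) :
    q ∈ critSet 4 f ↔ IsCC (A/2) q := by
  unfold IsCC critSet
  simp only [Set.mem_ofPred_eq]
  constructor
  · rintro ⟨h, h2⟩
    refine ⟨h, fun k => ?_⟩
    have h3 : ∀ v, Gr (A/2) q v = 0 := fun v => by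
      rw [← f_fderiv hA hf h v, h2]; rfl
    have h4 := h3 (Pi.single k (4 * q k - ∑ l, ((dsq q k l ^ (-(A/2)) : ℝ) : ℂ) * (q k - q l)))
    rw [Gr_eq, sum_eq_single k] at h4
    · rw [Pi.single_eq_same] at h4
      have h5 : 4 * q k - ∑ l, ((dsq q k l ^ (-(A/2)) : ℝ) : ℂ) * (q k - q l) = 0 := by
        rw [← Complex.normSq_eq_zero, Complex.normSq_apply]; exact h4
      exact (sub_eq_zero.1 h5).symm
    · intro j _ hj
      rw [Pi.single_eq_of_ne hj]; simp [dt]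
    · simp
  · rintro ⟨h, h2⟩
    refine ⟨h, ?_⟩
    ext v
    rw [f_fderiv hA hf h v, Gr_eq]
    simp [h2, dt]

end cal

lemma fin4_all {P : Fin 4 → Prop} (h0 : P 0) (h1 : P 1) (h2 : P 2) (h3 : P 3) : ∀ k, P k := by
  intro k; fin_cases k <;> assumption

def area (p q r : ℂ) : ℝ := (q - p).re * (r - p).im - (q - p).im * (r - p).re

def Dl (q : Fin 4 → ℂ) : Fin 4 → ℝ :=
  ![area (q 1) (q 2) (q 3), -area (q 0) (q 2) (q 3), area (q 0) (q 1) (q 3), -area (q 0) (q 1) (q 2)]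

noncomputable def Es (a : ℝ) (δ : Fin 4 → ℝ) (k : Fin 4) : ℝ :=
  ∑ l, if k = l then 0 else δ l * ps a (δ k * δ l)

def DS (a : ℝ) (δ : Fin 4 → ℝ) : Prop := δ ≠ 0 ∧ ∑ k, δ k = 0 ∧ (∀ k l, k ≠ l → δ k * δ l < 1) ∧
  ∀ k l, Es a δ k = Es a δ l

def Coll (q : Fin 4 → ℂ) : Prop := ∃ u : ℂ, ‖u‖ = 1 ∧ ∃ x : Fin 4 → ℝ, ∀ k, q k = u * x k

structure WR (a : ℝ) (q : Fin 4 → ℂ) (δ : Fin 4 → ℝ) : Prop where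
  hq : ∑ k, q k = 0
  hδ : ∑ k, δ k = 0
  hδq : ∑ k, (δ k : ℂ) * q k = 0
  lt : ∀ k l, k ≠ l → δ k * δ l < 1
  hs : ∀ k l, k ≠ l → dsq q k l = ps a (δ k * δ l)
  ne : δ ≠ 0

def RelQ (a : ℝ) (q : Fin 4 → ℂ) (δ : Fin 4 → ℝ) : Prop :=
  WR a q δ ∧ ∃ μ : ℝ, 0 < μ ∧ ∀ k, Dl q k = μ * δ k

lemma Dl_sum (q : Fin 4 → ℂ) : ∑ k, Dl q k = 0 := by
  simp [Fin.sum_univ_four, Dl, area]; ring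

lemma Dl_sum_q (q : Fin 4 → ℂ) : ∑ k, (Dl q k : ℂ) * q k = 0 := by
  apply Complex.ext <;> simp [Fin.sum_univ_four, Dl, area] <;> ring

lemma dsq_self (q : Fin 4 → ℂ) (k : Fin 4) : dsq q k k = 0 := by simp [dsq]

lemma sum_dsq {q : Fin 4 → ℂ} {δ : Fin 4 → ℝ} (h0 : ∑ k, δ k = 0)
    (h1 : ∑ k, (δ k : ℂ) * q k = 0) (k : Fin 4) :
    ∑ l, δ l * dsq q k l = ∑ l, δ l * Complex.normSq (q l) := by
  have hr := congrArg Complex.re h1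
  have hi := congrArg Complex.im h1
  simp [Fin.sum_univ_four] at h0 hr hi
  simp only [Fin.sum_univ_four, dsq, Complex.normSq_apply, Complex.sub_re, Complex.sub_im]
  linear_combination ((q k).re*(q k).re + (q k).im*(q k).im)*h0 - 2*(q k).re*hr - 2*(q k).im*hi

lemma IsCC.sum_q {b : ℝ} {q : Fin 4 → ℂ} (h : IsCC b q) : ∑ k, q k = 0 := by
  have h0 := h.2 0
  have h1 := h.2 1
  have h2 := h.2 2
  have h3 := h.2 3
  simp only [Fin.sum_univ_four] at *
  rw [dsq_comm q 1 0] at h1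
  rw [dsq_comm q 2 0, dsq_comm q 2 1] at h2
  rw [dsq_comm q 3 0, dsq_comm q 3 1, dsq_comm q 3 2] at h3
  linear_combination (-1/4)*(h0+h1+h2+h3)

lemma IsCC.stress {b : ℝ} {q : Fin 4 → ℂ} (h : IsCC b q) (k : Fin 4) :
    ∑ l, (((dsq q k l ^ (-b) - 1 : ℝ)) : ℂ) * (q l - q k) = 0 := by
  have h0 := h.2 k
  have h1 := h.sum_q
  simp only [Fin.sum_univ_four] at *
  push_cast
  linear_combination (-1)*h0 - h1

lemma tri_stress {p0 p1 p2 p3 : ℂ} {s1 s2 s3 : ℝ}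
    (h : (s1:ℂ)*(p1-p0) + (s2:ℂ)*(p2-p0) + (s3:ℂ)*(p3-p0) = 0) :
    s1 * area p0 p1 p3 + s2 * area p0 p2 p3 = 0 ∧ s1 * area p0 p1 p2 = s3 * area p0 p2 p3 ∧
    s2 * area p0 p1 p2 + s3 * area p0 p1 p3 = 0 := by
  have hr := congrArg Complex.re h
  have hi := congrArg Complex.im h
  simp at hr hi
  simp only [area, Complex.sub_re, Complex.sub_im]
  refine ⟨?_, ?_, ?_⟩
  · linear_combination (p3.im-p0.im)*hr - (p3.re-p0.re)*hi
  · linear_combination (p2.im-p0.im)*hr - (p2.re-p0.re)*hi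
  · linear_combination (-(p1.im-p0.im))*hr + (p1.re-p0.re)*hi

lemma stress_rel {q : Fin 4 → ℂ} {σ : Fin 4 → Fin 4 → ℝ} (hσ : ∀ k l, σ k l = σ l k)
    (h : ∀ k, ∑ l, ((σ k l : ℝ) : ℂ) * (q l - q k) = 0) :
    ∀ k l n, k ≠ l → k ≠ n → l ≠ n → σ k l * Dl q n = σ k n * Dl q l := by
  have h0 := h 0
  have h1 := h 1
  have h2 := h 2
  have h3 := h 3
  simp only [Fin.sum_univ_four, sub_self, mul_zero, zero_add, add_zero] at h0 h1 h2 h3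
  obtain ⟨a0, b0, c0⟩ := tri_stress h0
  obtain ⟨a1, b1, c1⟩ := tri_stress h1
  obtain ⟨a2, b2, c2⟩ := tri_stress h2
  obtain ⟨a3, b3, c3⟩ := tri_stress h3
  have r1 : ∀ a b c : ℂ, area a b c = area b c a := by intros; simp [area]; ring
  have r2 : ∀ a b c : ℂ, area b a c = -area a b c := by intros; simp [area]; ring
  have e0 : Dl q 0 = area (q 1) (q 2) (q 3) := rfl
  have e1 : Dl q 1 = -area (q 0) (q 2) (q 3) := rfl
  have e2 : Dl q 2 = area (q 0) (q 1) (q 3) := rfl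
  have e3 : Dl q 3 = -area (q 0) (q 1) (q 2) := rfl
  rw [r2 (q 0) (q 1) (q 3)] at a1 c1
  rw [r2 (q 0) (q 1) (q 2)] at b1 c1
  rw [r2 (q 0) (q 2) (q 3), r2 (q 1) (q 2) (q 3)] at a2
  rw [r1 (q 2) (q 0) (q 1), r2 (q 1) (q 2) (q 3)] at b2
  rw [r1 (q 2) (q 0) (q 1), r2 (q 0) (q 2) (q 3)] at c2
  rw [r1 (q 3) (q 0) (q 2), r1 (q 3) (q 1) (q 2)] at a3
  rw [r1 (q 3) (q 0) (q 1), r1 (q 3) (q 1) (q 2)] at b3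
  rw [r1 (q 3) (q 0) (q 1), r1 (q 3) (q 0) (q 2)] at c3
  have s1 := hσ 1 0
  have s2 := hσ 2 0
  have s3 := hσ 3 0
  have s4 := hσ 2 1
  have s5 := hσ 3 1
  have s6 := hσ 3 2
  simp only [s1, s2, s3, s4, s5, s6] at a1 b1 c1 a2 b2 c2 a3 b3 c3
  clear h h0 h1 h2 h3 r1 r2 hσ
  have main : ∀ k l n : Fin 4, k ≠ l → k ≠ n → l ≠ n → σ k l * Dl q n = σ k n * Dl q l := by
    refine fin4_all ?_ ?_ ?_ ?_ <;> refine fin4_all ?_ ?_ ?_ ?_ <;> refine fin4_all ?_ ?_ ?_ ?_ <;>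
      intro n1 n2 n3 <;> first
      | exact absurd rfl n1 | exact absurd rfl n2 | exact absurd rfl n3
      | (simp only [e0, e1, e2, e3, s1, s2, s3, s4, s5, s6]; linarith)
  exact main

lemma rpow_ps {a b s t : ℝ} (hab : a*b = 1) (hs : 0 < s) (h : s^(-b) = 1 - t) : s = ps a t := by
  unfold ps
  rw [← h, ← Real.rpow_mul hs.le, show -b * -a = 1 by linarith, Real.rpow_one]

lemma ps_rpow {a b t : ℝ} (hab : a*b = 1) (ht : t < 1) : ps a t ^ (-b) = 1 - t := by
  unfold ps
  rw [← Real.rpow_mul (by linarith), show -a * -b = 1 by linarith, Real.rpow_one]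

lemma cc_delta {a b : ℝ} (ha : 0 < a) (hab : a*b = 1) {q : Fin 4 → ℂ} (h : IsCC b q)
    (hD : Dl q ≠ 0) : ∃ δ, RelQ a q δ := by
  have hst := stress_rel (σ := fun k l => dsq q k l ^ (-b) - 1)
    (fun k l => by simp only [dsq_comm q k l]) h.stress
  have hsum := Dl_sum q
  -- two indices with nonzero values
  obtain ⟨k, j, hkj⟩ : ∃ k j, Dl q k < 0 ∧ 0 < Dl q j := by
    obtain ⟨i, hi⟩ := Function.ne_iff.1 hD
    have hne : ∃ i ∈ (univ : Finset (Fin 4)), Dl q i ≠ 0 := ⟨i, mem_univ i, hi⟩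
    obtain ⟨j, -, hj⟩ := exists_pos_of_sum_zero_of_exists_nonzero (Dl q) hsum hne
    have hne' : ∃ i ∈ (univ : Finset (Fin 4)), -Dl q i ≠ 0 := ⟨i, mem_univ i, neg_ne_zero.2 hi⟩
    obtain ⟨k, -, hk⟩ := exists_pos_of_sum_zero_of_exists_nonzero (fun i => -Dl q i) (by rw [sum_neg_distrib, hsum, neg_zero]) hne'
    exact ⟨k, j, by simpa using hk, hj⟩
  obtain ⟨hk, hj⟩ := hkj
  have kj : k ≠ j := by rintro rfl; linarith
  set c := (dsq q k j ^ (-b) - 1) / (Dl q k * Dl q j) with hc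
  have hkj0 : Dl q k * Dl q j ≠ 0 := (mul_neg_of_neg_of_pos hk hj).ne
  have ckj : dsq q k j ^ (-b) - 1 = c * (Dl q k * Dl q j) := by rw [hc, div_mul_cancel₀ _ hkj0]
  have ck : ∀ l, k ≠ l → dsq q k l ^ (-b) - 1 = c * (Dl q k * Dl q l) := by
    intro l hl
    by_cases hlj : l = j
    · rw [hlj]; exact ckj
    · have := hst k l j hl kj hlj
      rw [ckj] at this
      apply mul_right_cancel₀ hj.ne'
      rw [this]; ring
  have cj : ∀ l, j ≠ l → dsq q j l ^ (-b) - 1 = c * (Dl q j * Dl q l) := by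
    intro l hl
    by_cases hlj : l = k
    · rw [hlj, dsq_comm, ckj]; ring
    · have := hst j l k hl kj.symm hlj
      rw [dsq_comm q j k, ckj] at this
      apply mul_right_cancel₀ hk.ne
      rw [this]; ring
  have call : ∀ m l, m ≠ l → dsq q m l ^ (-b) - 1 = c * (Dl q m * Dl q l) := by
    intro m l hml
    by_cases hmk : m = k
    · rw [hmk] at hml ⊢; exact ck l hml
    by_cases hlk : l = k
    · rw [hlk, dsq_comm, ck m (Ne.symm hmk)]; ring
    have := hst m l k hml hmk hlk
    rw [dsq_comm q m k, ck m (Ne.symm hmk)] at this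
    apply mul_right_cancel₀ hk.ne
    rw [this]; ring
  have hlt : ∀ m l, m ≠ l → -(c * (Dl q m * Dl q l)) < 1 := by
    intro m l hml
    have := Real.rpow_pos_of_pos (dsq_pos h.1 hml) (-b)
    linarith [call m l hml]
  have hs : ∀ m l, m ≠ l → dsq q m l = ps a (-(c * (Dl q m * Dl q l))) := by
    intro m l hml
    exact rpow_ps hab (dsq_pos h.1 hml) (by linarith [call m l hml])
  have hcneg : c < 0 := by
    by_contra hc0
    push Not at hc0
    have e := (sum_dsq hsum (Dl_sum_q q) k).trans (sum_dsq hsum (Dl_sum_q q) j).symm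
    rw [← add_sum_erase univ _ (mem_univ k), ← add_sum_erase univ (fun l => Dl q l * dsq q j l) (mem_univ k),
      ← add_sum_erase (univ.erase k) _ (mem_erase.2 ⟨kj.symm, mem_univ j⟩),
      ← add_sum_erase (univ.erase k) (fun l => Dl q l * dsq q j l) (mem_erase.2 ⟨kj.symm, mem_univ j⟩)] at e
    simp only [dsq_self] at e
    rw [dsq_comm q j k] at e
    have hp := dsq_pos h.1 kj
    have : ∑ l ∈ (univ.erase k).erase j, Dl q l * dsq q j l ≤ ∑ l ∈ (univ.erase k).erase j, Dl q l * dsq q k l := by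
      apply sum_le_sum
      intro l hl
      have hlj : l ≠ j := (mem_erase.1 hl).1
      have hlk : l ≠ k := (mem_erase.1 (mem_erase.1 hl).2).1
      rw [hs j l hlj.symm, hs k l hlk.symm]
      rcases le_total 0 (Dl q l) with h0 | h0
      · apply mul_le_mul_of_nonneg_left _ h0
        refine ps_le ha ?_ (hlt k l hlk.symm)
        nlinarith [mul_nonneg (mul_nonneg hc0 h0) (by linarith : 0 ≤ Dl q j - Dl q k)]
      · apply mul_le_mul_of_nonpos_left _ h0
        refine ps_le ha ?_ (hlt j l hlj.symm)
        nlinarith [mul_nonneg (mul_nonneg hc0 (neg_nonneg.2 h0)) (by linarith : 0 ≤ Dl q j - Dl q k)]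
    nlinarith [mul_pos hp (by linarith : 0 < Dl q j - Dl q k)]
  have hm : 0 < √(-c) := Real.sqrt_pos.2 (by linarith)
  have hm2 : √(-c) * √(-c) = -c := Real.mul_self_sqrt (by linarith)
  have eδ : ∀ m l, √(-c) * Dl q m * (√(-c) * Dl q l) = -(c * (Dl q m * Dl q l)) := by
    intro m l
    linear_combination (Dl q m * Dl q l) * hm2
  refine ⟨fun i => √(-c) * Dl q i, ⟨h.sum_q, ?_, ?_, ?_, ?_, ?_⟩, (√(-c))⁻¹, inv_pos.2 hm, ?_⟩
  · rw [← mul_sum, hsum, mul_zero]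
  · have := Dl_sum_q q
    simp only [Complex.ofReal_mul, mul_assoc]
    rw [← mul_sum, this, mul_zero]
  · intro m l hml; rw [eδ]; exact hlt m l hml
  · intro m l hml; rw [eδ]; exact hs m l hml
  · intro h0
    have := congrFun h0 j
    simp only [Pi.zero_apply] at this
    exact absurd this (mul_pos hm hj).ne'
  · intro i; field_simp

lemma WR.ds {a : ℝ} {q δ} (h : WR a q δ) : DS a δ := by
  refine ⟨h.ne, h.hδ, h.lt, ?_⟩
  have : ∀ k, Es a δ k = ∑ l, δ l * dsq q k l := by
    intro k
    apply sum_congr rfl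
    intro l _
    by_cases hkl : k = l
    · rw [if_pos hkl, hkl, dsq_self, mul_zero]
    · rw [if_neg hkl, h.hs k l hkl]
  intro k l
  rw [this, this, sum_dsq h.hδ h.hδq, sum_dsq h.hδ h.hδq]

lemma WR.dist {a : ℝ} {q δ} (h : WR a q δ) : Dist4 q := by
  intro k l hkl e
  have h1 := h.hs k l hkl
  have h2 := ps_pos (a := a) (h.lt k l hkl)
  rw [← h1, dsq, e, sub_self, map_zero] at h2
  exact lt_irrefl _ h2

lemma WR.cc {a b : ℝ} (hab : a*b = 1) {q δ} (h : WR a q δ) : IsCC b q := by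
  refine ⟨h.dist, fun k => ?_⟩
  have : ∀ l, ((dsq q k l ^ (-b):ℝ):ℂ) * (q k - q l) = q k - q l - δ k * δ l * q k + δ k * (δ l * q l) := by
    intro l
    by_cases hkl : k = l
    · rw [hkl]; ring
    · rw [h.hs k l hkl, ps_rpow hab (h.lt k l hkl)]; push_cast; ring
  rw [sum_congr rfl fun l _ => this l]
  have h1 := h.hq
  have h2 := congrArg (Complex.ofReal) h.hδ
  have h3 := h.hδq
  simp only [Fin.sum_univ_four] at *
  push_cast at h2
  linear_combination (-1)*h1 - δ k * q k * h2 + δ k * h3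

lemma area_eq (p q r : ℂ) : area p q r = ((starRingEnd ℂ) (q - p) * (r - p)).im := by
  simp [area]; ring

lemma coll_Dl {q : Fin 4 → ℂ} (h : Coll q) : Dl q = 0 := by
  obtain ⟨u, -, x, hx⟩ := h
  have : ∀ i j k, area (q i) (q j) (q k) = 0 := by
    intro i j k
    simp [area, hx]; ring
  funext i
  fin_cases i <;> simp [Dl, this]

lemma Dl_coll {q : Fin 4 → ℂ} (h0 : ∑ k, q k = 0) (hd : q 1 ≠ q 0) (h : Dl q = 0) : Coll q := by
  set w := q 1 - q 0 with hw
  have hw0 : w ≠ 0 := sub_ne_zero.2 hd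
  have a2 : area (q 0) (q 1) (q 2) = 0 := by simpa [Dl] using congrFun h 3
  have a3 : area (q 0) (q 1) (q 3) = 0 := by simpa [Dl] using congrFun h 2
  have hn : (‖w‖ : ℂ) ≠ 0 := by exact_mod_cast (norm_pos_iff.2 hw0).ne'
  have key : ∀ k, ∃ y : ℝ, q k - q 0 = w * y := by
    have gen : ∀ z : ℂ, area (q 0) (q 1) z = 0 → ∃ y : ℝ, z - q 0 = w * y := by
      intro z hz
      rw [area_eq] at hz
      refine ⟨((z - q 0) / w).re, ?_⟩
      have him : ((z - q 0) / w).im = 0 := by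
        have : (z - q 0) / w = ((starRingEnd ℂ) w * (z - q 0)) * ((Complex.normSq w)⁻¹ : ℝ) := by
          rw [div_eq_mul_inv, Complex.inv_def]; ring
        rw [this, Complex.im_mul_ofReal, hz, zero_mul]
      have : (((z - q 0) / w).re : ℂ) = (z - q 0) / w := by
        apply Complex.ext <;> simp [him]
      rw [this]; field_simp
    refine fin4_all ⟨0, by simp⟩ ⟨1, by simp [hw]⟩ (gen _ a2) (gen _ a3)
  choose y hy using key
  refine ⟨w / ‖w‖, ?_, fun k => ‖w‖ * (y k - (∑ l, y l)/4), fun k => ?_⟩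
  · rw [norm_div]; simp [(norm_pos_iff.2 hw0).ne']
  · have h1 := hy k
    have h4 : ∑ l, (q l - q 0) = w * ((∑ l, y l : ℝ) : ℂ) := by
      rw [sum_congr rfl fun l _ => hy l, ← mul_sum]; push_cast; rfl
    rw [sum_sub_distrib, h0] at h4
    simp only [sum_const, card_univ, Fintype.card_fin] at h4
    push_cast at h4 ⊢
    field_simp
    rw [nsmul_eq_mul] at h4
    push_cast at h4
    linear_combination 4*h1 - h4

lemma RelQ.not_coll {a : ℝ} {q δ} (h : RelQ a q δ) : ¬ Coll q := by
  intro hc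
  obtain ⟨hw, μ, hμ, hD⟩ := h
  apply hw.ne
  funext k
  have := hD k
  rw [coll_Dl hc] at this
  simpa [hμ.ne'] using this.symm

lemma cc_rel {a b : ℝ} (ha : 0 < a) (hab : a*b = 1) {q : Fin 4 → ℂ} (h : IsCC b q)
    (hc : ¬ Coll q) : ∃ δ, RelQ a q δ :=
  cc_delta ha hab h fun h0 => hc (Dl_coll h.sum_q (h.1 1 0 (by decide)) h0)

lemma exists_neg_pos {δ : Fin 4 → ℝ} (hsum : ∑ k, δ k = 0) (hD : δ ≠ 0) : ∃ k j, δ k < 0 ∧ 0 < δ j := by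
  obtain ⟨i, hi⟩ := Function.ne_iff.1 hD
  have hne : ∃ i ∈ (univ : Finset (Fin 4)), δ i ≠ 0 := ⟨i, mem_univ i, hi⟩
  obtain ⟨j, -, hj⟩ := exists_pos_of_sum_zero_of_exists_nonzero δ hsum hne
  have hne' : ∃ i ∈ (univ : Finset (Fin 4)), -δ i ≠ 0 := ⟨i, mem_univ i, neg_ne_zero.2 hi⟩
  obtain ⟨k, -, hk⟩ := exists_pos_of_sum_zero_of_exists_nonzero (fun i => -δ i) (by rw [sum_neg_distrib, hsum, neg_zero]) hne'
  exact ⟨k, j, by simpa using hk, hj⟩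

lemma normSq_unit {u : ℂ} (hu : ‖u‖ = 1) : Complex.normSq u = 1 := by
  rw [Complex.normSq_eq_norm_sq, hu]; norm_num

lemma dsq_rot {u : ℂ} (hu : ‖u‖ = 1) (q : Fin 4 → ℂ) (k l : Fin 4) :
    dsq (fun k => u * q k) k l = dsq q k l := by
  simp only [dsq]
  rw [← mul_sub, map_mul, normSq_unit hu, one_mul]

lemma Dl_rot {u : ℂ} (hu : ‖u‖ = 1) (q : Fin 4 → ℂ) (k : Fin 4) :
    Dl (fun k => u * q k) k = Dl q k := by
  have : ∀ x y z : ℂ, area (u*x) (u*y) (u*z) = area x y z := by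
    intro x y z
    have h := normSq_unit hu
    rw [Complex.normSq_apply] at h
    simp [area]
    linear_combination ((y.re - x.re)*(z.im-x.im) - (y.im-x.im)*(z.re-x.re)) * h
  revert k
  refine fin4_all ?_ ?_ ?_ ?_ <;> simp [Dl, this]

lemma WR.rot {a : ℝ} {q δ} (h : WR a q δ) {u : ℂ} (hu : ‖u‖ = 1) : WR a (fun k => u * q k) δ where
  hq := by rw [← mul_sum, h.hq, mul_zero]
  hδ := h.hδ
  hδq := by
    have := h.hδq
    rw [sum_congr rfl fun k _ => mul_left_comm (δ k : ℂ) u (q k), ← mul_sum, this, mul_zero]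
  lt := h.lt
  hs := fun k l hkl => by rw [dsq_rot hu]; exact h.hs k l hkl
  ne := h.ne

lemma WR.perm {a : ℝ} {q δ} (h : WR a q δ) (σ : Equiv.Perm (Fin 4)) : WR a (q ∘ σ) (δ ∘ σ) where
  hq := by rw [← h.hq]; exact Equiv.sum_comp σ q
  hδ := by rw [← h.hδ]; exact Equiv.sum_comp σ δ
  hδq := by rw [← h.hδq]; exact Equiv.sum_comp σ (fun k => (δ k : ℂ) * q k)
  lt := fun k l hkl => h.lt _ _ (fun e => hkl (σ.injective e))
  hs := fun k l hkl => h.hs (σ k) (σ l) (fun e => hkl (σ.injective e))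
  ne := fun e => h.ne (by
    funext k
    have := congrFun e (σ.symm k)
    simpa using this)

lemma WR.neg {a : ℝ} {q δ} (h : WR a q δ) : WR a q (-δ) where
  hq := h.hq
  hδ := by simp [h.hδ]
  hδq := by simp [h.hδq]
  lt := fun k l hkl => by simpa using h.lt k l hkl
  hs := fun k l hkl => by simpa using h.hs k l hkl
  ne := neg_ne_zero.2 h.ne

lemma WR.conj {a : ℝ} {q δ} (h : WR a q δ) : WR a (fun k => (starRingEnd ℂ) (q k)) δ where
  hq := by rw [← map_sum, h.hq, map_zero]
  hδ := h.hδ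
  hδq := by
    have := congrArg (starRingEnd ℂ) h.hδq
    simpa using this
  lt := h.lt
  hs := fun k l hkl => by
    rw [← h.hs k l hkl]
    simp only [dsq]
    rw [← map_sub, Complex.normSq_conj]
  ne := h.ne

lemma Dl_prop {q : Fin 4 → ℂ} {δ : Fin 4 → ℝ} (h0 : ∑ k, δ k = 0) (h1 : ∑ k, (δ k : ℂ) * q k = 0) :
    ∀ k l, Dl q k * δ l = Dl q l * δ k := by
  have hd := Dl_sum q
  have h2 := congrArg Complex.ofReal h0
  simp only [Fin.sum_univ_four] at h0 h1 hd h2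
  push_cast at h2
  obtain ⟨x, y, z⟩ := tri_stress (p0 := q 0) (p1 := q 1) (p2 := q 2) (p3 := q 3) (s1 := δ 1) (s2 := δ 2) (s3 := δ 3)
    (by linear_combination h1 - q 0 * h2)
  have e1 : Dl q 1 = -area (q 0) (q 2) (q 3) := rfl
  have e2 : Dl q 2 = area (q 0) (q 1) (q 3) := rfl
  have e3 : Dl q 3 = -area (q 0) (q 1) (q 2) := rfl
  have f1 : Dl q 1 * δ 2 = Dl q 2 * δ 1 := by rw [e1, e2]; linarith
  have f2 : Dl q 1 * δ 3 = Dl q 3 * δ 1 := by rw [e1, e3]; linarith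
  have f3 : Dl q 2 * δ 3 = Dl q 3 * δ 2 := by rw [e2, e3]; linarith
  have g1 : Dl q 0 * δ 1 = Dl q 1 * δ 0 := by linear_combination δ 1 * hd - Dl q 1 * h0 + f1 + f2
  have g2 : Dl q 0 * δ 2 = Dl q 2 * δ 0 := by linear_combination δ 2 * hd - Dl q 2 * h0 - f1 + f3
  have g3 : Dl q 0 * δ 3 = Dl q 3 * δ 0 := by linear_combination δ 3 * hd - Dl q 3 * h0 - f2 - f3
  refine fin4_all ?_ ?_ ?_ ?_ <;> refine fin4_all ?_ ?_ ?_ ?_ <;> first | rfl | assumption | (symm; assumption)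

lemma WR.toRel {a : ℝ} {q δ} (h : WR a q δ) (hc : ¬ Coll q) : ∃ q', RelQ a q' δ := by
  have hD : Dl q ≠ 0 := fun h0 => hc (Dl_coll h.hq (h.dist 1 0 (by decide)) h0)
  obtain ⟨j, hj⟩ := Function.ne_iff.1 h.ne
  have hj : δ j ≠ 0 := hj
  have hk : ∀ k, Dl q k = Dl q j / δ j * δ k := by
    intro k
    have := Dl_prop h.hδ h.hδq k j
    field_simp
    linarith
  have hμ : Dl q j / δ j ≠ 0 := by
    intro h0
    apply hD
    funext k
    rw [hk k, h0, zero_mul]; rfl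
  rcases lt_or_gt_of_ne hμ with h0 | h0
  · refine ⟨_, h.conj, -(Dl q j / δ j), by linarith, fun k => ?_⟩
    have : Dl (fun k => (starRingEnd ℂ) (q k)) k = -Dl q k := by
      revert k
      refine fin4_all ?_ ?_ ?_ ?_ <;> simp [Dl, area] <;> ring
    rw [this, hk k]; ring
  · exact ⟨q, h, _, h0, hk⟩

lemma RelQ.rot {a : ℝ} {q δ} (h : RelQ a q δ) {u : ℂ} (hu : ‖u‖ = 1) : RelQ a (fun k => u * q k) δ := by
  obtain ⟨h1, μ, hμ, h2⟩ := h
  exact ⟨h1.rot hu, μ, hμ, fun k => by rw [Dl_rot hu, h2]⟩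

lemma ps_inj {a s t : ℝ} (ha : 0 < a) (hs : s < 1) (ht : t < 1) (h : ps a s = ps a t) : s = t := by
  rcases lt_trichotomy s t with h1 | h1 | h1
  · exact absurd h (ps_lt ha h1 ht).ne
  · exact h1
  · exact absurd h (ps_lt ha h1 hs).ne'

lemma RelQ.uniq {a : ℝ} (ha : 0 < a) {q δ δ'} (h : RelQ a q δ) (h' : RelQ a q δ') : δ = δ' := by
  obtain ⟨h1, μ, hμ, h2⟩ := h
  obtain ⟨h1', μ', hμ', h2'⟩ := h'
  obtain ⟨k, j, hk, hj⟩ := exists_neg_pos h1.hδ h1.ne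
  have kj : k ≠ j := by rintro rfl; linarith
  have e : ∀ i, μ * δ i = μ' * δ' i := fun i => by rw [← h2, ← h2']
  have h3 := ps_inj ha (h1.lt k j kj) (h1'.lt k j kj) (by rw [← h1.hs k j kj, ← h1'.hs k j kj])
  have h4 : μ^2 * (δ k * δ j) = μ'^2 * (δ k * δ j) := by
    rw [h3]
    rw [show μ ^ 2 * (δ' k * δ' j) = μ ^2 *(δ k * δ j) by rw [h3]]
    linear_combination (μ * δ j) * e k + (μ' * δ' k) * e j
  have h5 : μ^2 = μ'^2 := mul_right_cancel₀ (mul_neg_of_neg_of_pos hk hj).ne h4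
  have h6 : μ = μ' := by
    rwa [pow_left_inj₀ hμ.le hμ'.le (by norm_num)] at h5
  funext i
  have := e i
  rw [h6] at this
  exact mul_left_cancel₀ hμ'.ne' this

lemma area_sq (p q r : ℂ) : area p q r ^ 2 = Complex.normSq (p - q) * Complex.normSq (p - r) -
    ((Complex.normSq (p - q) + Complex.normSq (p - r) - Complex.normSq (q - r))/2)^2 := by
  simp [area, Complex.normSq_apply]; ring

lemma RelQ.orbit {a : ℝ} {q q' δ} (h : RelQ a q δ) (h' : RelQ a q' δ) :
    ∃ u : ℂ, ‖u‖ = 1 ∧ q' = fun k => u * q k := by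
  obtain ⟨h1, μ, hμ, h2⟩ := h
  obtain ⟨h1', μ', hμ', h2'⟩ := h'
  have hs : ∀ k l, dsq q' k l = dsq q k l := by
    intro k l
    by_cases hkl : k = l
    · rw [hkl, dsq_self, dsq_self]
    · rw [h1.hs k l hkl, h1'.hs k l hkl]
  have har : ∀ i j k, area (q' i) (q' j) (q' k) ^ 2 = area (q i) (q j) (q k) ^ 2 := by
    intro i j k
    rw [area_sq, area_sq]
    have x := hs i j
    have y := hs i k
    have z := hs j k
    simp only [dsq] at x y z
    rw [x, y, z]
  have hD2 : ∀ k, Dl q' k ^ 2 = Dl q k ^ 2 := by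
    refine fin4_all ?_ ?_ ?_ ?_ <;> simp only [Dl]
    · simpa using har 1 2 3
    · simpa using har 0 2 3
    · simpa using har 0 1 3
    · simpa using har 0 1 2
  obtain ⟨j, hj⟩ := Function.ne_iff.1 h1.ne
  have hj : δ j ≠ 0 := hj
  have h6 : μ' = μ := by
    have := hD2 j
    rw [h2, h2', mul_pow, mul_pow] at this
    have := mul_right_cancel₀ (pow_ne_zero 2 hj) this
    rwa [pow_left_inj₀ hμ'.le hμ.le (by norm_num)] at this
  have hD : ∀ k, Dl q' k = Dl q k := fun k => by rw [h2, h2', h6]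
  have hA : ∀ k, area (q' 0) (q' 1) (q' k) = area (q 0) (q 1) (q k) := by
    refine fin4_all ?_ ?_ ?_ ?_
    · simp [area]
    · simp [area]; ring
    · have := hD 3; simp [Dl] at this; exact this
    · have := hD 2; simp [Dl] at this; exact this
  have hw : q 1 - q 0 ≠ 0 := sub_ne_zero.2 (h1.dist 1 0 (by decide))
  have hC : ∀ k, (starRingEnd ℂ) (q' 1 - q' 0) * (q' k - q' 0) = (starRingEnd ℂ) (q 1 - q 0) * (q k - q 0) := by
    intro k
    apply Complex.ext
    · have x := hs 1 0
      have y := hs k 0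
      have z := hs 1 k
      simp only [dsq, Complex.normSq_apply, Complex.sub_re, Complex.sub_im] at x y z
      simp
      linarith
    · rw [← area_eq, ← area_eq, hA]
  set u := (q' 1 - q' 0) / (q 1 - q 0) with hu
  have huw : q' 1 - q' 0 = u * (q 1 - q 0) := by rw [hu]; field_simp
  have hun : Complex.normSq u = 1 := by
    rw [hu, map_div₀]
    have := hs 1 0
    simp only [dsq] at this
    rw [this, div_self]
    exact Complex.normSq_eq_zero.not.2 hw
  have huu : u * (starRingEnd ℂ) u = 1 := by rw [Complex.mul_conj, hun]; simp
  have hk : ∀ k, q' k - q' 0 = u * (q k - q 0) := by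
    intro k
    have h3 := hC k
    rw [huw, map_mul] at h3
    have hw' : (starRingEnd ℂ) (q 1 - q 0) ≠ 0 := (map_ne_zero _).2 hw
    have h4 : (starRingEnd ℂ) u * (q' k - q' 0) = q k - q 0 := by
      apply mul_left_cancel₀ hw'
      rw [← h3]; ring
    rw [← h4]
    linear_combination (-(q' k - q' 0)) * huu
  refine ⟨u, ?_, ?_⟩
  · rw [Complex.norm_def, hun, Real.sqrt_one]
  · have x := h1.hq
    have x' := h1'.hq
    simp only [Fin.sum_univ_four] at x x'
    have h0 : q' 0 = u * q 0 := by
      linear_combination (1/4)*(x' - u * x - hk 1 - hk 2 - hk 3)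
    funext k
    linear_combination hk k + h0

def vsq (x : ℝ) : Fin 4 → ℝ := ![x, x, -x, -x]
def veq (z : ℝ) : Fin 4 → ℝ := ![-(3*z), z, z, z]
def viso (r w : ℝ) : Fin 4 → ℝ := ![-((2+r)*w), w, w, r*w]

lemma DS.perm {a δ} (h : DS a δ) (σ : Equiv.Perm (Fin 4)) : DS a (δ ∘ σ) := by
  obtain ⟨h1, h2, h3, h4⟩ := h
  have hE : ∀ k, Es a (δ ∘ σ) k = Es a δ (σ k) := by
    intro k
    unfold Es
    rw [← Equiv.sum_comp σ (fun l => if σ k = l then 0 else δ l * ps a (δ (σ k) * δ l))]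
    simp
  refine ⟨fun e => h1 ?_, ?_, fun k l hkl => h3 _ _ (fun e => hkl (σ.injective e)), fun k l => ?_⟩
  · funext k
    have := congrFun e (σ.symm k)
    simpa using this
  · rw [← h2]; exact Equiv.sum_comp σ δ
  · rw [hE, hE, h4]

lemma DS.neg {a δ} (h : DS a δ) : DS a (-δ) := by
  obtain ⟨h1, h2, h3, h4⟩ := h
  have hE : ∀ k, Es a (-δ) k = -Es a δ k := by
    intro k
    unfold Es
    rw [← sum_neg_distrib]
    apply sum_congr rfl
    intro l _
    by_cases hkl : k = l <;> simp [hkl]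
  refine ⟨neg_ne_zero.2 h1, by simp [h2], fun k l hkl => by simpa using h3 k l hkl, fun k l => ?_⟩
  rw [hE, hE, h4 k l]

def Cls (a : ℝ) (δ : Fin 4 → ℝ) : Prop := ∃ (σ : Equiv.Perm (Fin 4)) (ε : ℝ), (ε = 1 ∨ ε = -1) ∧
  ((∃ x, 0 < x ∧ x^2 < 1 ∧ ps a (x^2) = 2 * ps a (-x^2) ∧ δ = fun k => ε * vsq x (σ k)) ∨
   (∃ z, 0 < z ∧ z^2 < 1 ∧ ps a (z^2) = 3 * ps a (-(3*z^2)) ∧ δ = fun k => ε * veq z (σ k)) ∨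
   (∃ r w, 1 < r ∧ 0 < w ∧ Iso a r (w^2) ∧ δ = fun k => ε * viso r w (σ k)))

lemma Cls.of_perm {a δ} (σ : Equiv.Perm (Fin 4)) (h : Cls a (δ ∘ σ)) : Cls a δ := by
  obtain ⟨τ, ε, hε, h⟩ := h
  refine ⟨σ.symm.trans τ, ε, hε, ?_⟩
  have key : ∀ g : Fin 4 → ℝ, δ ∘ σ = (fun k => ε * g (τ k)) → δ = fun k => ε * g ((σ.symm.trans τ) k) := by
    intro g hg
    funext k
    have := congrFun hg (σ.symm k)
    simpa using this
  rcases h with ⟨x, h1, h2, h3, h4⟩ | ⟨x, h1, h2, h3, h4⟩ | ⟨r, w, h1, h2, h3, h4⟩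
  · exact Or.inl ⟨x, h1, h2, h3, key _ h4⟩
  · exact Or.inr (Or.inl ⟨x, h1, h2, h3, key _ h4⟩)
  · exact Or.inr (Or.inr ⟨r, w, h1, h2, h3, key _ h4⟩)

lemma Cls.of_neg {a δ} (h : Cls a (-δ)) : Cls a δ := by
  obtain ⟨τ, ε, hε, h⟩ := h
  refine ⟨τ, -ε, by rcases hε with h | h <;> simp [h], ?_⟩
  have key : ∀ g : Fin 4 → ℝ, -δ = (fun k => ε * g (τ k)) → δ = fun k => (-ε) * g (τ k) := by
    intro g hg
    funext k
    have := congrFun hg k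
    simp at this
    linarith
  rcases h with ⟨x, h1, h2, h3, h4⟩ | ⟨x, h1, h2, h3, h4⟩ | ⟨r, w, h1, h2, h3, h4⟩
  · exact Or.inl ⟨x, h1, h2, h3, key _ h4⟩
  · exact Or.inr (Or.inl ⟨x, h1, h2, h3, key _ h4⟩)
  · exact Or.inr (Or.inr ⟨r, w, h1, h2, h3, key _ h4⟩)

lemma iso_of_eqs {a w y s : ℝ} (hw : 0 < w) (hy : 0 < y) (hs : s = 2*w + y) (hw2 : w*w < 1) (hwy : w*y < 1)
    (e1 : 2*(w*ps a (-(s*w))) + y * ps a (-(s*y)) = -(s*ps a (-(s*w))) + w*ps a (w*w) + y*ps a (w*y))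
    (e2 : 2*(w*ps a (-(s*w))) + y * ps a (-(s*y)) = -(s*ps a (-(s*y))) + 2*(w*ps a (w*y))) :
    Iso a (y/w) (w^2) := by
  have a1 : -(y/w*((2+y/w)*w^2)) = -(s*y) := by rw [hs]; field_simp
  have a2 : -((2+y/w)*w^2) = -(s*w) := by rw [hs]; field_simp
  have a3 : y/w*w^2 = w*y := by field_simp
  refine ⟨div_pos hy hw, by positivity, by nlinarith, by rw [a3]; exact hwy, ?_, ?_⟩
  · rw [a1, a2, a3]
    generalize ps a (-(s*w)) = Z at *
    generalize ps a (-(s*y)) = W at *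
    generalize ps a (w*y) = Y at *
    field_simp
    rw [hs] at e2
    linarith
  · rw [a1, a2, pow_two w]
    generalize ps a (-(s*w)) = Z at *
    generalize ps a (-(s*y)) = W at *
    generalize ps a (w*w) = X at *
    generalize ps a (w*y) = Y at *
    have hY : w * Y = (w+y)*W + w*Z := by
      rw [hs] at e2; linarith
    field_simp
    have : w * (w^2 * X + y^2 * W - w^2*4*Z) = 0 := by
      rw [hs] at e1
      linear_combination (-w^2) * e1 - y * w * hY
    have := (mul_eq_zero.1 this).resolve_left hw.ne'
    linarith

lemma cls_sorted {a b : ℝ} (ha : 0 < a) (hab : a*b = 1) (hb : 3/2 ≤ b) {δ : Fin 4 → ℝ} (h : DS a δ)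
    (h01 : δ 0 ≤ δ 1) (h12 : δ 1 ≤ δ 2) (h23 : δ 2 ≤ δ 3) (hw : δ 3 ≤ -δ 0) : Cls a δ := by
  obtain ⟨h1, h2, h3, h4⟩ := h
  have E01 := h4 0 1
  have E02 := h4 0 2
  have E03 := h4 0 3
  have l01 := h3 0 1 (by decide)
  have l02 := h3 0 2 (by decide)
  have l03 := h3 0 3 (by decide)
  have l12 := h3 1 2 (by decide)
  have l13 := h3 1 3 (by decide)
  have l23 := h3 2 3 (by decide)
  obtain ⟨i, j, hi, hj⟩ := exists_neg_pos h2 h1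
  have n0 : δ 0 < 0 := by
    revert hi; revert i; refine fin4_all ?_ ?_ ?_ ?_ <;> intro hi <;> linarith
  have p3 : 0 < δ 3 := by
    revert hj; revert j; refine fin4_all ?_ ?_ ?_ ?_ <;> intro hj <;> linarith
  have hext : ∀ v : Fin 4 → ℝ, δ 0 = v 0 → δ 1 = v 1 → δ 2 = v 2 → δ 3 = v 3 → δ = v := by
    intro v a b c d; funext k; revert k; exact fin4_all a b c d
  simp only [Fin.sum_univ_four] at h2
  simp [Es, Fin.sum_univ_four] at E01 E02 E03
  clear h3 h4 h1 hi hj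
  generalize δ 0 = d0 at *
  generalize δ 1 = d1 at *
  generalize δ 2 = d2 at *
  generalize δ 3 = d3 at *
  rw [mul_comm d1 d0] at E01
  rw [mul_comm d2 d0, mul_comm d2 d1] at E02
  rw [mul_comm d3 d0, mul_comm d3 d1, mul_comm d3 d2] at E03
  rcases lt_trichotomy d1 0 with c1 | c1 | c1
  · rcases lt_trichotomy d2 0 with c2 | c2 | c2
    · exfalso; linarith
    · exfalso
      subst c2
      simp only [mul_zero, zero_mul, ps_zero, mul_one, zero_add, add_zero] at *
      have := zero_excl (a := a) (p := d0) (q := d1) (r := d3) (by linarith) l01 l03 l13 (by linarith) (by linarith) (by linarith)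
      linarith [this.1]
    · have := convex_sym (a := a) (al := d3) (be := d2) (ga := -d1) (ka := -d0) ha (by linarith) (by linarith) (by linarith) (by linarith)
        (by linarith) (by linarith) (by linarith)
        (by simp only [Eg, neg_mul_neg]; rw [mul_comm d3 d2, mul_comm d3 d1, mul_comm d3 d0, mul_comm d2 d1, mul_comm d2 d0]; linarith)
        (by simp only [Eg, neg_mul_neg]; rw [mul_comm d1 d0]; linarith)
        (by simp only [Eg, neg_mul_neg]; rw [mul_comm d2 d1, mul_comm d2 d0, mul_comm d1 d0]; linarith)
      obtain ⟨t1, t2⟩ := this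
      have t2' : d1 = d0 := by linarith
      have t3 : d0 = -d3 := by linarith
      subst t2'
      subst t1
      subst t3
      refine ⟨1, -1, Or.inr rfl, Or.inl ⟨d3, p3, by nlinarith, ?_, ?_⟩⟩
      · rw [pow_two]
        have e : -d3 * d3 = -(d3*d3) := by ring
        simp only [neg_mul_neg, e] at E02
        have : d3 * (ps a (d3*d3) - 2 * ps a (-(d3*d3))) = 0 := by linarith
        have := (mul_eq_zero.1 this).resolve_left p3.ne'
        linarith
      · apply hext <;> simp [vsq]
  · exfalso
    subst c1
    simp only [mul_zero, zero_mul, ps_zero, mul_one, zero_add, add_zero] at *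
    have := zero_excl (a := a) (p := d0) (q := d2) (r := d3) (by linarith) l02 l03 l23 (by linarith) (by linarith) (by linarith)
    linarith [this.1]
  · have hs : d0 = -(d1+d2+d3) := by linarith
    by_cases c12 : d1 = d2
    · subst c12
      by_cases c23 : d1 = d3
      · subst c23
        have hs : d0 = -(3*d1) := by linarith
        subst hs
        refine ⟨1, 1, Or.inl rfl, Or.inr (Or.inl ⟨d1, p3, by nlinarith, ?_, ?_⟩)⟩
        · rw [pow_two]
          rw [show -(3*d1)*d1 = -(3*(d1*d1)) by ring] at E01
          have : d1 * (ps a (d1*d1) - 3 * ps a (-(3*(d1*d1)))) = 0 := by linarith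
          have := (mul_eq_zero.1 this).resolve_left p3.ne'
          linarith
        · apply hext <;> simp [veq]
      · have hlt : d1 < d3 := lt_of_le_of_ne h23 c23
        obtain ⟨s, rfl⟩ : ∃ s, d0 = -s := ⟨-d0, by ring⟩
        rw [show -s*d1 = -(s*d1) by ring] at E01 E02 E03
        rw [show -s*d3 = -(s*d3) by ring] at E01 E02 E03
        have hi := iso_of_eqs (a := a) (w := d1) (y := d3) (s := s) c1 p3 (by linarith) (by linarith) (by linarith) (by linarith) (by linarith)
        refine ⟨1, 1, Or.inl rfl, Or.inr (Or.inr ⟨d3/d1, d1, (one_lt_div c1).2 hlt, c1, hi, ?_⟩)⟩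
        apply hext <;> simp [viso] <;> field_simp
        linarith
    · have c12' : d1 < d2 := lt_of_le_of_ne h12 c12
      by_cases c23 : d2 = d3
      · exfalso
        subst c23
        obtain ⟨s, rfl⟩ : ∃ s, d0 = -s := ⟨-d0, by ring⟩
        rw [show -s*d1 = -(s*d1) by ring] at E01 E02 E03
        rw [show -s*d2 = -(s*d2) by ring] at E01 E02 E03
        rw [mul_comm d1 d2] at E01 E02 E03
        have hi := iso_of_eqs (a := a) (w := d2) (y := d1) (s := s) p3 c1 (by linarith) (by linarith) (by linarith) (by linarith) (by linarith)
        have := iso_not_lt ha hab hb hi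
        rw [one_le_div p3] at this
        linarith
      · exfalso
        have c23' : d2 < d3 := lt_of_le_of_ne h23 c23
        refine concave_sym (a := a) (s := -d0) ha (by linarith) c1 c12' c23' l23 ?_ ?_
        · simp only [Eg, neg_neg]; rw [mul_comm d2 d1, mul_comm d1 d0, mul_comm d2 d0]; linarith
        · simp only [Eg, neg_neg]; rw [mul_comm d3 d2, mul_comm d3 d1, mul_comm d3 d0, mul_comm d2 d1, mul_comm d2 d0]; linarith

lemma classify {a b : ℝ} (ha : 0 < a) (hab : a*b = 1) (hb : 3/2 ≤ b) {δ : Fin 4 → ℝ} (h : DS a δ) : Cls a δ := by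
  apply Cls.of_perm (Tuple.sort δ)
  have hm := Tuple.monotone_sort δ
  have h := h.perm (Tuple.sort δ)
  generalize δ ∘ Tuple.sort δ = e at *
  have h01 : e 0 ≤ e 1 := hm (by decide)
  have h12 : e 1 ≤ e 2 := hm (by decide)
  have h23 : e 2 ≤ e 3 := hm (by decide)
  rcases le_total (e 3) (-e 0) with h0 | h0
  · exact cls_sorted ha hab hb h h01 h12 h23 h0
  · apply Cls.of_neg
    apply Cls.of_perm Fin.revPerm
    have r0 : (Fin.rev (0:Fin 4)) = 3 := rfl
    have r1 : (Fin.rev (1:Fin 4)) = 2 := rfl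
    have r2 : (Fin.rev (2:Fin 4)) = 1 := rfl
    have r3 : (Fin.rev (3:Fin 4)) = 0 := rfl
    apply cls_sorted ha hab hb (h.neg.perm _) <;> simp [r0, r1, r2, r3] <;> linarith

lemma ratio_eq {a b c s t : ℝ} (ha : 0 < a) (hab : a*b = 1) (hc : 0 < c) (hs : s < 1) (ht : t < 1) :
    ps a t = c * ps a s ↔ c^b*(1-t) = 1-s := by
  have h1 := ratio_le ha hab hc hs ht
  have h2 := ratio_lt ha hab hc hs ht
  constructor
  · intro h
    apply le_antisymm (h1.1 h.ge)
    by_contra h3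
    push Not at h3
    exact absurd (h2.2 h3) (by rw [h]; exact lt_irrefl _)
  · intro h
    apply le_antisymm _ (h1.2 h.le)
    by_contra h3
    push Not at h3
    exact absurd (h2.1 h3) (by rw [h]; exact lt_irrefl _)

section par
variable {a b : ℝ}

def PSq (a x : ℝ) : Prop := 0 < x ∧ x^2 < 1 ∧ ps a (x^2) = 2 * ps a (-x^2)
def PEq (a z : ℝ) : Prop := 0 < z ∧ z^2 < 1 ∧ ps a (z^2) = 3 * ps a (-(3*z^2))
def PIso (a r w : ℝ) : Prop := 1 < r ∧ 0 < w ∧ Iso a r (w^2)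

lemma psq_iff (ha : 0 < a) (hab : a*b = 1) {x : ℝ} (hx : 0 < x) (h1 : x^2 < 1) :
    PSq a x ↔ (2:ℝ)^b * (1 - x^2) = 1 + x^2 := by
  have := ratio_eq ha hab (c := 2) (s := -x^2) (t := x^2) (by norm_num) (by nlinarith) h1
  rw [sub_neg_eq_add] at this
  rw [← this]
  exact ⟨fun h => h.2.2, fun h => ⟨hx, h1, h⟩⟩

lemma peq_iff (ha : 0 < a) (hab : a*b = 1) {x : ℝ} (hx : 0 < x) (h1 : x^2 < 1) :
    PEq a x ↔ (3:ℝ)^b * (1 - x^2) = 1 + 3*x^2 := by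
  have := ratio_eq ha hab (c := 3) (s := -(3*x^2)) (t := x^2) (by norm_num) (by nlinarith) h1
  rw [sub_neg_eq_add] at this
  rw [← this]
  exact ⟨fun h => h.2.2, fun h => ⟨hx, h1, h⟩⟩

lemma par_exists {c d : ℝ} (hc : 1 < c) (hd : 0 < d) : ∃ x, 0 < x ∧ x^2 < 1 ∧ c * (1-x^2) = 1 + d*x^2 := by
  have h0 : 0 < (c-1)/(c+d) := by apply div_pos <;> linarith
  refine ⟨√((c-1)/(c+d)), Real.sqrt_pos.2 h0, ?_, ?_⟩
  · rw [Real.sq_sqrt h0.le, div_lt_one (by linarith)]; linarith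
  · rw [Real.sq_sqrt h0.le]; field_simp; ring

lemma par_uniq {c d x y : ℝ} (hc : 1 < c) (hd : 0 < d) (hx : 0 < x) (hy : 0 < y) (h1 : c * (1-x^2) = 1 + d*x^2)
    (h2 : c * (1-y^2) = 1 + d*y^2) : x = y := by
  have : (c+d)*x^2 = (c+d)*y^2 := by linarith
  have := mul_left_cancel₀ (by linarith : c+d ≠ 0) this
  rwa [pow_left_inj₀ hx.le hy.le (by norm_num)] at this

lemma one_lt_c {c : ℝ} (hab : a*b = 1) (ha : 0 < a) (hc : 1 < c) : 1 < c^b :=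
  Real.one_lt_rpow hc (by by_contra h; push Not at h; nlinarith)

lemma psq_exists (ha : 0 < a) (hab : a*b = 1) : ∃ x, PSq a x := by
  obtain ⟨x, h1, h2, h3⟩ := par_exists (one_lt_c (c := 2) hab ha (by norm_num)) one_pos
  exact ⟨x, (psq_iff ha hab h1 h2).2 (by linarith)⟩

lemma peq_exists (ha : 0 < a) (hab : a*b = 1) : ∃ x, PEq a x := by
  obtain ⟨x, h1, h2, h3⟩ := par_exists (d := 3) (one_lt_c (c := 3) hab ha (by norm_num)) (by norm_num)
  exact ⟨x, (peq_iff ha hab h1 h2).2 (by linarith)⟩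

lemma psq_uniq (ha : 0 < a) (hab : a*b = 1) {x y} (hx : PSq a x) (hy : PSq a y) : x = y := by
  have h1 := (psq_iff ha hab hx.1 hx.2.1).1 hx
  have h2 := (psq_iff ha hab hy.1 hy.2.1).1 hy
  exact par_uniq (one_lt_c (c := 2) hab ha (by norm_num)) one_pos hx.1 hy.1 (by linarith) (by linarith)

lemma peq_uniq (ha : 0 < a) (hab : a*b = 1) {x y} (hx : PEq a x) (hy : PEq a y) : x = y := by
  have h1 := (peq_iff ha hab hx.1 hx.2.1).1 hx
  have h2 := (peq_iff ha hab hy.1 hy.2.1).1 hy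
  exact par_uniq (d := 3) (one_lt_c (c := 3) hab ha (by norm_num)) (by norm_num) hx.1 hy.1 (by linarith) (by linarith)

lemma piso_exists (ha : 0 < a) (hab : a*b = 1) (hb : 3/2 ≤ b) : ∃ r w, PIso a r w := by
  obtain ⟨r, u, h1, h2⟩ := iso_exists ha hab hb
  refine ⟨r, √u, h1, Real.sqrt_pos.2 h2.2.1, ?_⟩
  rw [Real.sq_sqrt h2.2.1.le]; exact h2

lemma piso_uniq (ha : 0 < a) (hab : a*b = 1) (hb : 3/2 ≤ b) {r w r' w'} (h : PIso a r w) (h' : PIso a r' w') :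
    r = r' ∧ w = w' := by
  obtain ⟨e1, e2⟩ := iso_unique ha hab hb h.1 h'.1 h.2.2 h'.2.2
  exact ⟨e1, by rwa [pow_left_inj₀ h.2.1.le h'.2.1.le (by norm_num)] at e2⟩

lemma WR.mk' {q : Fin 4 → ℂ} {δ : Fin 4 → ℝ} (hq : ∑ k, q k = 0) (hδ : ∑ k, δ k = 0)
    (hδq : ∑ k, (δ k : ℂ) * q k = 0) (ne : δ 3 ≠ 0)
    (h01 : δ 0 * δ 1 < 1 ∧ dsq q 0 1 = ps a (δ 0 * δ 1))
    (h02 : δ 0 * δ 2 < 1 ∧ dsq q 0 2 = ps a (δ 0 * δ 2))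
    (h03 : δ 0 * δ 3 < 1 ∧ dsq q 0 3 = ps a (δ 0 * δ 3))
    (h12 : δ 1 * δ 2 < 1 ∧ dsq q 1 2 = ps a (δ 1 * δ 2))
    (h13 : δ 1 * δ 3 < 1 ∧ dsq q 1 3 = ps a (δ 1 * δ 3))
    (h23 : δ 2 * δ 3 < 1 ∧ dsq q 2 3 = ps a (δ 2 * δ 3)) : WR a q δ := by
  have : ∀ k l, k ≠ l → δ k * δ l < 1 ∧ dsq q k l = ps a (δ k * δ l) := by
    refine fin4_all ?_ ?_ ?_ ?_ <;> refine fin4_all ?_ ?_ ?_ ?_ <;> intro h <;> first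
      | exact absurd rfl h | assumption | (rw [dsq_comm, mul_comm]; assumption)
  exact ⟨hq, hδ, hδq, fun k l h => (this k l h).1, fun k l h => (this k l h).2, fun e => ne (by rw [e]; rfl)⟩

lemma sq_real {x : ℝ} (h : PSq a x) : ∃ q, WR a q (vsq x) ∧ ¬ Coll q := by
  obtain ⟨hx, h1, h2⟩ := h
  have hP := ps_pos (a := a) h1
  have hm := ps_pos (a := a) (t := -x^2) (by nlinarith)
  set R := √(ps a (x^2))/2 with hR
  have hR0 : 0 < R := by have := Real.sqrt_pos.2 hP; positivity
  have hR2 : 4*(R*R) = ps a (x^2) := by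
    rw [hR]; linear_combination Real.mul_self_sqrt hP.le
  refine ⟨![⟨R,0⟩, ⟨-R,0⟩, ⟨0,R⟩, ⟨0,-R⟩], ?_, ?_⟩
  · have e1 : x * -x = -x^2 := by ring
    have e2 : -x * -x = x^2 := by ring
    have e3 : x * x = x^2 := by ring
    apply WR.mk'
    · apply Complex.ext <;> simp [Fin.sum_univ_four]
    · simp [Fin.sum_univ_four, vsq]
    · apply Complex.ext <;> simp [Fin.sum_univ_four, vsq]
    · simp [vsq, hx.ne']
    all_goals simp only [dsq, vsq, Complex.normSq_apply, Matrix.cons_val, Complex.sub_re, Complex.sub_im, e1, e2, e3]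
    all_goals exact ⟨by linarith [sq_nonneg x], by linarith⟩
  · intro hc
    have := congrFun (coll_Dl hc) 3
    simp [Dl, area] at this
    rcases this with h | h <;> linarith

lemma eq_real {z : ℝ} (h : PEq a z) : ∃ q, WR a q (veq z) ∧ ¬ Coll q := by
  obtain ⟨hx, h1, h2⟩ := h
  have hP := ps_pos (a := a) h1
  have hm := ps_pos (a := a) (t := -(3*z^2)) (by nlinarith)
  set R := √(ps a (-(3*z^2))) with hR
  have hR0 : 0 < R := Real.sqrt_pos.2 hm
  have hR2 : R*R = ps a (-(3*z^2)) := Real.mul_self_sqrt hm.le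
  have h3 : √3*√3 = (3:ℝ) := Real.mul_self_sqrt (by norm_num)
  have h30 : (0:ℝ) < √3 := Real.sqrt_pos.2 (by norm_num)
  have hR3 : 3*(R*R) = ps a (z^2) := by rw [h2, hR2]
  have k1 : (R*√3/2)*(R*√3/2) = 3*(R*R)/4 := by linear_combination (R*R/4)*h3
  refine ⟨![⟨0,0⟩, ⟨R,0⟩, ⟨-R/2,R*√3/2⟩, ⟨-R/2,-(R*√3/2)⟩], ?_, ?_⟩
  · have e1 : -(3*z) * z = -(3*z^2) := by ring
    have e3 : z * z = z^2 := by ring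
    apply WR.mk'
    · apply Complex.ext <;> simp [Fin.sum_univ_four]; ring
    · simp [Fin.sum_univ_four, veq]; ring
    · apply Complex.ext <;> simp [Fin.sum_univ_four, veq] ; ring
    · simp [veq, hx.ne']
    all_goals simp only [dsq, veq, Complex.normSq_apply, Matrix.cons_val, Complex.sub_re, Complex.sub_im, e1, e3]
    all_goals generalize R*√3/2 = S at *
    all_goals exact ⟨by linarith [sq_nonneg z], by linarith⟩
  · intro hc
    have := congrFun (coll_Dl hc) 3
    simp [Dl, area, hR0.ne', h30.ne'] at this


lemma iso_real {r w : ℝ} (h : PIso a r w) : ∃ q, WR a q (viso r w) ∧ ¬ Coll q := by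
  obtain ⟨hr, hw, -, hu, hu1, hru, I, II⟩ := h
  have p1 := ps_pos (a := a) hu1
  have q1 : 0 < (2+r)*w^2 := by positivity
  have q2 : 0 < r*((2+r)*w^2) := by positivity
  have p2 := ps_pos (a := a) (t := -(r*((2+r)*w^2))) (by linarith)
  set H := √(ps a (-(r*((2+r)*w^2)))) with hH
  set T := √(ps a (w^2))/2 with hT
  have hH0 : 0 < H := Real.sqrt_pos.2 p2
  have hT0 : 0 < T := by have := Real.sqrt_pos.2 p1; positivity
  have hH2 : H*H = ps a (-(r*((2+r)*w^2))) := Real.mul_self_sqrt p2.le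
  have hT2 : 4*(T*T) = ps a (w^2) := by rw [hT]; linear_combination Real.mul_self_sqrt p1.le
  refine ⟨![⟨-(1+r)*H/4 + r*H/2,0⟩, ⟨-(1+r)*H/4,T⟩, ⟨-(1+r)*H/4,-T⟩, ⟨-(1+r)*H/4+(2+r)*H/2,0⟩], ?_, ?_⟩
  · have e1 : -((2+r)*w) * w = -((2+r)*w^2) := by ring
    have e2 : -((2+r)*w) * (r*w) = -(r*((2+r)*w^2)) := by ring
    have e3 : w * w = w^2 := by ring
    have e4 : w * (r*w) = r*w^2 := by ring
    apply WR.mk'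
    · apply Complex.ext <;> simp [Fin.sum_univ_four]; ring
    · simp [Fin.sum_univ_four, viso]; ring
    · apply Complex.ext <;> simp [Fin.sum_univ_four, viso] ; ring
    · have : r ≠ 0 := by linarith
      simp [viso, hw.ne', this]
    all_goals simp only [dsq, viso, Complex.normSq_apply, Matrix.cons_val, Complex.sub_re, Complex.sub_im, e1, e2, e3, e4]
    all_goals generalize ps a (-(r*((2+r)*w^2))) = W at *
    all_goals generalize ps a (-((2+r)*w^2)) = Z at *
    all_goals generalize ps a (r*w^2) = Y at *
    all_goals generalize ps a (w^2) = X at *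
    · exact ⟨by linarith, by linear_combination (r^2/4)*hH2 + hT2/4 + II/4⟩
    · exact ⟨by linarith, by linear_combination (r^2/4)*hH2 + hT2/4 + II/4⟩
    · exact ⟨by linarith, by linear_combination hH2⟩
    · exact ⟨by linarith, by linear_combination hT2⟩
    · exact ⟨by linarith, by linear_combination ((2+r)^2/4)*hH2 + hT2/4 + II/4 - I⟩
    · exact ⟨by linarith, by linear_combination ((2+r)^2/4)*hH2 + hT2/4 + II/4 - I⟩
  · intro hc
    have := congrFun (coll_Dl hc) 0
    simp [Dl, area] at this
    rcases this with h | h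
    · linarith
    · have : 0 < (2+r)*H := by positivity
      rcases h with h | h <;> linarith

end par

abbrev E4 := Fin 4 → ℂ

def HIdx (H : E4 → ℝ) (n : ℕ) : Prop :=
  (∃ V : Submodule ℝ E4, Module.finrank ℝ V = n ∧ ∀ v ∈ V, v ≠ 0 → H v < 0) ∧
  ∀ V : Submodule ℝ E4, (∀ v ∈ V, v ≠ 0 → H v < 0) → Module.finrank ℝ V ≤ n

lemma HIdx.morse {A : ℝ} {f : E4 → ℝ} (hA : 3 ≤ A) (hf : FForm A f) {q : E4} (h : Dist4 q) {n : ℕ}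
    (hI : HIdx (Hs (A/2) q) n) : morseIndex f q = n := by
  unfold morseIndex
  simp only [f_hess hA hf h]
  obtain ⟨h1, h2⟩ := hI
  apply le_antisymm
  · apply csSup_le ⟨n, h1⟩
    rintro m ⟨V, rfl, hV⟩
    exact h2 V hV
  · refine le_csSup (s := {n : ℕ | ∃ V : Submodule ℝ E4, Module.finrank ℝ V = n ∧ ∀ v ∈ V, v ≠ 0 → Hs (A/2) q v < 0}) ⟨n, ?_⟩ h1
    rintro m ⟨V, rfl, hV⟩
    exact h2 V hV

lemma HIdx.equiv {H H' : E4 → ℝ} (e : E4 ≃ₗ[ℝ] E4) (he : ∀ v, H' (e v) = H v) {n : ℕ} (h : HIdx H' n) : HIdx H n := by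
  obtain ⟨⟨V, h1, h2⟩, h3⟩ := h
  refine ⟨⟨V.map e.symm.toLinearMap, ?_, ?_⟩, ?_⟩
  · rw [LinearEquiv.finrank_map_eq, h1]
  · rintro v ⟨x, hx, rfl⟩ hv
    have := h2 x hx (fun h0 => hv (by rw [h0]; simp))
    rw [← he]; simpa using this
  · intro V hV
    have := h3 (V.map e.toLinearMap) (by
      rintro v ⟨x, hx, rfl⟩ hv
      have := hV x hx (fun h0 => hv (by rw [h0]; simp))
      rw [← he] at this; simpa using this)
    rwa [LinearEquiv.finrank_map_eq] at this

lemma HIdx.perm {b : ℝ} {q : E4} (σ : Equiv.Perm (Fin 4)) {n : ℕ} (h : HIdx (Hs b (q ∘ σ)) n) : HIdx (Hs b q) n := by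
  refine HIdx.equiv (LinearEquiv.funCongrLeft ℝ ℂ σ) (fun v => ?_) h
  unfold Hs
  congr 1
  · congr 1
    exact Equiv.sum_comp σ (fun k => Complex.normSq (v k))
  · congr 1
    rw [← Equiv.sum_comp σ (fun k => ∑ l, (dsq q k l ^ (-b) * Complex.normSq (v k - v l)
      - 2*b*(dsq q k l ^ (-b) / dsq q k l) * dt (q k - q l) (v k - v l) ^ 2))]
    apply sum_congr rfl
    intro k _
    rw [← Equiv.sum_comp σ (fun l => (dsq q (σ k) l ^ (-b) * Complex.normSq (v (σ k) - v l)
      - 2*b*(dsq q (σ k) l ^ (-b) / dsq q (σ k) l) * dt (q (σ k) - q l) (v (σ k) - v l) ^ 2))]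
    rfl

lemma hidx_upper {F : Type*} [AddCommGroup F] [Module ℝ F] [Module.Finite ℝ F] {H : E4 → ℝ} (L : E4 →ₗ[ℝ] F)
    (hL : ∀ v, L v = 0 → 0 ≤ H v) (V : Submodule ℝ E4) (hV : ∀ v ∈ V, v ≠ 0 → H v < 0) :
    Module.finrank ℝ V ≤ Module.finrank ℝ F := by
  apply LinearMap.finrank_le_finrank_of_injective (f := L.comp V.subtype)
  rw [← LinearMap.ker_eq_bot, LinearMap.ker_eq_bot']
  rintro ⟨v, hv⟩ h0
  by_contra hne
  have h1 := hL v (by simpa using h0)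
  have h2 := hV v hv (fun e => hne (by simp [e]))
  linarith

lemma hidx_lower {F : Type*} [AddCommGroup F] [Module ℝ F] {H : E4 → ℝ} (h0 : H 0 = 0) (M : F →ₗ[ℝ] E4)
    (hM : ∀ w, w ≠ 0 → H (M w) < 0) :
    ∃ V : Submodule ℝ E4, Module.finrank ℝ V = Module.finrank ℝ F ∧ ∀ v ∈ V, v ≠ 0 → H v < 0 := by
  refine ⟨LinearMap.range M, ?_, ?_⟩
  · apply LinearMap.finrank_range_of_inj
    rw [← LinearMap.ker_eq_bot, LinearMap.ker_eq_bot']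
    intro w hw
    by_contra hne
    have := hM w hne
    rw [hw, h0] at this
    exact lt_irrefl _ this
  · rintro v ⟨w, rfl⟩ hv
    exact hM w (fun e => hv (by rw [e, map_zero]))

lemma Hs_zero (b : ℝ) (q : E4) : Hs b q 0 = 0 := by simp [Hs, dt]

/-- centered Hessian -/
noncomputable def gt' (a : ℝ) (q : E4) (δ : Fin 4 → ℝ) (v : E4) (k l : Fin 4) : ℝ :=
  (1 - δ k * δ l) / ps a (δ k * δ l) * dt (q k - q l) (v k - v l)^2

noncomputable def PP (a : ℝ) (q : E4) (δ : Fin 4 → ℝ) (v : E4) : ℝ :=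
  gt' a q δ v 0 1 + gt' a q δ v 0 2 + gt' a q δ v 0 3 + gt' a q δ v 1 2 + gt' a q δ v 1 3 + gt' a q δ v 2 3

noncomputable def SD (δ : Fin 4 → ℝ) : E4 →ₗ[ℝ] ℂ where
  toFun v := δ 0 * v 0 + δ 1 * v 1 + δ 2 * v 2 + δ 3 * v 3
  map_add' x y := by simp; ring
  map_smul' c x := by simp; ring

lemma SD_apply (δ v) : SD δ v = δ 0 * v 0 + δ 1 * v 1 + δ 2 * v 2 + δ 3 * v 3 := rfl

noncomputable def Hc (a b : ℝ) (q : E4) (δ : Fin 4 → ℝ) (v : E4) : ℝ :=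
  -Complex.normSq (SD δ v) + 2*b*PP a q δ v

lemma Hs_eq {a b : ℝ} (hab : a*b = 1) {q δ} (h : WR a q δ) (v : E4) :
    Hs b q v = Complex.normSq (∑ k, v k) + Hc a b q δ v := by
  have key : ∀ k l, dsq q k l ^ (-b) * Complex.normSq (v k - v l)
    - 2*b*(dsq q k l ^ (-b) / dsq q k l) * dt (q k - q l) (v k - v l) ^ 2 =
    (1 - δ k * δ l) * Complex.normSq (v k - v l) - 2*b*gt' a q δ v k l := by
    intro k l
    by_cases hkl : k = l
    · subst hkl; simp [dt, gt']
    · rw [h.hs k l hkl, ps_rpow hab (h.lt k l hkl), gt']; ring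
  have gsym : ∀ k l, gt' a q δ v k l = gt' a q δ v l k := by
    intro k l
    simp only [gt', dt, mul_comm (δ k) (δ l), Complex.sub_re, Complex.sub_im]; ring
  have gd : ∀ k, gt' a q δ v k k = 0 := by intro k; simp [gt', dt]
  unfold Hs
  rw [sum_congr rfl fun k _ => sum_congr rfl fun l _ => key k l]
  have hδ := h.hδ
  unfold Hc PP
  rw [SD_apply]
  simp only [Fin.sum_univ_four, gd] at hδ ⊢
  rw [gsym 1 0, gsym 2 0, gsym 3 0, gsym 2 1, gsym 3 1, gsym 3 2]
  simp only [Complex.normSq_apply, Complex.sub_re, Complex.sub_im, Complex.add_re, Complex.add_im, Complex.re_ofReal_mul, Complex.im_ofReal_mul]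
  linear_combination (δ 0*((v 0).re*(v 0).re+(v 0).im*(v 0).im) + δ 1*((v 1).re*(v 1).re+(v 1).im*(v 1).im)
    + δ 2*((v 2).re*(v 2).re+(v 2).im*(v 2).im) + δ 3*((v 3).re*(v 3).re+(v 3).im*(v 3).im)) * hδ

noncomputable def cenL : E4 →ₗ[ℝ] E4 where
  toFun v := fun k => v k - (v 0 + v 1 + v 2 + v 3)/4
  map_add' x y := by funext k; simp; ring
  map_smul' c x := by funext k; simp; ring

lemma Hc_cen {a b : ℝ} (hab : a*b = 1) {q δ} (h : WR a q δ) (v : E4) : Hs b q (cenL v) = Hc a b q δ v := by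
  rw [Hs_eq hab h]
  have e1 : ∑ k, cenL v k = 0 := by
    simp [Fin.sum_univ_four, cenL]; ring
  have e2 : SD δ (cenL v) = SD δ v := by
    have hδ := congrArg Complex.ofReal h.hδ
    simp only [Fin.sum_univ_four] at hδ
    push_cast at hδ
    simp [SD_apply, cenL]
    linear_combination (-(v 0 + v 1 + v 2 + v 3)/4) * hδ
  have e3 : PP a q δ (cenL v) = PP a q δ v := by
    have : ∀ k l, gt' a q δ (cenL v) k l = gt' a q δ v k l := by
      intro k l; simp only [gt', cenL, LinearMap.coe_mk, AddHom.coe_mk, sub_sub_sub_cancel_right]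
    simp only [PP, this]
  rw [e1, Hc, Hc, e2, e3]; simp

lemma WR.idx {a b : ℝ} (hab : a*b = 1) {q δ} (h : WR a q δ) {F G : Type*} [AddCommGroup F] [Module ℝ F] [Module.Finite ℝ F]
    [AddCommGroup G] [Module ℝ G] {n : ℕ} (hF : Module.finrank ℝ F = n) (hG : Module.finrank ℝ G = n)
    (L : E4 →ₗ[ℝ] F) (hL : ∀ v, L v = 0 → 0 ≤ Hc a b q δ v)
    (M : G →ₗ[ℝ] E4) (hM : ∀ w, w ≠ 0 → Hc a b q δ (M w) < 0) : HIdx (Hs b q) n := by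
  constructor
  · rw [← hG]
    exact hidx_lower (Hs_zero b q) (cenL.comp M) (fun w hw => by
      rw [LinearMap.comp_apply, Hc_cen hab h]; exact hM w hw)
  · intro V hV
    rw [← hF]
    refine hidx_upper L (fun v hv => ?_) V hV
    rw [Hs_eq hab h]
    exact add_nonneg (Complex.normSq_nonneg _) (hL v hv)

lemma gt_nonneg {a : ℝ} {q δ} (h : WR a q δ) (v : E4) {k l : Fin 4} (hkl : k ≠ l) : 0 ≤ gt' a q δ v k l := by
  have h1 := h.lt k l hkl
  exact mul_nonneg (div_nonneg (by linarith) (ps_pos h1).le) (sq_nonneg _)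

lemma PP_nonneg {a : ℝ} {q δ} (h : WR a q δ) (v : E4) : 0 ≤ PP a q δ v := by
  have h1 := gt_nonneg h v (k := 0) (l := 1) (by decide)
  have h2 := gt_nonneg h v (k := 0) (l := 2) (by decide)
  have h3 := gt_nonneg h v (k := 0) (l := 3) (by decide)
  have h4 := gt_nonneg h v (k := 1) (l := 2) (by decide)
  have h5 := gt_nonneg h v (k := 1) (l := 3) (by decide)
  have h6 := gt_nonneg h v (k := 2) (l := 3) (by decide)
  unfold PP; linarith

lemma dt_dsq (q : E4) (k l m n : Fin 4) : dt (q k - q l) (q m - q n) =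
    (dsq q k n + dsq q l m - dsq q k m - dsq q l n)/2 := by
  simp [dt, dsq, Complex.normSq_apply]; ring

lemma ortho_dec {e1 e2 W : ℂ} {N : ℝ} (hN : 0 < N) (h1 : Complex.normSq e1 = N) (h2 : Complex.normSq e2 = N)
    (h0 : dt e1 e2 = 0) : N * Complex.normSq W = dt e1 W ^ 2 + dt e2 W ^ 2 := by
  apply mul_left_cancel₀ hN.ne'
  simp only [dt, Complex.normSq_apply] at *
  obtain ⟨p, q⟩ := e1
  obtain ⟨s, t⟩ := e2
  obtain ⟨x, y⟩ := W
  simp only at *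
  have c1 : N*(q*q - s*s) = 0 := by
    linear_combination (t*q-p*s)*h0 + s*s*h1 - q*q*h2
  have c2 : N*(p*p - t*t) = 0 := by
    linear_combination (p*s-t*q)*h0 + t*t*h1 - p*p*h2
  have c3 : N*(p*q+s*t) = 0 := by
    linear_combination (q*s+p*t)*h0 - s*t*h1 - p*q*h2
  linear_combination x*x*c1 + y*y*c2 - 2*x*y*c3 - N*(x*x+y*y)*h1

lemma sq_fin {b x Z N P d02 d03 d12 d13 : ℝ} (hb : 3/2 ≤ b) (hZ : 0 < Z)
    (key : 2*Z*N = (x*(d02+d03-d12-d13))^2 + (-(x*(d02-d03+d12-d13)))^2)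
    (hP : (1+x^2)*(d02^2+d03^2+d12^2+d13^2) ≤ P*Z) : 0 ≤ -N+2*b*P := by
  have hD : 0 ≤ d02^2+d03^2+d12^2+d13^2 := by positivity
  have hB : 0 ≤ (x*(d02-d03-d12+d13))^2 + (x*(d02+d03+d12+d13))^2 := by positivity
  have f1 := mul_le_mul_of_nonneg_left hP (show (0:ℝ) ≤ b by linarith)
  have f3 := mul_nonneg (show 0 ≤ b - 3/2 by linarith) (mul_nonneg (show 0 ≤ 1+x^2 by positivity) hD)
  have f4 := mul_nonneg (sq_nonneg x) hD
  have : 0 ≤ Z * (-N+2*b*P) := by linarith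
  exact (mul_nonneg_iff_of_pos_left hZ).1 this

lemma sq_idx {a b : ℝ} (ha : 0 < a) (hab : a*b = 1) (hb : 3/2 ≤ b) {q : E4} {x : ℝ} (hx : PSq a x) (h : WR a q (vsq x)) :
    HIdx (Hs b q) 0 := by
  refine h.idx hab (F := Fin 0 → ℝ) (G := Fin 0 → ℝ) (by simp) (by simp) 0 ?_ 0 (fun w hw => absurd (Subsingleton.elim _ _) hw)
  intro v _
  obtain ⟨hx0, hx1, hxe⟩ := hx
  have hZ : 0 < ps a (-x^2) := ps_pos (by nlinarith)
  have s01 := h.hs 0 1 (by decide)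
  have s02 := h.hs 0 2 (by decide)
  have s03 := h.hs 0 3 (by decide)
  have s12 := h.hs 1 2 (by decide)
  have s13 := h.hs 1 3 (by decide)
  have s23 := h.hs 2 3 (by decide)
  have g01 := gt_nonneg h v (k := 0) (l := 1) (by decide)
  have g23 := gt_nonneg h v (k := 2) (l := 3) (by decide)
  have h0 := dt_dsq q 0 1 2 3
  have hr := congrArg Complex.re h.hδq
  have hi := congrArg Complex.im h.hδq
  have e1 : x * -x = -x^2 := by ring
  have e2 : -x * -x = x^2 := by ring
  have e3 : x * x = x^2 := by ring
  simp only [vsq, Matrix.cons_val, e1, e2, e3] at s01 s02 s03 s12 s13 s23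
  rw [s03, s12, s02, s13] at h0
  have hn1 : Complex.normSq (q 0 - q 1) = 2 * ps a (-x^2) := by rw [← hxe]; exact s01
  have hn2 : Complex.normSq (q 2 - q 3) = 2 * ps a (-x^2) := by rw [← hxe]; exact s23
  have key := ortho_dec (W := SD (vsq x) v) (by linarith) hn1 hn2 (by rw [h0]; ring)
  set d02 := dt (q 0 - q 2) (v 0 - v 2) with hd02
  set d03 := dt (q 0 - q 3) (v 0 - v 3) with hd03
  set d12 := dt (q 1 - q 2) (v 1 - v 2) with hd12
  set d13 := dt (q 1 - q 3) (v 1 - v 3) with hd13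
  simp [Fin.sum_univ_four, vsq] at hr hi
  have w1 : dt (q 0 - q 1) (SD (vsq x) v) = x*(d02+d03-d12-d13) := by
    rw [SD_apply, hd02, hd03, hd12, hd13]
    simp [dt, vsq]
    linear_combination (-((v 0).re - (v 1).re))*hr - ((v 0).im-(v 1).im)*hi
  have w2 : dt (q 2 - q 3) (SD (vsq x) v) = -(x*(d02-d03+d12-d13)) := by
    rw [SD_apply, hd02, hd03, hd12, hd13]
    simp [dt, vsq]
    linear_combination (-((v 2).re - (v 3).re))*hr - ((v 2).im-(v 3).im)*hi
  rw [w1, w2] at key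
  have hP : (1+x^2)/ps a (-x^2) * (d02^2+d03^2+d12^2+d13^2) ≤ PP a q (vsq x) v := by
    unfold PP
    have : ∀ k l, k ≠ l → vsq x k * vsq x l = -x^2 → gt' a q (vsq x) v k l = (1+x^2)/ps a (-x^2) * dt (q k - q l) (v k - v l)^2 := by
      intro k l _ e
      rw [gt', e, sub_neg_eq_add]
    rw [this 0 2 (by decide) (by simp [vsq]; ring), this 0 3 (by decide) (by simp [vsq]; ring),
      this 1 2 (by decide) (by simp [vsq]; ring), this 1 3 (by decide) (by simp [vsq]; ring)]
    linarith
  unfold Hc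
  rw [div_mul_eq_mul_div, div_le_iff₀ hZ] at hP
  exact sq_fin hb hZ key hP

lemma num3 {b : ℝ} (hb : 3/2 ≤ b) : 4*b*(3:ℝ)^b < ((3:ℝ)^b-1)*((3:ℝ)^b+3) := by
  obtain ⟨t, rfl⟩ : ∃ t, b = 3/2 + t := ⟨b - 3/2, by ring⟩
  have ht : 0 ≤ t := by linarith
  have h1 : (3:ℝ)^(3/2+t) = 3^(3/2:ℝ) * 3^t := Real.rpow_add (by norm_num) _ _
  have h2 : (5.19:ℝ) ≤ 3^(3/2:ℝ) := by
    have : ((3:ℝ)^(3/2:ℝ))^2 = 27 := by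
      rw [← Real.rpow_natCast, ← Real.rpow_mul (by norm_num)]; norm_num
    have h0 : 0 < (3:ℝ)^(3/2:ℝ) := by positivity
    nlinarith
  have h3 : 1 + t ≤ (3:ℝ)^t := by
    have l3 : 1 ≤ Real.log 3 := by
      rw [Real.le_log_iff_exp_le (by norm_num)]; linarith [Real.exp_one_lt_d9]
    have h5 := Real.add_one_le_exp (Real.log 3 * t)
    rw [Real.rpow_def_of_pos (by norm_num)]
    nlinarith
  have h4 : 5.19*(1+t) ≤ (3:ℝ)^(3/2+t) := by
    rw [h1]; exact mul_le_mul h2 h3 (by linarith) (by positivity)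
  generalize (3:ℝ)^(3/2+t) = T at *
  nlinarith

lemma eq_cond {a b : ℝ} (ha : 0 < a) (hab : a*b = 1) (hb : 3/2 ≤ b) {z : ℝ} (hz : PEq a z) :
    b*(1+3*z^2)*(1-z^2) < 4*z^2 := by
  have h1 := (peq_iff ha hab hz.1 hz.2.1).1 hz
  have h2 := num3 hb
  have h3 : 0 < 1 - z^2 := by linarith [hz.2.1]
  generalize (3:ℝ)^b = T at *
  generalize z^2 = u at *
  have h4 := mul_lt_mul_of_pos_right h2 (mul_pos h3 h3)
  have e1 : (T-1)*(1-u) = 4*u := by linarith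
  have e2 : (T+3)*(1-u) = 4 := by linarith
  have e3 : (T-1)*(T+3)*((1-u)*(1-u)) = 4*u*4 := by rw [← e1, ← e2]; ring
  rw [e3] at h4
  have e4 : 4*b*T*((1-u)*(1-u)) = 4*(b*(1+3*u)*(1-u)) := by rw [← h1]; ring
  linarith

lemma eq_idx {a b : ℝ} (ha : 0 < a) (hab : a*b = 1) (hb : 3/2 ≤ b) {q : E4} {z : ℝ} (hz : PEq a z) (h : WR a q (veq z)) :
    HIdx (Hs b q) 2 := by
  have hcond := eq_cond ha hab hb hz
  obtain ⟨hz0, hz1, hze⟩ := hz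
  have hu0 : 0 < z^2 := by positivity
  have hZ : 0 < ps a (-(3*z^2)) := ps_pos (by linarith)
  set γ := (1+3*z^2)/4 with hγ
  let M : (Fin 2 → ℝ) →ₗ[ℝ] E4 :=
    { toFun := fun p => ![(p 0:ℂ)*q 1 + (p 1:ℂ)*q 2,
        γ*(2*((p 0:ℂ) - (p 1:ℂ)/2)*q 1 - ((p 0:ℂ)*q 1 + (p 1:ℂ)*q 2)),
        γ*(2*((p 1:ℂ) - (p 0:ℂ)/2)*q 2 - ((p 0:ℂ)*q 1 + (p 1:ℂ)*q 2)),
        γ*(2*(-((p 0:ℂ) + (p 1:ℂ))/2)*q 3 - ((p 0:ℂ)*q 1 + (p 1:ℂ)*q 2))]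
      map_add' := fun x y => by
        funext k; revert k; refine fin4_all ?_ ?_ ?_ ?_ <;> simp <;> ring
      map_smul' := fun c x => by
        funext k; revert k; refine fin4_all ?_ ?_ ?_ ?_ <;> simp <;> ring }
  refine h.idx hab (F := ℂ) (G := Fin 2 → ℝ) (by simp) (by simp) (SD (veq z)) ?_ M ?_
  · intro v hv
    unfold Hc
    rw [hv, map_zero]
    have := PP_nonneg h v
    have : 0 ≤ 2*b*PP a q (veq z) v := by positivity
    linarith
  · intro p hp
    have hq := h.hq
    have hδq := h.hδq
    simp only [Fin.sum_univ_four, veq, Matrix.cons_val] at hq hδq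
    push_cast at hδq
    have hzc : (z:ℂ) ≠ 0 := by exact_mod_cast hz0.ne'
    have q0 : q 0 = 0 := by
      have : (z:ℂ) * (4 * q 0) = 0 := by linear_combination z * hq - hδq
      simpa [hzc] using this
    have q3 : q 3 = -q 1 - q 2 := by rw [q0] at hq; linear_combination hq
    have s01 := h.hs 0 1 (by decide)
    have s02 := h.hs 0 2 (by decide)
    have s12 := h.hs 1 2 (by decide)
    have e1 : -(3*z) * z = -(3*z^2) := by ring
    have e3 : z * z = z^2 := by ring
    simp only [veq, Matrix.cons_val, e1, e3, hze, dsq, q0, zero_sub, Complex.normSq_neg] at s01 s02 s12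
    have hSD : SD (veq z) (M p) = -(3*z)*((p 0:ℂ)*q 1 + (p 1:ℂ)*q 2) := by
      rw [SD_apply]
      simp only [M, LinearMap.coe_mk, AddHom.coe_mk, veq, Matrix.cons_val, q3]
      push_cast; ring
    unfold Hc
    rw [hSD]
    have wt1 : ∀ k : Fin 4, k ≠ 0 → veq z 0 * veq z k = -(3*z^2) := by
      refine fin4_all ?_ ?_ ?_ ?_ <;> intro hk <;> simp [veq] at hk ⊢ <;> ring
    have wt2 : ∀ k l : Fin 4, k ≠ 0 → l ≠ 0 → veq z k * veq z l = z^2 := by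
      refine fin4_all ?_ ?_ ?_ ?_ <;> refine fin4_all ?_ ?_ ?_ ?_ <;> intro hk hl <;> simp [veq] at hk hl ⊢ <;> ring
    unfold PP
    simp only [gt', wt1 1 (by decide), wt1 2 (by decide), wt1 3 (by decide), wt2 1 2 (by decide) (by decide),
      wt2 1 3 (by decide) (by decide), wt2 2 3 (by decide) (by decide), hze]
    generalize ps a (-(3*z^2)) = Z at *
    obtain ⟨α, hα⟩ : ∃ α, α = p 0 := ⟨_, rfl⟩
    obtain ⟨β, hβ⟩ : ∃ β, β = p 1 := ⟨_, rfl⟩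
    have hpos : 0 < α^2 - α*β + β^2 := by
      have : α ≠ 0 ∨ β ≠ 0 := by
        by_contra hc
        push Not at hc
        apply hp
        funext i
        fin_cases i
        · exact hα.symm.trans hc.1
        · exact hβ.symm.trans hc.2
      rcases this with h0 | h0
      · have : 0 < α^2 := by positivity
        nlinarith [sq_nonneg (α - 2*β)]
      · have : 0 < β^2 := by positivity
        nlinarith [sq_nonneg (2*α - β)]
    have i1 : (q 1).re*(q 1).re + (q 1).im*(q 1).im = Z := by rw [← s01, Complex.normSq_apply]
    have i2 : (q 2).re*(q 2).re + (q 2).im*(q 2).im = Z := by rw [← s02, Complex.normSq_apply]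
    have i12 : (q 1).re*(q 2).re + (q 1).im*(q 2).im = -Z/2 := by
      rw [Complex.normSq_apply, Complex.sub_re, Complex.sub_im] at s12; linarith
    have d01 : dt (q 0 - q 1) (M p 0 - M p 1) = (γ-1)*Z*(α-β/2) := by
      simp [M, dt, q0, ← hα, ← hβ]
      linear_combination (-α+2*γ*(α-β/2)-γ*α)*i1 + (-β-γ*β)*i12
    have d02 : dt (q 0 - q 2) (M p 0 - M p 2) = (γ-1)*Z*(β-α/2) := by
      simp [M, dt, q0, ← hα, ← hβ]
      linear_combination (-β+2*γ*(β-α/2)-γ*β)*i2 + (-α-γ*α)*i12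
    have d03 : dt (q 0 - q 3) (M p 0 - M p 3) = (γ-1)*Z*(-(α+β)/2) := by
      simp [M, dt, q0, q3, ← hα, ← hβ]
      linear_combination (α+γ*α - γ*(α+β))*i1 + (β + γ*β - γ*(α+β))*i2 + (α+β+γ*(α+β) - 2*γ*(α+β))*i12
    have d12 : dt (q 1 - q 2) (M p 1 - M p 2) = 3*γ*Z*((α+β)/2) := by
      simp [M, dt, q0, ← hα, ← hβ]
      linear_combination (2*γ*(α-β/2))*i1 + (2*γ*(β-α/2))*i2 - (2*γ*(α-β/2)+2*γ*(β-α/2))*i12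
    have d13 : dt (q 1 - q 3) (M p 1 - M p 3) = -(3*γ*Z*(β-α/2)) := by
      simp [M, dt, q0, q3, ← hα, ← hβ]
      linear_combination (4*γ*(α-β/2)-2*γ*(α+β))*i1 + (-γ*(α+β))*i2 + (2*γ*(α-β/2)-3*γ*(α+β))*i12
    have d23 : dt (q 2 - q 3) (M p 2 - M p 3) = -(3*γ*Z*(α-β/2)) := by
      simp [M, dt, q0, q3, ← hα, ← hβ]
      linear_combination (4*γ*(β-α/2)-2*γ*(α+β))*i2 + (-γ*(α+β))*i1 + (2*γ*(β-α/2)-3*γ*(α+β))*i12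
    have hn : Complex.normSq (-(3*z)*((p 0:ℂ)*q 1 + (p 1:ℂ)*q 2)) = 9*z^2*Z*(α^2-α*β+β^2) := by
      simp [Complex.normSq_apply, ← hα, ← hβ]
      linear_combination 9*z^2*α^2*i1 + 9*z^2*β^2*i2 + 18*z^2*α*β*i12
    rw [d01, d02, d03, d12, d13, d23, hn]
    have : -(9*z^2*Z*(α^2-α*β+β^2)) + 2*b*((1 - -(3*z^2))/Z*((γ-1)*Z*(α-β/2))^2 + (1 - -(3*z^2))/Z*((γ-1)*Z*(β-α/2))^2
      + (1 - -(3*z^2))/Z*((γ-1)*Z*(-(α+β)/2))^2 + (1-z^2)/(3*Z)*(3*γ*Z*((α+β)/2))^2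
      + (1-z^2)/(3*Z)*(-(3*γ*Z*(β-α/2)))^2 + (1-z^2)/(3*Z)*(-(3*γ*Z*(α-β/2)))^2)
      = (9/4)*Z*(α^2-α*β+β^2)*(b*(1+3*z^2)*(1-z^2) - 4*z^2) := by
      rw [hγ]; field_simp; ring
    rw [this]
    exact mul_neg_of_pos_of_neg (by positivity) (by linarith)

lemma am_le {t ψ : ℝ} (ht : t < 1) (hψ : 0 < ψ) (lam om d : ℝ) :
    2*lam*(om*d) - lam^2*(om^2*ψ/(1-t)) ≤ (1-t)/ψ*d^2 := by
  have h1 : 0 < 1 - t := by linarith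
  have : 0 ≤ ((1-t)*d - lam*om*ψ)^2/((1-t)*ψ) := by positivity
  have e : ((1-t)*d - lam*om*ψ)^2/((1-t)*ψ) = (1-t)/ψ*d^2 - (2*lam*(om*d) - lam^2*(om^2*ψ/(1-t))) := by
    field_simp; ring
  linarith

lemma iso_fin {b N K S P : ℝ} (hb : 0 < b) (hN : 0 < N) (hK : K ≤ 2*b*N)
    (hP : ∀ lam : ℝ, 2*lam*S - lam^2*K ≤ P) : S^2/N ≤ 2*b*P := by
  have h := hP (S/(2*b*N))
  have h2 : (S/(2*b*N))^2*K ≤ (S/(2*b*N))^2*(2*b*N) := mul_le_mul_of_nonneg_left hK (by positivity)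
  have e : 2*(S/(2*b*N))*S - (S/(2*b*N))^2*(2*b*N) = S^2/N/(2*b) := by field_simp; ring
  have h3 : S^2/N/(2*b) ≤ P := by linarith
  rw [div_le_iff₀ (by positivity)] at h3
  linarith

noncomputable def crL (e : ℂ) (δ : Fin 4 → ℝ) : E4 →ₗ[ℝ] ℝ where
  toFun v := e.re * (SD δ v).im - e.im * (SD δ v).re
  map_add' x y := by rw [map_add, Complex.add_re, Complex.add_im]; ring
  map_smul' c x := by rw [map_smul, Complex.smul_re, Complex.smul_im]; simp; ring

noncomputable def lnM (x : E4) : ℝ →ₗ[ℝ] E4 where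
  toFun t := t • x
  map_add' s t := add_smul s t x
  map_smul' c t := by simp [mul_smul]

lemma iso_idx {a b : ℝ} (ha : 0 < a) (hab : a*b = 1) (hb : 3/2 ≤ b) {q : E4} {r w : ℝ} (hI : PIso a r w)
    (h : WR a q (viso r w)) : HIdx (Hs b q) 1 := by
  obtain ⟨hr, hw, hI⟩ := hI
  obtain ⟨κ, hκ, hsad⟩ := iso_saddle ha hab hb hr hI
  have hlow := iso_low ha hab hr hI
  obtain ⟨hr0, hu0, hu1, hru, hI1, hI2⟩ := hI
  have s01 := h.hs 0 1 (by decide)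
  have s02 := h.hs 0 2 (by decide)
  have s03 := h.hs 0 3 (by decide)
  have s12 := h.hs 1 2 (by decide)
  have s13 := h.hs 1 3 (by decide)
  have s23 := h.hs 2 3 (by decide)
  have t01 : viso r w 0 * viso r w 1 = -((2+r)*w^2) := by simp [viso]; ring
  have t02 : viso r w 0 * viso r w 2 = -((2+r)*w^2) := by simp [viso]; ring
  have t03 : viso r w 0 * viso r w 3 = -(r*((2+r)*w^2)) := by simp [viso]; ring
  have t12 : viso r w 1 * viso r w 2 = w^2 := by simp [viso]; ring
  have t13 : viso r w 1 * viso r w 3 = r*w^2 := by simp [viso]; ring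
  have t23 : viso r w 2 * viso r w 3 = r*w^2 := by simp [viso]; ring
  have p1 : 0 < (2+r)*w^2 := by positivity
  have p2 : 0 < r*((2+r)*w^2) := by positivity
  have hX : 0 < ps a (w^2) := ps_pos hu1
  have hY : 0 < ps a (r*w^2) := ps_pos hru
  have hZ : 0 < ps a (-((2+r)*w^2)) := ps_pos (by linarith)
  have hW : 0 < ps a (-(r*((2+r)*w^2))) := ps_pos (by linarith)
  have hPP : ∀ v, PP a q (viso r w) v =
      (1 - -((2+r)*w^2))/ps a (-((2+r)*w^2))*dt (q 0 - q 1) (v 0 - v 1)^2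
      + (1 - -((2+r)*w^2))/ps a (-((2+r)*w^2))*dt (q 0 - q 2) (v 0 - v 2)^2
      + (1 - -(r*((2+r)*w^2)))/ps a (-(r*((2+r)*w^2)))*dt (q 0 - q 3) (v 0 - v 3)^2
      + (1 - w^2)/ps a (w^2)*dt (q 1 - q 2) (v 1 - v 2)^2
      + (1 - r*w^2)/ps a (r*w^2)*dt (q 1 - q 3) (v 1 - v 3)^2
      + (1 - r*w^2)/ps a (r*w^2)*dt (q 2 - q 3) (v 2 - v 3)^2 := by
    intro v
    simp only [PP, gt', t01, t02, t03, t12, t13, t23]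
  rw [t01] at s01
  rw [t02] at s02
  rw [t03] at s03
  rw [t12] at s12
  rw [t13] at s13
  rw [t23] at s23
  obtain ⟨Qa, hQa⟩ : ∃ Q, Q = ps a (-((2+r)*w^2))/(1+(2+r)*w^2) := ⟨_, rfl⟩
  obtain ⟨Pa, hPa⟩ : ∃ Q, Q = ps a (r*w^2)/(1-r*w^2) := ⟨_, rfl⟩
  have hQ0 : 0 < Qa := by rw [hQa]; positivity
  have hP0 : 0 < Pa := by rw [hPa]; exact div_pos hY (by linarith)
  have hlow' : b*ps a (w^2) < w^2*(r^2*Pa + (2+r)^2*Qa) := by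
    rw [hPa, hQa, ← mul_div_assoc, ← mul_div_assoc]; exact hlow
  refine h.idx hab (F := ℝ) (G := ℝ) (by simp) (by simp)
    (crL (-((2-κ:ℝ):ℂ)*q 0 + q 1 + q 2 - (κ:ℂ)*q 3) (viso r w)) ?_
    (lnM ![-((2+r)*Qa:ℝ)*(q 1 - q 2), 0, 0, (r*Pa:ℝ)*(q 1 - q 2)]) ?_
  · intro v hv
    obtain ⟨e, he⟩ : ∃ e, e = -((2-κ:ℝ):ℂ)*q 0 + q 1 + q 2 - (κ:ℂ)*q 3 := ⟨_, rfl⟩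
    rw [← he] at hv
    have hN : Complex.normSq e = (κ+r)^2*ps a (-(r*((2+r)*w^2))) := by
      have : Complex.normSq e = 2*(2-κ)*((dsq q 0 1 + dsq q 0 2)/2) - κ*(2-κ)*dsq q 0 3 - dsq q 1 2 + κ*(dsq q 1 3 + dsq q 2 3) := by
        rw [he]; simp [dsq, Complex.normSq_apply]; ring
      rw [this, s01, s02, s03, s12, s13, s23]
      linear_combination 2*κ*hI1 - hI2
    have hS : dt e (SD (viso r w) v) = -(
        (-(4+r-κ)*w)*dt (q 0 - q 1) (v 0 - v 1) + (-(4+r-κ)*w)*dt (q 0 - q 2) (v 0 - v 2)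
        + (2*(κ*(1+r)-r)*w)*dt (q 0 - q 3) (v 0 - v 3) + (2*w)*dt (q 1 - q 2) (v 1 - v 2)
        + ((r-κ)*w)*dt (q 1 - q 3) (v 1 - v 3) + ((r-κ)*w)*dt (q 2 - q 3) (v 2 - v 3)) := by
      have hre := congrArg Complex.re h.hδq
      have him := congrArg Complex.im h.hδq
      simp [Fin.sum_univ_four, viso] at hre him
      rw [SD_apply, he]
      simp [dt, viso]
      linear_combination -(-(2-κ)*(v 0).re + (v 1).re + (v 2).re - κ*(v 3).re)*hre - (-(2-κ)*(v 0).im + (v 1).im + (v 2).im - κ*(v 3).im)*him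
    have hN0 : 0 < Complex.normSq e := by rw [hN]; positivity
    have hdec : Complex.normSq (SD (viso r w) v) = (-dt e (SD (viso r w) v))^2/Complex.normSq e := by
      rw [eq_div_iff hN0.ne']
      have hv' : e.re * (SD (viso r w) v).im - e.im * (SD (viso r w) v).re = 0 := hv
      simp only [dt, Complex.normSq_apply]
      linear_combination (e.re * (SD (viso r w) v).im - e.im * (SD (viso r w) v).re) * hv'
    have := iso_fin (b := b) (S := -dt e (SD (viso r w) v)) (K := 2*(w^2*(2*ps a (w^2)/(1-w^2) + (r-κ)^2*ps a (r*w^2)/(1-r*w^2)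
        + (4+r-κ)^2*ps a (-((2+r)*w^2))/(1+(2+r)*w^2) + 2*(κ*(1+r)-r)^2*ps a (-(r*((2+r)*w^2)))/(1+r*((2+r)*w^2)))))
      (P := PP a q (viso r w) v) (by linarith) hN0 (by rw [hN]; linarith) (by
        intro lam
        rw [hPP, hS]
        have a1 := am_le (t := -((2+r)*w^2)) (by linarith) hZ lam (-(4+r-κ)*w) (dt (q 0 - q 1) (v 0 - v 1))
        have a2 := am_le (t := -((2+r)*w^2)) (by linarith) hZ lam (-(4+r-κ)*w) (dt (q 0 - q 2) (v 0 - v 2))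
        have a3 := am_le (t := -(r*((2+r)*w^2))) (by linarith) hW lam (2*(κ*(1+r)-r)*w) (dt (q 0 - q 3) (v 0 - v 3))
        have a4 := am_le hu1 hX lam (2*w) (dt (q 1 - q 2) (v 1 - v 2))
        have a5 := am_le hru hY lam ((r-κ)*w) (dt (q 1 - q 3) (v 1 - v 3))
        have a6 := am_le hru hY lam ((r-κ)*w) (dt (q 2 - q 3) (v 2 - v 3))
        have b1 := add_le_add (add_le_add (add_le_add (add_le_add (add_le_add a1 a2) a3) a4) a5) a6
        refine le_trans (le_of_eq ?_) b1
        clear a1 a2 a3 a4 a5 a6 b1 hS hdec hlow hlow' hsad hPP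
        generalize dt (q 0 - q 1) (v 0 - v 1) = d1
        generalize dt (q 0 - q 2) (v 0 - v 2) = d2
        generalize dt (q 0 - q 3) (v 0 - v 3) = d3
        generalize dt (q 1 - q 2) (v 1 - v 2) = d4
        generalize dt (q 1 - q 3) (v 1 - v 3) = d5
        generalize dt (q 2 - q 3) (v 2 - v 3) = d6
        rw [sub_neg_eq_add, sub_neg_eq_add]
        ring)
    unfold Hc
    rw [hdec]; linarith
  · intro t ht
    obtain ⟨v, hv⟩ : ∃ v, v = lnM ![-((2+r)*Qa:ℝ)*(q 1 - q 2), 0, 0, (r*Pa:ℝ)*(q 1 - q 2)] t := ⟨_, rfl⟩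
    have v0 : v 0 = ((-(t*((2+r)*Qa)):ℝ):ℂ)*(q 1 - q 2) := by rw [hv]; simp [lnM]; ring
    have v1 : v 1 = 0 := by rw [hv]; simp [lnM]
    have v2 : v 2 = 0 := by rw [hv]; simp [lnM]
    have v3 : v 3 = ((t*(r*Pa):ℝ):ℂ)*(q 1 - q 2) := by rw [hv]; simp [lnM]; ring
    rw [← hv]
    unfold Hc
    have dtm : ∀ (c : ℝ) (x y : ℂ), dt x ((c:ℂ)*y) = c*dt x y := by intro c x y; simp [dt]; ring
    have dd : ∀ k, dsq q k k = 0 := by intro k; simp [dsq]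
    have hSD : SD (viso r w) v = ((t*w*(r^2*Pa + (2+r)^2*Qa):ℝ):ℂ)*(q 1 - q 2) := by
      rw [SD_apply, v0, v1, v2, v3]; simp [viso]; ring
    have d01 : dt (q 0 - q 1) (v 0 - v 1) = t*((2+r)*Qa)*ps a (w^2)/2 := by
      rw [v0, v1, sub_zero, dtm, dt_dsq, dd, s01, s02, s12]; ring
    have d02 : dt (q 0 - q 2) (v 0 - v 2) = -(t*((2+r)*Qa)*ps a (w^2)/2) := by
      rw [v0, v2, sub_zero, dtm, dt_dsq, dd, dsq_comm q 2 1, s01, s02, s12]; ring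
    have d03 : dt (q 0 - q 3) (v 0 - v 3) = 0 := by
      rw [v0, v3, ← sub_mul, ← Complex.ofReal_sub, dtm, dt_dsq, dsq_comm q 3 1, dsq_comm q 3 2, s01, s02, s13, s23]; ring
    have d12 : dt (q 1 - q 2) (v 1 - v 2) = 0 := by rw [v1, v2]; simp [dt]
    have neg' : ∀ y : ℂ, (0:ℂ) - ((t*(r*Pa):ℝ):ℂ)*y = ((-(t*(r*Pa)):ℝ):ℂ)*y := by intro y; push_cast; ring
    have d13 : dt (q 1 - q 3) (v 1 - v 3) = -(t*(r*Pa)*ps a (w^2)/2) := by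
      rw [v1, v3, neg', dtm, dt_dsq, dd, dsq_comm q 3 1, dsq_comm q 3 2, s13, s23, s12]; ring
    have d23 : dt (q 2 - q 3) (v 2 - v 3) = t*(r*Pa)*ps a (w^2)/2 := by
      rw [v2, v3, neg', dtm, dt_dsq, dd, dsq_comm q 3 1, dsq_comm q 3 2, dsq_comm q 2 1, s13, s23, s12]; ring
    have n12 : Complex.normSq (q 1 - q 2) = ps a (w^2) := s12
    rw [hPP, hSD, d01, d02, d03, d12, d13, d23, Complex.normSq_mul, n12, Complex.normSq_ofReal]
    have eZ : (1 - -((2+r)*w^2))/ps a (-((2+r)*w^2)) = 1/Qa := by rw [hQa, one_div_div, sub_neg_eq_add]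
    have eY : (1 - r*w^2)/ps a (r*w^2) = 1/Pa := by rw [hPa, one_div_div]
    rw [eZ, eY]
    generalize ps a (w^2) = X at *
    clear hsad hPP hQa hPa eZ eY hlow
    have : -(t*w*(r^2*Pa+(2+r)^2*Qa)*(t*w*(r^2*Pa+(2+r)^2*Qa))*X) + 2*b*(1/Qa*(t*((2+r)*Qa)*X/2)^2 + 1/Qa*(-(t*((2+r)*Qa)*X/2))^2
       + (1 - -(r*((2+r)*w^2)))/ps a (-(r*((2+r)*w^2)))*0^2 + (1-w^2)/X*0^2 + 1/Pa*(-(t*(r*Pa)*X/2))^2 + 1/Pa*(t*(r*Pa)*X/2)^2)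
       = (t^2*X*(r^2*Pa+(2+r)^2*Qa))*(b*X - w^2*(r^2*Pa+(2+r)^2*Qa)) := by
      have e1 : 1/Qa*(t*((2+r)*Qa)*X/2)^2 = t^2*(2+r)^2*Qa*X^2/4 := by field_simp; ring
      have e2 : 1/Pa*(t*(r*Pa)*X/2)^2 = t^2*r^2*Pa*X^2/4 := by field_simp; ring
      rw [neg_sq, neg_sq, e1, e2]; ring
    rw [this]
    exact mul_neg_of_pos_of_neg (by positivity) (by linarith)

noncomputable def ph (b d : ℝ) : ℝ := (d^2)^(-b)*d

def RC (b : ℝ) (x : Fin 4 → ℝ) : Prop := (∀ k l, k ≠ l → x k ≠ x l) ∧ ∀ k, ∑ l, ph b (x k - x l) = 4*x k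

lemma ph_neg (b d : ℝ) : ph b (-d) = -ph b d := by simp [ph]

lemma ph_mul (b c d : ℝ) : ph b (c*d) = (c^2)^(-b)*c*ph b d := by
  rw [ph, ph, mul_pow, Real.mul_rpow (sq_nonneg c) (sq_nonneg d)]; ring

lemma ph_pos {b d : ℝ} (hd : 0 < d) : 0 < ph b d := by unfold ph; positivity

lemma ph_pow {b d : ℝ} (hd : 0 < d) : ph b d = d^(1-2*b) := by
  rw [ph, ← Real.rpow_natCast, ← Real.rpow_mul hd.le, ← Real.rpow_add_one hd.ne']
  congr 1; push_cast; ring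

lemma ph_anti {b x y : ℝ} (hb : 3/2 ≤ b) (hx : 0 < x) (hxy : x < y) : ph b y < ph b x := by
  rw [ph_pow hx, ph_pow (hx.trans hxy)]
  exact Real.rpow_lt_rpow_of_neg hx hxy (by linarith)

lemma ph_diff {b x y : ℝ} (hb : 3/2 ≤ b) (hx : 0 < x) (hy : 0 < y) : (ph b x - ph b y)*(x-y) ≤ 0 := by
  rcases lt_trichotomy x y with h | h | h
  · exact mul_nonpos_of_nonneg_of_nonpos (by linarith [ph_anti hb hx h]) (by linarith)
  · simp [h]
  · exact mul_nonpos_of_nonpos_of_nonneg (by linarith [ph_anti hb hy h]) (by linarith)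

lemma coll_cc {b : ℝ} {u : ℂ} (hu : ‖u‖ = 1) (x : Fin 4 → ℝ) : IsCC b (fun k => u * x k) ↔ RC b x := by
  have hu0 : u ≠ 0 := by intro h; simp [h] at hu
  have e1 : ∀ k l, dsq (fun k => u * x k) k l = (x k - x l)^2 := by
    intro k l
    rw [dsq, ← mul_sub, Complex.normSq_mul, Complex.normSq_eq_norm_sq u, hu, ← Complex.ofReal_sub, Complex.normSq_ofReal]; ring
  unfold IsCC RC Dist4
  refine and_congr ?_ (forall_congr' fun k => ?_)
  · simp [hu0]
  · have e2 : ∑ l, (((dsq (fun k => u * x k) k l)^(-b):ℝ):ℂ)*(u*x k - u*x l) = u*((∑ l, ph b (x k - x l) : ℝ):ℂ) := by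
      rw [Complex.ofReal_sum, mul_sum]
      refine sum_congr rfl fun l _ => ?_
      rw [e1, ph]; push_cast; ring
    have e3 : 4*(u*(x k:ℂ)) = u*((4*x k:ℝ):ℂ) := by push_cast; ring
    rw [e2, e3, mul_right_inj' hu0, Complex.ofReal_inj]

lemma rc4 {b : ℝ} (y : Fin 4 → ℝ) : (∀ k, ∑ l, ph b (y k - y l) = 4*y k) ↔
    (-ph b (y 1 - y 0) - ph b (y 2 - y 0) - ph b (y 3 - y 0) = 4*y 0 ∧
    ph b (y 1 - y 0) - ph b (y 2 - y 1) - ph b (y 3 - y 1) = 4*y 1 ∧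
    ph b (y 2 - y 0) + ph b (y 2 - y 1) - ph b (y 3 - y 2) = 4*y 2 ∧
    ph b (y 3 - y 0) + ph b (y 3 - y 1) + ph b (y 3 - y 2) = 4*y 3) := by
  have e : ∀ k l, ph b (y k - y l) = -ph b (y l - y k) := by intro k l; rw [← ph_neg, neg_sub]
  have e0 : ph b 0 = 0 := by simp [ph]
  have e00 := e 0 1
  have e01 := e 0 2
  have e02 := e 0 3
  have e03 := e 1 2
  have e04 := e 1 3
  have e05 := e 2 3
  simp only [Fin.sum_univ_four]
  constructor
  · intro h
    have h0 := h 0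
    have h1 := h 1
    have h2 := h 2
    have h3 := h 3
    simp only [sub_self, e0] at h0 h1 h2 h3
    refine ⟨?_, ?_, ?_, ?_⟩ <;> linarith
  · rintro ⟨h1, h2, h3, h4⟩
    refine fin4_all ?_ ?_ ?_ ?_ <;> simp only [sub_self, e0] <;> linarith

lemma rc_uniq {b : ℝ} (hb : 3/2 ≤ b) {y z : Fin 4 → ℝ} (hy : RC b y) (hz : RC b z) (my : StrictMono y) (mz : StrictMono z) : y = z := by
  obtain ⟨y0, y1, y2, y3⟩ := (rc4 y).1 hy.2
  obtain ⟨z0, z1, z2, z3⟩ := (rc4 z).1 hz.2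
  have d : ∀ k l : Fin 4, k < l → (ph b (y l - y k) - ph b (z l - z k))*((y l - y k) - (z l - z k)) ≤ 0 :=
    fun k l h => ph_diff hb (sub_pos.2 (my h)) (sub_pos.2 (mz h))
  have d01 := d 0 1 (by decide)
  have d02 := d 0 2 (by decide)
  have d03 := d 0 3 (by decide)
  have d12 := d 1 2 (by decide)
  have d13 := d 1 3 (by decide)
  have d23 := d 2 3 (by decide)
  have key : 4*((y 0 - z 0)^2 + (y 1 - z 1)^2 + (y 2 - z 2)^2 + (y 3 - z 3)^2) ≤ 0 := by
    refine le_trans (le_of_eq ?_) (add_nonpos (add_nonpos (add_nonpos (add_nonpos (add_nonpos d01 d02) d03) d12) d13) d23)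
    linear_combination (z 0 - y 0)*(y0 - z0) + (z 1 - y 1)*(y1 - z1) + (z 2 - y 2)*(y2 - z2) + (z 3 - y 3)*(y3 - z3)
  have := sq_nonneg (y 0 - z 0)
  have := sq_nonneg (y 1 - z 1)
  have := sq_nonneg (y 2 - z 2)
  have := sq_nonneg (y 3 - z 3)
  funext k; revert k
  refine fin4_all ?_ ?_ ?_ ?_ <;> exact sub_eq_zero.1 (pow_eq_zero_iff (two_ne_zero)|>.1 (by linarith))

def vcol (α β : ℝ) : Fin 4 → ℝ := ![-β, -α, α, β]

lemma rcol {b α β : ℝ} (h0 : 0 < α) (h1 : α < β) : RC b (vcol α β) ↔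
    (ph b (β-α) + ph b (β+α) + ph b (2*β) = 4*β ∧ -ph b (β-α) + ph b (β+α) + ph b (2*α) = 4*α) := by
  have hd : ∀ k l, k ≠ l → vcol α β k ≠ vcol α β l := by
    refine fin4_all ?_ ?_ ?_ ?_ <;> refine fin4_all ?_ ?_ ?_ ?_ <;> intro hk <;> first | exact absurd rfl hk | skip
    all_goals
      simp only [vcol, Matrix.cons_val]
      intro h; linarith
  rw [RC, rc4, and_iff_right hd]
  have e1 : -α - -β = β - α := by ring
  have e2 : α - -β = β + α := by ring
  have e3 : β - -β = 2*β := by ring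
  have e4 : α - -α = 2*α := by ring
  have e5 : β - -α = β + α := by ring
  simp only [vcol, Matrix.cons_val, e1, e2, e3, e4, e5]
  constructor
  · rintro ⟨h1, h2, h3, h4⟩; constructor <;> linarith
  · rintro ⟨h1, h2⟩; refine ⟨?_, ?_, ?_, ?_⟩ <;> linarith

lemma ph_cont (b : ℝ) {g : ℝ → ℝ} {s : Set ℝ} (hg : ContinuousOn g s) (h0 : ∀ t ∈ s, 0 < g t) : ContinuousOn (fun t => ph b (g t)) s := by
  unfold ph
  refine ContinuousOn.mul (ContinuousOn.rpow_const (hg.pow 2) fun t ht => Or.inl ?_) hg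
  have := h0 t ht
  positivity

lemma rc_exists {b : ℝ} (hb : 3/2 ≤ b) : ∃ α β, 0 < α ∧ α < β ∧ RC b (vcol α β) := by
  obtain ⟨τ, ⟨hτ0, hτ1⟩, hτ⟩ : ∃ τ ∈ Set.Icc (1/4:ℝ) (1/3), τ*(ph b (1-τ) + ph b (1+τ) + ph b 2) - (-ph b (1-τ) + ph b (1+τ) + ph b (2*τ)) = 0 := by
    refine intermediate_value_Icc (by norm_num) (f := fun τ => τ*(ph b (1-τ) + ph b (1+τ) + ph b 2) - (-ph b (1-τ) + ph b (1+τ) + ph b (2*τ))) ?_ ⟨?_, ?_⟩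
    · have c1 : ContinuousOn (fun τ => ph b (1-τ)) (Set.Icc (1/4:ℝ) (1/3)) := ph_cont b (by fun_prop) (fun t ht => by linarith [ht.2])
      have c2 : ContinuousOn (fun τ => ph b (1+τ)) (Set.Icc (1/4:ℝ) (1/3)) := ph_cont b (by fun_prop) (fun t ht => by linarith [ht.1])
      have c3 : ContinuousOn (fun τ => ph b (2*τ)) (Set.Icc (1/4:ℝ) (1/3)) := ph_cont b (by fun_prop) (fun t ht => by linarith [ht.1])
      exact (continuousOn_id.mul ((c1.add c2).add continuousOn_const)).sub ((c1.neg.add c2).add c3)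
    · have h1 : ph b (1 - 1/4) ≤ 4/9*ph b (1/2) := by
        have e : (1 - 1/4 : ℝ) = (3/2)*(1/2) := by norm_num
        rw [e, ph_mul]
        apply mul_le_mul_of_nonneg_right _ (ph_pos (by norm_num)).le
        have h2 : ((3/2:ℝ)^2)^(-b) ≤ ((3/2:ℝ)^2)^(-(3/2:ℝ)) := Real.rpow_le_rpow_of_exponent_le (by norm_num) (by linarith)
        have h3 : ((3/2:ℝ)^2)^(-(3/2:ℝ)) = 8/27 := by
          rw [← Real.rpow_natCast, ← Real.rpow_mul (by norm_num)]; norm_num [Real.rpow_neg]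
        linarith
      have h2 : ph b 2 < ph b (1+1/4) := ph_anti hb (by norm_num) (by norm_num)
      have h3 := ph_pos (b := b) (d := 1/2) (by norm_num)
      have h4 := ph_pos (b := b) (d := 1+1/4) (by norm_num)
      have e : (2*(1/4):ℝ) = 1/2 := by norm_num
      simp only [e]
      linarith
    · have e1 : (1 - 1/3:ℝ) = 2/3 := by norm_num
      have e2 : (1 + 1/3:ℝ) = 2*(2/3) := by norm_num
      have e3 : (2*(1/3):ℝ) = 2/3 := by norm_num
      have h1 : ph b (2*(2/3)) ≤ 1/4*ph b (2/3) := by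
        rw [ph_mul]
        apply mul_le_mul_of_nonneg_right _ (ph_pos (by norm_num)).le
        have h2 : ((2:ℝ)^2)^(-b) ≤ ((2:ℝ)^2)^(-(3/2:ℝ)) := Real.rpow_le_rpow_of_exponent_le (by norm_num) (by linarith)
        have h3 : ((2:ℝ)^2)^(-(3/2:ℝ)) = 1/8 := by
          rw [← Real.rpow_natCast, ← Real.rpow_mul (by norm_num)]; norm_num [Real.rpow_neg]
        linarith
      have h3 := ph_pos (b := b) (d := 2/3) (by norm_num)
      have h4 := ph_pos (b := b) (d := 2) (by norm_num)
      simp only [e1, e2, e3]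
      linarith
  obtain ⟨C, hC⟩ : ∃ C, C = ph b (1-τ) + ph b (1+τ) + ph b 2 := ⟨_, rfl⟩
  have hC0 : 0 < C := by
    rw [hC]
    exact add_pos (add_pos (ph_pos (by linarith)) (ph_pos (by linarith))) (ph_pos (by norm_num))
  obtain ⟨β, hβ⟩ : ∃ β, β = Real.sqrt ((C/4)^(1/b)) := ⟨_, rfl⟩
  have hβ0 : 0 < β := by rw [hβ]; positivity
  have hβb : (β^2)^(-b)*C = 4 := by
    rw [hβ, Real.sq_sqrt (by positivity), ← Real.rpow_mul (by positivity)]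
    have : 1/b*(-b) = -1 := by field_simp
    rw [this, Real.rpow_neg_one]; field_simp
  refine ⟨β*τ, β, by positivity, by nlinarith, ?_⟩
  rw [rcol (by positivity) (by nlinarith)]
  have e1 : β - β*τ = β*(1-τ) := by ring
  have e2 : β + β*τ = β*(1+τ) := by ring
  have e3 : 2*(β*τ) = β*(2*τ) := by ring
  rw [e1, e2, e3, mul_comm 2 β, ph_mul b β, ph_mul b β, ph_mul b β, ph_mul b β]
  rw [← hC] at hτ
  constructor
  · linear_combination β*hβb - (β^2)^(-b)*β*hC
  · linear_combination (β*τ)*hβb - (β^2)^(-b)*β*hτ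

lemma hs_unit (b : ℝ) {u : ℂ} (hu : ‖u‖ = 1) (q v : E4) : Hs b (fun k => u * q k) (fun k => u * v k) = Hs b q v := by
  have hn := normSq_unit hu
  have e1 : ∀ z, Complex.normSq (u*z) = Complex.normSq z := by intro z; rw [Complex.normSq_mul, hn, one_mul]
  have e2 : ∀ w z, dt (u*w) (u*z) = dt w z := by
    intro w z
    rw [Complex.normSq_apply] at hn
    simp only [dt, Complex.mul_re, Complex.mul_im]
    linear_combination (w.re*z.re+w.im*z.im)*hn
  unfold Hs
  simp only [dsq_rot hu, ← mul_sub, e1, e2]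

lemma HIdx.unit {b : ℝ} {u : ℂ} (hu : ‖u‖ = 1) {q : E4} {n : ℕ} (h : HIdx (Hs b q) n) : HIdx (Hs b (fun k => u * q k)) n := by
  have hu0 : u ≠ 0 := by intro h; simp [h] at hu
  refine HIdx.equiv (H' := Hs b q)
    { toFun := fun v k => u⁻¹ * v k
      invFun := fun v k => u * v k
      map_add' := fun x y => by funext k; simp [mul_add]
      map_smul' := fun c x => by funext k; simp; ring
      left_inv := fun v => by funext k; simp [hu0]
      right_inv := fun v => by funext k; simp [hu0] } (fun v => ?_) h
  change Hs b q (fun k => u⁻¹ * v k) = _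
  rw [← hs_unit b hu]
  congr 1
  funext k
  rw [mul_inv_cancel_left₀ hu0]

/-- transverse form -/
lemma hs_col (b : ℝ) {α β : ℝ} (h0 : 0 < α) (h1 : α < β) (v : E4) :
    Hs b (fun k => (vcol α β k : ℂ)) v =
    (4*((v 0).re^2 + (v 1).re^2 + (v 2).re^2 + (v 3).re^2) + (2*b-1)*(
      ((β-α)^2)^(-b)*(((v 3).re-(v 2).re)^2+((v 1).re-(v 0).re)^2) + ((β+α)^2)^(-b)*(((v 3).re-(v 1).re)^2+((v 2).re-(v 0).re)^2)
      + ((2*β)^2)^(-b)*((v 3).re-(v 0).re)^2 + ((2*α)^2)^(-b)*((v 2).re-(v 1).re)^2))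
    + (4*((v 0).im^2 + (v 1).im^2 + (v 2).im^2 + (v 3).im^2) - (
      ((β-α)^2)^(-b)*(((v 3).im-(v 2).im)^2+((v 1).im-(v 0).im)^2) + ((β+α)^2)^(-b)*(((v 3).im-(v 1).im)^2+((v 2).im-(v 0).im)^2)
      + ((2*β)^2)^(-b)*((v 3).im-(v 0).im)^2 + ((2*α)^2)^(-b)*((v 2).im-(v 1).im)^2)) := by
  have key : ∀ k l : Fin 4, ∀ d : ℝ, (vcol α β k - vcol α β l)^2 = d^2 → d ≠ 0 → dsq (fun k => (vcol α β k : ℂ)) k l ^ (-b) * Complex.normSq (v k - v l)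
      - 2*b*(dsq (fun k => (vcol α β k : ℂ)) k l ^ (-b) / dsq (fun k => (vcol α β k : ℂ)) k l) * dt ((vcol α β k : ℂ) - vcol α β l) (v k - v l) ^ 2
      = (d^2)^(-b)*(((v k).im - (v l).im)^2 - (2*b-1)*((v k).re - (v l).re)^2) := by
    intro k l d hd hd0
    have e1 : dsq (fun k => (vcol α β k : ℂ)) k l = d^2 := by
      rw [dsq, ← Complex.ofReal_sub, Complex.normSq_ofReal, ← hd]; ring
    have e2 : dt ((vcol α β k : ℂ) - vcol α β l) (v k - v l) ^ 2 = d^2*((v k).re - (v l).re)^2 := by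
      rw [← Complex.ofReal_sub, ← hd]; simp [dt]; ring
    rw [e1, e2, Complex.normSq_apply, Complex.sub_re, Complex.sub_im]
    have : d^2 ≠ 0 := pow_ne_zero 2 hd0
    field_simp; ring
  have kd : ∀ k : Fin 4, dsq (fun k => (vcol α β k : ℂ)) k k ^ (-b) * Complex.normSq (v k - v k)
      - 2*b*(dsq (fun k => (vcol α β k : ℂ)) k k ^ (-b) / dsq (fun k => (vcol α β k : ℂ)) k k) * dt ((vcol α β k : ℂ) - vcol α β k) (v k - v k) ^ 2 = 0 := by
    intro k; simp [dt]
  have n1 : β - α ≠ 0 := by linarith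
  have n2 : β + α ≠ 0 := by linarith
  have n3 : 2*β ≠ 0 := by linarith
  have n4 : 2*α ≠ 0 := by linarith
  unfold Hs
  simp only [Fin.sum_univ_four, kd]
  rw [key 0 1 (β-α) (by simp [vcol]; ring) n1, key 1 0 (β-α) (by simp [vcol]; ring) n1,
    key 2 3 (β-α) (by simp [vcol]; ring) n1, key 3 2 (β-α) (by simp [vcol]) n1,
    key 0 2 (β+α) (by simp [vcol]; ring) n2, key 2 0 (β+α) (by simp [vcol]; ring) n2,
    key 1 3 (β+α) (by simp [vcol]; ring) n2, key 3 1 (β+α) (by simp [vcol]) n2,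
    key 0 3 (2*β) (by simp [vcol]; ring) n3, key 3 0 (2*β) (by simp [vcol]; ring) n3,
    key 1 2 (2*α) (by simp [vcol]; ring) n4, key 2 1 (2*α) (by simp [vcol]; ring) n4]
  simp only [Complex.normSq_apply]
  ring

lemma col_idx {b α β : ℝ} (hb : 3/2 ≤ b) (h0 : 0 < α) (h1 : α < β) (hr : RC b (vcol α β)) :
    HIdx (Hs b (fun k => (vcol α β k : ℂ))) 2 := by
  obtain ⟨r1, r2⟩ := (rcol h0 h1).1 hr
  have hIo := ph_anti hb (show 0 < 2*α by linarith) (show 2*α < 2*β by linarith)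
  have hDS := ph_anti hb (show 0 < β-α by linarith) (show β-α < β+α by linarith)
  have hDS : ((β+α)^2)^(-b) < ((β-α)^2)^(-b) := by
    rw [← Real.rpow_natCast, ← Real.rpow_natCast, ← Real.rpow_mul (by linarith), ← Real.rpow_mul (by linarith)]
    exact Real.rpow_lt_rpow_of_neg (by linarith) (by linarith) (by push_cast; linarith)
  have hHs := fun v => hs_col b h0 h1 v
  unfold ph at r1 r2 hIo
  have hD0 : 0 < ((β-α)^2)^(-b) := Real.rpow_pos_of_pos (pow_pos (by linarith) 2) _
  have hS0 : 0 < ((β+α)^2)^(-b) := Real.rpow_pos_of_pos (pow_pos (by linarith) 2) _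
  have hO0 : 0 < ((2*β)^2)^(-b) := Real.rpow_pos_of_pos (pow_pos (by linarith) 2) _
  have hI0 : 0 < ((2*α)^2)^(-b) := Real.rpow_pos_of_pos (pow_pos (by linarith) 2) _
  generalize ((β-α)^2)^(-b) = D at *
  generalize ((β+α)^2)^(-b) = S at *
  generalize ((2*β)^2)^(-b) = O at *
  generalize ((2*α)^2)^(-b) = I at *
  have hD2 : 2 < D := by
    by_contra hc
    push Not at hc
    have := mul_nonneg (sub_nonneg.2 hc) (show 0 ≤ β - α by linarith)
    linarith
  have hβ : 0 < β := by linarith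
  let L : E4 →ₗ[ℝ] (Fin 2 → ℝ) :=
    { toFun := fun v => ![(v 0).im - (v 1).im - (v 2).im + (v 3).im, α*((v 3).im - (v 0).im) - β*((v 2).im - (v 1).im)]
      map_add' := fun x y => by
        funext i; fin_cases i <;> simp <;> ring
      map_smul' := fun c x => by
        funext i; fin_cases i <;> simp <;> ring }
  let M : (Fin 2 → ℝ) →ₗ[ℝ] E4 :=
    { toFun := fun p => ![⟨0, p 0 - p 1⟩, ⟨0, -p 0⟩, ⟨0, -p 0⟩, ⟨0, p 0 + p 1⟩]
      map_add' := fun x y => by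
        funext k; revert k; refine fin4_all ?_ ?_ ?_ ?_ <;> apply Complex.ext <;> simp <;> ring
      map_smul' := fun c x => by
        funext k; revert k; refine fin4_all ?_ ?_ ?_ ?_ <;> apply Complex.ext <;> simp <;> ring }
  constructor
  · have := hidx_lower (Hs_zero b (fun k => (vcol α β k : ℂ))) M (fun p hp => ?_)
    · simpa using this
    · rw [hHs]
      simp only [M, LinearMap.coe_mk, AddHom.coe_mk, Matrix.cons_val]
      obtain ⟨s, hs⟩ : ∃ s, s = p 0 := ⟨_, rfl⟩
      obtain ⟨t, ht⟩ : ∃ t, t = p 1 := ⟨_, rfl⟩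
      rw [← hs, ← ht]
      have hst : s ≠ 0 ∨ t ≠ 0 := by
        by_contra hc
        push Not at hc
        apply hp
        funext i
        fin_cases i
        · exact hs.symm.trans hc.1
        · exact ht.symm.trans hc.2
      refine neg_of_mul_neg_right (a := β) ?_ hβ.le
      refine lt_of_eq_of_lt (b := -(8*β*(D+S-2))*s^2 + (-(2*α*(D-S)))*t^2) ?_ ?_
      · linear_combination -2*t^2*r1
      · have p1 : 0 < 8*β*(D+S-2) := mul_pos (by linarith) (by linarith)
        have p2 : 0 < 2*α*(D-S) := mul_pos (by linarith) (by linarith)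
        rcases hst with h | h
        · have := mul_pos p1 (show 0 < s^2 by positivity)
          have := mul_nonneg p2.le (sq_nonneg t)
          linarith
        · have := mul_pos p2 (show 0 < t^2 by positivity)
          have := mul_nonneg p1.le (sq_nonneg s)
          linarith
  · intro V hV
    have := hidx_upper L (fun v hv => ?_) V hV
    · simpa using this
    · rw [hHs]
      have l1 := congrFun hv 0
      have l2 := congrFun hv 1
      simp only [L, LinearMap.coe_mk, AddHom.coe_mk, Matrix.cons_val, Pi.zero_apply] at l1 l2
      refine add_nonneg ?_ ?_
      · have : 0 ≤ 2*b-1 := by linarith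
        positivity
      · generalize (v 0).im = y0 at *
        generalize (v 1).im = y1 at *
        generalize (v 2).im = y2 at *
        generalize (v 3).im = y3 at *
        obtain ⟨c, hc⟩ : ∃ c, y3 - y0 = 2*β*c := ⟨(y3-y0)/(2*β), by field_simp⟩
        have hc2 : y2 - y1 = 2*α*c := by
          apply mul_left_cancel₀ hβ.ne'
          linear_combination α*hc - l2
        obtain ⟨p, hp⟩ : ∃ p, p = (y0+y3)/2 := ⟨_, rfl⟩
        have e3 : y3 = p + β*c := by linarith
        have e0 : y0 = p - β*c := by linarith
        have e2 : y2 = p + α*c := by linarith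
        have e1 : y1 = p - α*c := by linarith
        subst e3 e0 e2 e1
        refine le_of_le_of_eq (b := 16*p^2) (by positivity) ?_
        linear_combination 2*β*c^2*r1 + 2*α*c^2*r2

def UR (q q' : E4) : Prop := ∃ u : ℂ, ‖u‖ = 1 ∧ q' = fun k => u * q k

lemma orb_eq {q q' : E4} : rotOrbit 4 q = rotOrbit 4 q' ↔ UR q q' := by
  constructor
  · intro h
    have : q' ∈ rotOrbit 4 q' := ⟨1, by simp, by funext k; simp⟩
    rw [← h] at this
    exact this
  · rintro ⟨u, hu, rfl⟩
    have hu0 : u ≠ 0 := by intro h; simp [h] at hu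
    ext p
    constructor
    · rintro ⟨w, hw, rfl⟩
      refine ⟨w*u⁻¹, by simp [hu, hw], ?_⟩
      funext k; field_simp
    · rintro ⟨w, hw, rfl⟩
      refine ⟨w*u, by simp [hu, hw], ?_⟩
      funext k; ring

def Orb (P : E4 → Prop) : Set (Set E4) := {O | ∃ q, P q ∧ O = rotOrbit 4 q}

lemma orb_card {τ : Type*} (T : Set τ) (R : E4 → τ → Prop) (h2 : ∀ t ∈ T, ∃ q, R q t)
    (h3 : ∀ q q' t, R q t → R q' t → UR q q')
    (h4 : ∀ q q' t t', t ∈ T → t' ∈ T → R q t → R q' t' → UR q q' → t = t') :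
    (Orb fun q => ∃ t ∈ T, R q t).ncard = T.ncard := by
  have : ∀ t, ∃ q, t ∈ T → R q t := by
    intro t
    by_cases ht : t ∈ T
    · obtain ⟨q, hq⟩ := h2 t ht
      exact ⟨q, fun _ => hq⟩
    · exact ⟨0, fun h => absurd h ht⟩
  choose g hg using this
  have e : (Orb fun q => ∃ t ∈ T, R q t) = (fun t => rotOrbit 4 (g t)) '' T := by
    ext O
    constructor
    · rintro ⟨q, ⟨t, ht, hR⟩, rfl⟩
      exact ⟨t, ht, orb_eq.2 (h3 _ _ t (hg t ht) hR)⟩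
    · rintro ⟨t, ht, rfl⟩
      exact ⟨g t, ⟨t, ht, hg t ht⟩, rfl⟩
  rw [e]
  apply Set.ncard_image_of_injOn
  intro t ht t' ht' h
  exact h4 _ _ t t' ht ht' (hg t ht) (hg t' ht') (orb_eq.1 h)

lemma orb_or {P Q : E4 → Prop} (hP : (Orb P).Finite) (hQ : (Orb Q).Finite) (h : ∀ q q', P q → Q q' → UR q q' → False) :
    (Orb fun q => P q ∨ Q q).ncard = (Orb P).ncard + (Orb Q).ncard := by
  have e : (Orb fun q => P q ∨ Q q) = Orb P ∪ Orb Q := by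
    ext O
    constructor
    · rintro ⟨q, hq | hq, rfl⟩
      · exact Or.inl ⟨q, hq, rfl⟩
      · exact Or.inr ⟨q, hq, rfl⟩
    · rintro (⟨q, hq, rfl⟩ | ⟨q, hq, rfl⟩)
      · exact ⟨q, Or.inl hq, rfl⟩
      · exact ⟨q, Or.inr hq, rfl⟩
  rw [e]
  refine Set.ncard_union_eq ?_ hP hQ
  rw [Set.disjoint_left]
  rintro O ⟨q, hq, rfl⟩ ⟨q', hq', h'⟩
  exact h q q' hq hq' (orb_eq.1 h')

def TS (D : Fin 4 → ℝ) : Set (Fin 4 → ℝ) :=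
  {δ | ∃ (σ : Equiv.Perm (Fin 4)) (ε : ℝ), (ε = 1 ∨ ε = -1) ∧ δ = fun k => ε * D (σ k)}

lemma coll_perm {q : E4} (σ : Equiv.Perm (Fin 4)) (h : Coll (q ∘ σ)) : Coll q := by
  obtain ⟨u, hu, x, hx⟩ := h
  refine ⟨u, hu, x ∘ σ.symm, fun k => ?_⟩
  have := hx (σ.symm k)
  simpa using this

lemma ts_real {a : ℝ} {D : Fin 4 → ℝ} (h : ∃ q, WR a q D ∧ ¬ Coll q) : ∀ δ ∈ TS D, ∃ q, RelQ a q δ := by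
  obtain ⟨q, hq, hc⟩ := h
  rintro δ ⟨σ, ε, hε, rfl⟩
  have h1 := hq.perm σ
  have h2 : ¬ Coll (q ∘ σ) := fun h => hc (coll_perm σ h)
  rcases hε with rfl | rfl
  · obtain ⟨p, hp⟩ := h1.toRel h2
    refine ⟨p, ?_⟩
    convert hp using 1
    funext k; simp
  · obtain ⟨p, hp⟩ := h1.neg.toRel h2
    refine ⟨p, ?_⟩
    convert hp using 1
    funext k; simp

lemma ts_idx {a b : ℝ} {D : Fin 4 → ℝ} {n : ℕ} (h : ∀ q, WR a q D → HIdx (Hs b q) n) {q : E4} {δ} (hδ : δ ∈ TS D) (hq : RelQ a q δ) :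
    HIdx (Hs b q) n := by
  obtain ⟨σ, ε, hε, rfl⟩ := hδ
  apply HIdx.perm σ.symm
  apply h
  rcases hε with rfl | rfl
  · have := hq.1.perm σ.symm
    convert this using 1
    funext k; simp
  · have := (hq.1.perm σ.symm).neg
    convert this using 1
    funext k; simp

def PT (a : ℝ) (D : Fin 4 → ℝ) (q : E4) : Prop := ∃ δ ∈ TS D, RelQ a q δ

lemma pt_card {a : ℝ} (ha : 0 < a) {D : Fin 4 → ℝ} (h : ∃ q, WR a q D ∧ ¬ Coll q) : (Orb (PT a D)).ncard = (TS D).ncard := by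
  refine orb_card (TS D) (RelQ a) (ts_real h) (fun q q' δ h h' => h.orbit h') ?_
  rintro q q' δ δ' _ _ h1 h2 ⟨u, hu, rfl⟩
  exact (h1.rot hu).uniq ha h2

def sgz : Bool → ℤ := fun s => if s then 1 else -1

def pat (c : Fin 4 → ℤ) (i : Equiv.Perm (Fin 4) × Bool) : Fin 4 → ℤ := fun k => sgz i.2 * c (i.1 k)

lemma ts_card {D : Fin 4 → ℝ} (c : Fin 4 → ℤ) {n : ℕ} (hn : (Finset.univ.image (pat c)).card = n)
    (h1 : ∀ k l, D k = D l ↔ c k = c l) (h2 : ∀ k l, D k = -D l ↔ c k = -c l) : (TS D).ncard = n := by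
  have e : TS D = (fun i : Equiv.Perm (Fin 4) × Bool => fun k => (sgz i.2 : ℝ) * D (i.1 k)) '' Set.univ := by
    ext δ
    constructor
    · rintro ⟨σ, ε, rfl | rfl, rfl⟩
      · exact ⟨(σ, true), trivial, by simp [sgz]⟩
      · exact ⟨(σ, false), trivial, by simp [sgz]⟩
    · rintro ⟨⟨σ, s⟩, -, rfl⟩
      refine ⟨σ, sgz s, ?_, rfl⟩
      cases s <;> simp [sgz]
  have key : ∀ i j : Equiv.Perm (Fin 4) × Bool, (fun k => (sgz i.2 : ℝ) * D (i.1 k)) = (fun k => (sgz j.2 : ℝ) * D (j.1 k)) ↔ pat c i = pat c j := by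
    rintro ⟨σ, s⟩ ⟨τ, t⟩
    rw [funext_iff, funext_iff]
    refine forall_congr' fun k => ?_
    cases s <;> cases t <;> simp [pat, sgz, h1, neg_eq_iff_eq_neg, h2]
  have hf : ∃ g : (Fin 4 → ℤ) → (Fin 4 → ℝ), ∀ i, g (pat c i) = fun k => (sgz i.2 : ℝ) * D (i.1 k) := by
    refine ⟨Function.extend (pat c) (fun i => fun k => (sgz i.2 : ℝ) * D (i.1 k)) 0, fun i => ?_⟩
    rw [Function.FactorsThrough.extend_apply]
    intro i j h
    exact (key i j).2 h
  obtain ⟨g, hg⟩ := hf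
  have e2 : TS D = g '' (Finset.univ.image (pat c) : Finset (Fin 4 → ℤ)) := by
    rw [e, Finset.coe_image, Set.image_image, Finset.coe_univ]
    simp only [hg]
  rw [e2, Set.ncard_image_of_injOn, Set.ncard_coe_finset, hn]
  intro p hp p' hp' h
  simp only [Finset.coe_image, Finset.coe_univ, Set.image_univ, Set.mem_range] at hp hp'
  obtain ⟨i, rfl⟩ := hp
  obtain ⟨j, rfl⟩ := hp'
  rw [hg, hg] at h
  exact (key i j).1 h

lemma ts_lin {x : ℝ} (hx : 0 < x) {D : Fin 4 → ℝ} (c : Fin 4 → ℤ) {n : ℕ} (hn : (Finset.univ.image (pat c)).card = n)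
    (h : ∀ k, D k = x * c k) : (TS D).ncard = n := by
  refine ts_card c hn (fun k l => ?_) (fun k l => ?_)
  · rw [h, h, mul_right_inj' hx.ne', Int.cast_inj]
  · rw [h, h, ← mul_neg, mul_right_inj' hx.ne', ← Int.cast_neg, Int.cast_inj]

lemma card_sq {x : ℝ} (hx : 0 < x) : (TS (vsq x)).ncard = 6 :=
  ts_lin hx ![1,1,-1,-1] (by decide +kernel) (fin4_all (by simp [vsq]) (by simp [vsq]) (by simp [vsq]) (by simp [vsq]))

lemma card_eq {x : ℝ} (hx : 0 < x) : (TS (veq x)).ncard = 8 :=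
  ts_lin hx ![-3,1,1,1] (by decide +kernel)
    (fin4_all (by simp [veq]; ring) (by simp [veq]) (by simp [veq]) (by simp [veq]))

lemma card_iso {r w : ℝ} (hr : 1 < r) (hw : 0 < w) : (TS (viso r w)).ncard = 24 := by
  have e : viso r w = ![-(2*w+r*w), w, w, r*w] := by
    funext k; revert k; refine fin4_all ?_ ?_ ?_ ?_ <;> simp [viso]; ring
  have h : w < r*w := by nlinarith
  rw [e]
  generalize r*w = s at *
  refine ts_card ![-3,1,1,2] (by decide +kernel) ?_ ?_
  · refine fin4_all ?_ ?_ ?_ ?_ <;> refine fin4_all ?_ ?_ ?_ ?_ <;> simp only [Matrix.cons_val] <;> norm_num <;> intro h0 <;> linarith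
  · refine fin4_all ?_ ?_ ?_ ?_ <;> refine fin4_all ?_ ?_ ?_ ?_ <;> simp only [Matrix.cons_val] <;> norm_num <;> (try intro h0) <;> linarith

def TC (α β : ℝ) : Set (Fin 4 → ℝ) := {x | ∃ σ : Equiv.Perm (Fin 4), x = vcol α β ∘ σ ∧ x 0 < 0}

lemma card_col {b α β : ℝ} (h0 : 0 < α) (h1 : α < β) (hr : RC b (vcol α β)) : (TC α β).ncard = 12 := by
  have hinj : Function.Injective (vcol α β) := by
    intro k l h
    by_contra hne
    exact hr.1 k l hne h
  have hs : ∀ k, vcol α β k < 0 ↔ (k = 0 ∨ k = 1) := by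
    refine fin4_all ?_ ?_ ?_ ?_ <;> simp [vcol] <;> linarith
  have e : TC α β = (fun σ : Equiv.Perm (Fin 4) => vcol α β ∘ σ) '' (Finset.univ.filter fun σ : Equiv.Perm (Fin 4) => σ 0 = 0 ∨ σ 0 = 1 : Finset (Equiv.Perm (Fin 4))) := by
    ext x
    constructor
    · rintro ⟨σ, rfl, h⟩
      exact ⟨σ, by simpa using (hs (σ 0)).1 h, rfl⟩
    · rintro ⟨σ, h, rfl⟩
      exact ⟨σ, rfl, (hs (σ 0)).2 (by simpa using h)⟩
  rw [e, Set.ncard_image_of_injective, Set.ncard_coe_finset]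
  · decide +kernel
  · intro σ τ h
    ext k
    have := congrFun h k
    exact congrArg Fin.val (hinj this)

def RCol (q : E4) (x : Fin 4 → ℝ) : Prop := ∃ u : ℂ, ‖u‖ = 1 ∧ q = fun k => u * x k

lemma pc_card {b α β : ℝ} (h0 : 0 < α) (h1 : α < β) (hr : RC b (vcol α β)) : (Orb fun q => ∃ x ∈ TC α β, RCol q x).ncard = 12 := by
  rw [← card_col h0 h1 hr]
  refine orb_card (TC α β) RCol ?_ ?_ ?_
  · intro x _
    exact ⟨fun k => x k, 1, by simp, by simp⟩
  · rintro q q' x ⟨u, hu, rfl⟩ ⟨u', hu', rfl⟩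
    have hu0 : u ≠ 0 := by intro h; simp [h] at hu
    exact ⟨u'*u⁻¹, by simp [hu, hu'], by funext k; field_simp⟩
  · rintro q q' x x' ⟨σ, rfl, h⟩ ⟨τ, rfl, h'⟩ ⟨u, hu, rfl⟩ ⟨u', hu', rfl⟩ ⟨w, hw, he⟩
    have hu0 : u' ≠ 0 := by intro h; simp [h] at hu'
    have e1 : ∀ k, (((vcol α β ∘ τ) k : ℝ):ℂ) = (u'⁻¹*w*u) * (((vcol α β ∘ σ) k : ℝ):ℂ) := by
      intro k
      have := congrFun he k
      simp only at this
      rw [mul_assoc, mul_assoc, ← this]; field_simp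
    have hn : ‖u'⁻¹*w*u‖ = 1 := by simp [hu, hu', hw]
    generalize u'⁻¹*w*u = c at *
    have hx : ((vcol α β ∘ σ) 0 : ℝ) ≠ 0 := h.ne
    have hc : c.im = 0 := by
      have := congrArg Complex.im (e1 0)
      simp only [Complex.ofReal_im, Complex.im_mul_ofReal] at this
      rcases mul_eq_zero.1 this.symm with h | h
      · exact h
      · exact absurd h hx
    have hre : ∀ k, (vcol α β ∘ τ) k = c.re * (vcol α β ∘ σ) k := by
      intro k
      have := congrArg Complex.re (e1 k)
      simpa only [Complex.ofReal_re, Complex.re_mul_ofReal] using this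
    have hc1 : c.re = 1 := by
      have hs : c.re*c.re + c.im*c.im = 1 := by rw [← Complex.normSq_apply, normSq_unit hn]
      have h3 := hre 0
      rw [hc] at hs
      have : 0 < c.re := by
        by_contra hcc
        push Not at hcc
        have := mul_nonneg_of_nonpos_of_nonpos hcc h.le
        linarith
      nlinarith
    funext k
    rw [hre k, hc1, one_mul]

lemma col_class {b α β : ℝ} (hb : 3/2 ≤ b) (h0 : 0 < α) (h1 : α < β) (hr : RC b (vcol α β)) {q : E4} (h : IsCC b q) (hc : Coll q) :
    ∃ x ∈ TC α β, RCol q x := by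
  obtain ⟨u, hu, x, hx⟩ := hc
  have hq : q = fun k => u * x k := funext hx
  rw [hq, coll_cc hu] at h
  have hmono : StrictMono (vcol α β) := by
    rw [Fin.strictMono_iff_lt_succ]
    intro i; fin_cases i <;> simp [vcol] <;> linarith
  have hσ : StrictMono (x ∘ Tuple.sort x) := by
    refine (Tuple.monotone_sort x).strictMono_of_injective ?_
    refine Function.Injective.comp ?_ (Tuple.sort x).injective
    intro k l hkl
    by_contra hne
    exact h.1 k l hne hkl
  have hrc : RC b (x ∘ Tuple.sort x) := by
    refine ⟨fun k l hkl => h.1 _ _ (fun e => hkl ((Tuple.sort x).injective e)), fun k => ?_⟩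
    refine Eq.trans ?_ (h.2 (Tuple.sort x k))
    exact Equiv.sum_comp (Tuple.sort x) (fun l => ph b (x (Tuple.sort x k) - x l))
  have he := rc_uniq hb hrc hr hσ hmono
  have hxe : x = vcol α β ∘ (Tuple.sort x).symm := by
    rw [← he]; funext k; simp
  generalize (Tuple.sort x).symm = σ at hxe
  subst hxe
  have hne : ∀ k, vcol α β k < 0 ∨ 0 < vcol α β k := by
    have hβ := h0.trans h1
    exact fin4_all (Or.inl (neg_neg_of_pos hβ)) (Or.inl (neg_neg_of_pos h0)) (Or.inr h0) (Or.inr hβ)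
  rcases hne (σ 0) with hs | hs
  · exact ⟨_, ⟨σ, rfl, hs⟩, u, hu, hq⟩
  · have hrev : ∀ k, vcol α β (Fin.revPerm k) = - vcol α β k := by
      refine fin4_all ?_ ?_ ?_ ?_ <;> simp [vcol, Fin.rev]
    refine ⟨vcol α β ∘ (σ.trans Fin.revPerm), ⟨_, rfl, ?_⟩, -u, by simpa using hu, ?_⟩
    · simp only [Function.comp, Equiv.trans_apply, hrev]; linarith
    · rw [hq]; funext k
      simp only [Function.comp, Equiv.trans_apply, hrev]; push_cast; ring

lemma col_prop {b α β : ℝ} (hb : 3/2 ≤ b) (h0 : 0 < α) (h1 : α < β) (hr : RC b (vcol α β)) {q : E4} (h : ∃ x ∈ TC α β, RCol q x) :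
    IsCC b q ∧ Coll q ∧ HIdx (Hs b q) 2 := by
  obtain ⟨x, ⟨σ, rfl, -⟩, u, hu, rfl⟩ := h
  refine ⟨?_, ⟨u, hu, _, fun k => rfl⟩, ?_⟩
  · rw [coll_cc hu]
    refine ⟨fun k l hkl => hr.1 _ _ (fun e => hkl (σ.injective e)), fun k => ?_⟩
    refine Eq.trans ?_ (hr.2 (σ k))
    exact Equiv.sum_comp σ (fun l => ph b (vcol α β (σ k) - vcol α β l))
  · apply HIdx.perm σ.symm
    have := (col_idx hb h0 h1 hr).unit hu
    convert this using 2
    funext k; simp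

lemma coll_ur {q q' : E4} (h : Coll q') (hu : UR q q') : Coll q := by
  obtain ⟨w, hw, x, hx⟩ := h
  obtain ⟨u, hu, rfl⟩ := hu
  have hu0 : u ≠ 0 := by intro h; simp [h] at hu
  refine ⟨u⁻¹*w, by simp [hu, hw], x, fun k => ?_⟩
  rw [mul_assoc, ← hx k]; simp [hu0]

lemma cc_unit {b : ℝ} {u : ℂ} (hu : ‖u‖ = 1) {q : E4} (h : IsCC b q) : IsCC b (fun k => u * q k) := by
  have hu0 : u ≠ 0 := by intro h; simp [h] at hu
  refine ⟨fun k l hkl e => h.1 k l hkl (mul_left_cancel₀ hu0 e), fun k => ?_⟩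
  have := congrArg (fun z => u*z) (h.2 k)
  simp only [mul_sum] at this
  rw [show 4*(u*q k) = u*(4*q k) by ring, ← this]
  refine sum_congr rfl fun l _ => ?_
  rw [dsq_rot hu]; ring

lemma pt_disj {a b : ℝ} {D D' : Fin 4 → ℝ} {n m : ℕ} (hnm : n ≠ m) (h : ∀ q, PT a D q → HIdx (Hs b q) n) (h' : ∀ q, PT a D' q → HIdx (Hs b q) m)
    (q q' : E4) (hq : PT a D q) (hq' : PT a D' q') (hu : UR q q') : False := by
  obtain ⟨u, hu, rfl⟩ := hu
  obtain ⟨δ, hδ, hR⟩ := hq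
  have h1 := h _ ⟨δ, hδ, hR.rot hu⟩
  have h2 := h' _ hq'
  obtain ⟨V, hV, hV'⟩ := h1.1
  obtain ⟨W, hW, hW'⟩ := h2.1
  have := h1.2 W hW'
  have := h2.2 V hV'
  omega

lemma orb_congr {f : E4 → ℝ} {P : E4 → Prop} {i : ℕ} (h : ∀ q, (q ∈ critSet 4 f ∧ morseIndex f q = i) ↔ P q) :
    {O : Set (Fin 4 → ℂ) | ∃ q ∈ critSet 4 f, O = rotOrbit 4 q ∧ morseIndex f q = i} = Orb P := by
  ext O
  constructor
  · rintro ⟨q, h1, h2, h3⟩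
    exact ⟨q, (h q).1 ⟨h1, h3⟩, h2⟩
  · rintro ⟨q, h1, h2⟩
    exact ⟨q, ((h q).2 h1).1, h2, ((h q).2 h1).2⟩

lemma main_aux (A : ℝ) (hA : 3 ≤ A) (f : E4 → ℝ) (hf : FForm A f) :
    (∀ q ∈ critSet 4 f, ∀ u : ℂ, ‖u‖ = 1 → (fun k => u * q k) ∈ critSet 4 f) ∧
      {O : Set (Fin 4 → ℂ) | ∃ q ∈ critSet 4 f, O = rotOrbit 4 q}.ncard = 50 ∧
      {O : Set (Fin 4 → ℂ) | ∃ q ∈ critSet 4 f, O = rotOrbit 4 q ∧ morseIndex f q = 0}.ncard = 6 ∧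
      {O : Set (Fin 4 → ℂ) | ∃ q ∈ critSet 4 f, O = rotOrbit 4 q ∧ morseIndex f q = 1}.ncard = 24 ∧
      {O : Set (Fin 4 → ℂ) | ∃ q ∈ critSet 4 f, O = rotOrbit 4 q ∧ morseIndex f q = 2}.ncard = 20 := by
  obtain ⟨b, hbA⟩ : ∃ b, b = A/2 := ⟨_, rfl⟩
  obtain ⟨a, haA⟩ : ∃ a, a = 2/A := ⟨_, rfl⟩
  have hb : 3/2 ≤ b := by rw [hbA]; linarith
  have ha : 0 < a := by rw [haA]; positivity
  have hab : a*b = 1 := by rw [haA, hbA]; field_simp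
  have hcrit := crit_iff hA hf
  rw [← hbA] at hcrit
  have hmor : ∀ q, IsCC b q → ∀ n, HIdx (Hs b q) n → morseIndex f q = n := by
    intro q hq n hn
    rw [hbA] at hn
    exact hn.morse hA hf hq.1
  obtain ⟨x, hx⟩ := psq_exists ha hab
  obtain ⟨z, hz⟩ := peq_exists ha hab
  obtain ⟨r, w, hrw⟩ := piso_exists ha hab hb
  obtain ⟨α, β, h0, h1, hr⟩ := rc_exists hb
  have iS : ∀ q, PT a (vsq x) q → HIdx (Hs b q) 0 := fun q ⟨δ, hδ, hq⟩ => ts_idx (fun q h => sq_idx ha hab hb hx h) hδ hq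
  have iE : ∀ q, PT a (veq z) q → HIdx (Hs b q) 2 := fun q ⟨δ, hδ, hq⟩ => ts_idx (fun q h => eq_idx ha hab hb hz h) hδ hq
  have iI : ∀ q, PT a (viso r w) q → HIdx (Hs b q) 1 := fun q ⟨δ, hδ, hq⟩ => ts_idx (fun q h => iso_idx ha hab hb hrw h) hδ hq
  have ccT : ∀ D q, PT a D q → IsCC b q := fun D q ⟨δ, hδ, hq⟩ => hq.1.cc hab
  have ncT : ∀ D q, PT a D q → ¬ Coll q := fun D q ⟨δ, hδ, hq⟩ => hq.not_coll
  have hC := fun q (h : ∃ x ∈ TC α β, RCol q x) => col_prop hb h0 h1 hr h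
  have cases : ∀ q, IsCC b q → PT a (vsq x) q ∨ PT a (viso r w) q ∨ PT a (veq z) q ∨ ∃ x ∈ TC α β, RCol q x := by
    intro q hq
    by_cases hc : Coll q
    · exact Or.inr (Or.inr (Or.inr (col_class hb h0 h1 hr hq hc)))
    · obtain ⟨δ, hδ⟩ := cc_rel ha hab hq hc
      obtain ⟨σ, ε, hε, ⟨x', p1, p2, p3, rfl⟩ | ⟨z', p1, p2, p3, rfl⟩ | ⟨r', w', p1, p2, p3, rfl⟩⟩ := classify ha hab hb hδ.1.ds
      · left
        obtain rfl := psq_uniq ha hab (⟨p1, p2, p3⟩ : PSq a x') hx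
        exact ⟨_, ⟨σ, ε, hε, rfl⟩, hδ⟩
      · right; right; left
        obtain rfl := peq_uniq ha hab (⟨p1, p2, p3⟩ : PEq a z') hz
        exact ⟨_, ⟨σ, ε, hε, rfl⟩, hδ⟩
      · right; left
        obtain ⟨rfl, rfl⟩ := piso_uniq ha hab hb (⟨p1, p2, p3⟩ : PIso a r' w') hrw
        exact ⟨_, ⟨σ, ε, hε, rfl⟩, hδ⟩
  have nS : (Orb (PT a (vsq x))).ncard = 6 := by rw [pt_card ha (sq_real hx), card_sq hx.1]
  have nE : (Orb (PT a (veq z))).ncard = 8 := by rw [pt_card ha (eq_real hz), card_eq hz.1]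
  have nI : (Orb (PT a (viso r w))).ncard = 24 := by rw [pt_card ha (iso_real hrw), card_iso hrw.1 hrw.2.1]
  have nC := pc_card h0 h1 hr
  have fS := Set.finite_of_ncard_ne_zero (by rw [nS]; norm_num)
  have fE := Set.finite_of_ncard_ne_zero (by rw [nE]; norm_num)
  have fI := Set.finite_of_ncard_ne_zero (by rw [nI]; norm_num)
  have fC := Set.finite_of_ncard_ne_zero (by rw [nC]; norm_num)
  have hTC : ∀ D q q', PT a D q → (∃ x ∈ TC α β, RCol q' x) → UR q q' → False :=
    fun D q q' h h' hu => ncT D q h (coll_ur (hC q' h').2.1 hu)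
  have n2 := orb_or fE fC (hTC _)
  rw [nE, nC] at n2
  have f2 := Set.finite_of_ncard_ne_zero (by rw [n2]; norm_num)
  have n3 := orb_or fI f2 (by
    rintro q q' h (h' | h') hu
    · exact pt_disj (by norm_num) iI iE q q' h h' hu
    · exact hTC _ q q' h h' hu)
  rw [nI, n2] at n3
  have f3 := Set.finite_of_ncard_ne_zero (by rw [n3]; norm_num)
  have n4 := orb_or fS f3 (by
    rintro q q' h (h' | h' | h') hu
    · exact pt_disj (by norm_num) iS iI q q' h h' hu
    · exact pt_disj (by norm_num) iS iE q q' h h' hu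
    · exact hTC _ q q' h h' hu)
  rw [nS, n3] at n4
  refine ⟨?_, ?_, ?_, ?_, ?_⟩
  · intro q hq u hu
    rw [hcrit] at hq ⊢
    exact cc_unit hu hq
  · refine Eq.trans (congrArg Set.ncard ?_) n4
    ext O
    constructor
    · rintro ⟨q, hq, rfl⟩
      exact ⟨q, cases q ((hcrit q).1 hq), rfl⟩
    · rintro ⟨q, hq, rfl⟩
      refine ⟨q, (hcrit q).2 ?_, rfl⟩
      rcases hq with h | h | h | h
      · exact ccT _ q h
      · exact ccT _ q h
      · exact ccT _ q h
      · exact (hC q h).1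
  all_goals
    have mS : ∀ q, PT a (vsq x) q → morseIndex f q = 0 := fun q h => hmor q (ccT _ q h) _ (iS q h)
    have mE : ∀ q, PT a (veq z) q → morseIndex f q = 2 := fun q h => hmor q (ccT _ q h) _ (iE q h)
    have mI : ∀ q, PT a (viso r w) q → morseIndex f q = 1 := fun q h => hmor q (ccT _ q h) _ (iI q h)
    have mC : ∀ q, (∃ x ∈ TC α β, RCol q x) → morseIndex f q = 2 := fun q h => hmor q (hC q h).1 _ (hC q h).2.2
  · rw [orb_congr (P := PT a (vsq x)), nS]
    intro q
    rw [hcrit]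
    constructor
    · rintro ⟨hq, hm⟩
      rcases cases q hq with h | h | h | h
      · exact h
      · rw [mI q h] at hm; omega
      · rw [mE q h] at hm; omega
      · rw [mC q h] at hm; omega
    · intro h; exact ⟨ccT _ q h, mS q h⟩
  · rw [orb_congr (P := PT a (viso r w)), nI]
    intro q
    rw [hcrit]
    constructor
    · rintro ⟨hq, hm⟩
      rcases cases q hq with h | h | h | h
      · rw [mS q h] at hm; omega
      · exact h
      · rw [mE q h] at hm; omega
      · rw [mC q h] at hm; omega
    · intro h; exact ⟨ccT _ q h, mI q h⟩
  · rw [orb_congr (P := fun q => PT a (veq z) q ∨ ∃ x ∈ TC α β, RCol q x), n2]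
    intro q
    rw [hcrit]
    constructor
    · rintro ⟨hq, hm⟩
      rcases cases q hq with h | h | h | h
      · rw [mS q h] at hm; omega
      · rw [mI q h] at hm; omega
      · exact Or.inl h
      · exact Or.inr h
    · rintro (h | h)
      · exact ⟨ccT _ q h, mE q h⟩
      · exact ⟨(hC q h).1, mC q h⟩

/-- For `A ≥ 3` and four equal unit masses, the set of critical points of
`f(q) = 2·∑‖q_k‖² + (1/(A-2))·∑_{k<l}‖q_k - q_l‖^(2-A)` is invariant under the diagonal
`SO(2)`-action and consists of exactly `50` rotation orbits, of which exactly `6` have Morse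
index `0`, exactly `24` have Morse index `1`, and exactly `20` have Morse index `2`; i.e.
the Morse polynomial of `f` on the quotient configuration space is `6 + 24t + 20t²`. -/
theorem four_body_morse_polynomial
    (A : ℝ) (hA : 3 ≤ A)
    (f : (Fin 4 → ℂ) → ℝ)
    (hf : ∀ q : Fin 4 → ℂ, (∀ k l, k ≠ l → q k ≠ q l) →
      f q = 2 * ∑ k, ‖q k‖ ^ 2 +
        (1 / (A - 2)) * ∑ k, ∑ l ∈ Finset.Ioi k, ‖q k - q l‖ ^ (2 - A)) :
    (∀ q ∈ critSet 4 f, ∀ u : ℂ, ‖u‖ = 1 → (fun k => u * q k) ∈ critSet 4 f) ∧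
      {O : Set (Fin 4 → ℂ) | ∃ q ∈ critSet 4 f, O = rotOrbit 4 q}.ncard = 50 ∧
      {O : Set (Fin 4 → ℂ) |
        ∃ q ∈ critSet 4 f, O = rotOrbit 4 q ∧ morseIndex f q = 0}.ncard = 6 ∧
      {O : Set (Fin 4 → ℂ) |
        ∃ q ∈ critSet 4 f, O = rotOrbit 4 q ∧ morseIndex f q = 1}.ncard = 24 ∧
      {O : Set (Fin 4 → ℂ) |
        ∃ q ∈ critSet 4 f, O = rotOrbit 4 q ∧ morseIndex f q = 2}.ncard = 20 := by
  exact main_aux A hA f hf
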